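/- Let n ∈ ℕ, let C_nuc_n be the class of separable unital C*-algebras D with nuclear dimension dim_nuc(D) ≤ n, let P ⊆ A be an inclusion of separable unital C*-algebras, and let E : A → P be a faithful conditional expectation of index finite type with the Rokhlin property. If A is a unital local C_nuc_n-algebra, then dim_nuc(P) ≤ n. -/

import Mathlib

noncomputable section
set_option linter.unusedSectionVars false

open scoped ComplexOrder Matrix.Norms.L2Operator
open Filter Topology

/-- An element of a `*`-ring is *positive* (in the C*-algebraic sense) if it has the
form `star y * y`. -/
def IsPosElem {R : Type*} [Mul R] [Star R] (a : R) : Prop :=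
  ∃ y : R, a = star y * y

/-- A linear functional on a unital complex `*`-algebra is a *tracial state* if it is unital,
positive and tracial. -/
def IsTracialState {R : Type*} [Ring R] [StarRing R] [Module ℂ R] (τ : R →ₗ[ℂ] ℂ) : Prop :=
  τ 1 = 1 ∧ (∀ x : R, 0 ≤ τ (star x * x)) ∧ ∀ a b : R, τ (a * b) = τ (b * a)

/-- A linear map between complex `*`-algebras is *completely positive* if all of its matrix
amplifications map positive elements to positive elements. -/
def IsCompletelyPositive {A B : Type*} [Ring A] [StarRing A] [Module ℂ A]
    [Ring B] [StarRing B] [Module ℂ B] (φ : A →ₗ[ℂ] B) : Prop :=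
  ∀ (k : ℕ) (x : Matrix (Fin k) (Fin k) A), IsPosElem x → IsPosElem (x.map φ)

/-- A map has *order zero* on a subset if it preserves orthogonality there. -/
def OrderZeroOn {F D : Type*} [Mul F] [Zero F] [Mul D] [Zero D] (φ : F → D) (s : Set F) : Prop :=
  ∀ e ∈ s, ∀ f ∈ s, e * f = 0 → f * e = 0 → φ e * φ f = 0 ∧ φ f * φ e = 0

/-- The finite-dimensional C*-algebra `⊕_{i=1}^s M_{r i}(ℂ)`. -/
abbrev FDBlock (s : ℕ) (r : Fin s → ℕ) : Type :=
  ∀ i : Fin s, Matrix (Fin (r i)) (Fin (r i)) ℂ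

/-- The elements of `⊕_{i=1}^s M_{r i}(ℂ)` supported on the blocks with label `j`. -/
def blockSupp {s : ℕ} {r : Fin s → ℕ} {n : ℕ} (J : Fin s → Fin (n + 1)) (j : Fin (n + 1)) :
    Set (FDBlock s r) :=
  {x | ∀ i : Fin s, J i ≠ j → x i = 0}

/-- `DecompositionRankLE n D` : the C*-algebra `D` has decomposition rank at most `n`. -/
def DecompositionRankLE (n : ℕ) (D : Type*) [NormedRing D] [StarRing D]
    [NormedAlgebra ℂ D] : Prop :=
  ∀ (S : Finset D) (ε : ℝ), 0 < ε →
    ∃ (s : ℕ) (r : Fin s → ℕ) (J : Fin s → Fin (n + 1))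
      (ψ : D →ₗ[ℂ] FDBlock s r) (φ : FDBlock s r →ₗ[ℂ] D),
      IsCompletelyPositive ψ ∧ IsCompletelyPositive φ ∧
      (∀ a : D, ‖ψ a‖ ≤ ‖a‖) ∧ (∀ x : FDBlock s r, ‖φ x‖ ≤ ‖x‖) ∧
      (∀ j : Fin (n + 1), OrderZeroOn φ (blockSupp J j)) ∧
      ∀ a ∈ S, ‖φ (ψ a) - a‖ < ε

/-- `NuclearDimensionLE n D` : the C*-algebra `D` has nuclear dimension at most `n`. -/
def NuclearDimensionLE (n : ℕ) (D : Type*) [NormedRing D] [StarRing D]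
    [NormedAlgebra ℂ D] : Prop :=
  ∀ (S : Finset D) (ε : ℝ), 0 < ε →
    ∃ (s : ℕ) (r : Fin s → ℕ) (J : Fin s → Fin (n + 1))
      (ψ : D →ₗ[ℂ] FDBlock s r) (φ : FDBlock s r →ₗ[ℂ] D),
      IsCompletelyPositive ψ ∧ IsCompletelyPositive φ ∧
      (∀ a : D, ‖ψ a‖ ≤ ‖a‖) ∧
      (∀ j : Fin (n + 1), (∀ x ∈ blockSupp J j, ‖φ x‖ ≤ ‖x‖) ∧
        OrderZeroOn φ (blockSupp J j)) ∧
      ∀ a ∈ S, ‖φ (ψ a) - a‖ < ε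

/-- A bundled unital C*-algebra. -/
structure CStarAlg : Type 1 where
  carrier : Type
  [str : CStarAlgebra carrier]

attribute [instance] CStarAlg.str

/-- The *finite saturation* of a class `𝒞` of unital C*-algebras: the smallest class
containing `𝒞` which is closed under isomorphism, finite direct sums, matrix amplifications
and corners by nonzero projections. -/
inductive FinSat (𝒞 : CStarAlg → Prop) : CStarAlg → Prop
  | base {B : CStarAlg} : 𝒞 B → FinSat 𝒞 B
  | iso {B B' : CStarAlg} : FinSat 𝒞 B → Nonempty (B'.carrier ≃⋆ₐ[ℂ] B.carrier) →
      FinSat 𝒞 B'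
  | sum {B₁ B₂ B : CStarAlg} : FinSat 𝒞 B₁ → FinSat 𝒞 B₂ →
      Nonempty (B.carrier ≃⋆ₐ[ℂ] (B₁.carrier × B₂.carrier)) → FinSat 𝒞 B
  | matrix {B B' : CStarAlg} (k : ℕ) : FinSat 𝒞 B →
      Nonempty (B'.carrier ≃⋆ₐ[ℂ] Matrix (Fin (k + 1)) (Fin (k + 1)) B.carrier) →
      FinSat 𝒞 B'
  | corner {B B' : CStarAlg} (p : B.carrier) : FinSat 𝒞 B → p ≠ 0 → p * p = p →
      star p = p →
      (∃ ι : B'.carrier →⋆ₙₐ[ℂ] B.carrier, Function.Injective ι ∧ ι 1 = p ∧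
        Set.range ι = {x : B.carrier | p * x * p = x}) →
      FinSat 𝒞 B'

/-- `A` is a *unital local `𝒞`-algebra*. -/
def IsUnitalLocalAlg (𝒞 : CStarAlg → Prop) (A : Type*) [NormedRing A] [StarRing A]
    [NormedAlgebra ℂ A] : Prop :=
  ∀ (S : Finset A) (ε : ℝ), 0 < ε →
    ∃ B : CStarAlg, FinSat 𝒞 B ∧
      ∃ φ : B.carrier →⋆ₐ[ℂ] A, ∀ a ∈ S, ∃ b : B.carrier, ‖a - φ b‖ < ε

/-- The class of separable unital C*-algebras with decomposition rank at most `n`. -/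
def drClass (n : ℕ) : CStarAlg → Prop :=
  fun B => TopologicalSpace.SeparableSpace B.carrier ∧ DecompositionRankLE n B.carrier

/-- The class of separable unital C*-algebras with nuclear dimension at most `n`. -/
def nucClass (n : ℕ) : CStarAlg → Prop :=
  fun B => TopologicalSpace.SeparableSpace B.carrier ∧ NuclearDimensionLE n B.carrier

/-- The class of separable unital C*-algebras with finite nuclear dimension. -/
def lnucClass : CStarAlg → Prop :=
  fun B => TopologicalSpace.SeparableSpace B.carrier ∧ ∃ n : ℕ, NuclearDimensionLE n B.carrier

/-- A separable unital C*-algebra has *locally finite nuclear dimension* if it is a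
unital local `C_lnuc`-algebra. -/
def HasLocallyFiniteNuclearDimension (A : Type*) [NormedRing A] [StarRing A]
    [NormedAlgebra ℂ A] : Prop :=
  IsUnitalLocalAlg lnucClass A
/-! ### Group actions and the Rokhlin property -/

/-- `α : G → (A →⋆ₐ[ℂ] A)` is an action of the group `G` on `A` by *-automorphisms. -/
def IsGroupAction {G A : Type*} [Group G] [CStarAlgebra A] (α : G → (A →⋆ₐ[ℂ] A)) : Prop :=
  (∀ a : A, α 1 a = a) ∧ ∀ (g h : G) (a : A), α g (α h a) = α (g * h) a

/-- The fixed point algebra `A^α` of an action, as a star subalgebra of `A`. -/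
def fixedPointAlgebra {G A : Type*} [Group G] [CStarAlgebra A] (α : G → (A →⋆ₐ[ℂ] A)) :
    StarSubalgebra ℂ A where
  carrier := {a : A | ∀ g : G, α g a = a}
  mul_mem' := fun {a} {b} ha hb g => by rw [map_mul, ha g, hb g]
  add_mem' := fun {a} {b} ha hb g => by rw [map_add, ha g, hb g]
  algebraMap_mem' := fun c g => by rw [AlgHomClass.commutes]
  star_mem' := fun {a} ha g => by rw [map_star, ha g]

/-- The Rokhlin property for a finite group action, expressed in terms of representing
sequences for projections in `A_∞ = (ℓ^∞(ℕ,A)/c₀(ℕ,A)) ∩ A'`. -/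
def ActionHasRokhlin {G A : Type*} [Group G] [Fintype G] [CStarAlgebra A]
    (α : G → (A →⋆ₐ[ℂ] A)) : Prop :=
  ∃ e : G → ℕ → A,
    (∀ g, ∃ M : ℝ, ∀ k, ‖e g k‖ ≤ M) ∧
    (∀ g, Tendsto (fun k => ‖e g k * e g k - e g k‖) atTop (𝓝 0)) ∧
    (∀ g, Tendsto (fun k => ‖star (e g k) - e g k‖) atTop (𝓝 0)) ∧
    (∀ g (a : A), Tendsto (fun k => ‖e g k * a - a * e g k‖) atTop (𝓝 0)) ∧
    Tendsto (fun k => ‖(∑ g : G, e g k) - 1‖) atTop (𝓝 0) ∧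
    (∀ g h, Tendsto (fun k => ‖α g (e h k) - e (g * h) k‖) atTop (𝓝 0))

/-! ### Inclusions of unital C*-algebras, conditional expectations, Watatani index -/

variable {P A : Type*}

/-- `E : A →ₗ[ℂ] P` is a conditional expectation onto the subalgebra `P` (included in `A`
via the injective unital *-homomorphism `ι`). -/
structure IsCondExpect [CStarAlgebra P] [CStarAlgebra A] (ι : P →⋆ₐ[ℂ] A)
    (E : A →ₗ[ℂ] P) : Prop where
  restricts : ∀ p : P, E (ι p) = p
  pos : ∀ x : A, IsPosElem (E (star x * x))
  bimodule : ∀ (p q : P) (x : A), E (ι p * x * ι q) = p * E x * q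

/-- `{(u i, v i)}` is a quasi-basis for the conditional expectation `E`; the existence of a
quasi-basis says precisely that `E` is of index-finite type. -/
def IsQuasiBasis [CStarAlgebra P] [CStarAlgebra A] (ι : P →⋆ₐ[ℂ] A) (E : A →ₗ[ℂ] P)
    {m : ℕ} (u v : Fin m → A) : Prop :=
  ∀ a : A, (a = ∑ i, u i * ι (E (v i * a))) ∧ (a = ∑ i, ι (E (a * u i)) * v i)

/-- The Rokhlin property for a conditional expectation of index-finite type with index
`ind = ∑ u i * v i` : there is a projection `e` in `A_∞ = (ℓ^∞(ℕ,A)/c₀(ℕ,A)) ∩ A'`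
(given by a representing sequence) with `E^∞(e) = (Index E)⁻¹ · 1` such that `x ↦ x e`
is injective on `A`. -/
def CondExpectHasRokhlin [CStarAlgebra P] [CStarAlgebra A] (ι : P →⋆ₐ[ℂ] A)
    (E : A →ₗ[ℂ] P) (ind : A) : Prop :=
  ∃ e : ℕ → A,
    (∃ M : ℝ, ∀ k, ‖e k‖ ≤ M) ∧
    Tendsto (fun k => ‖e k * e k - e k‖) atTop (𝓝 0) ∧
    Tendsto (fun k => ‖star (e k) - e k‖) atTop (𝓝 0) ∧
    (∀ a : A, Tendsto (fun k => ‖e k * a - a * e k‖) atTop (𝓝 0)) ∧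
    (∃ w : A, w * ind = 1 ∧ ind * w = 1 ∧
      Tendsto (fun k => ‖ι (E (e k)) - w‖) atTop (𝓝 0)) ∧
    (∀ x : A, Tendsto (fun k => ‖x * e k‖) atTop (𝓝 0) → x = 0)

/-! ### Cuntz comparison, dimension functions, strict comparison, almost divisibility -/

/-- Cuntz subequivalence for positive matrices over a C*-algebra (the topology on matrices
over a C*-algebra is the norm topology, which agrees with the product topology). -/
def CuntzSub {R : Type*} [NonUnitalNonAssocSemiring R] [Star R] [TopologicalSpace R]
    {m k : Type*} [Fintype m] [Fintype k] (a : Matrix m m R) (b : Matrix k k R) : Prop :=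
  ∃ v : ℕ → Matrix m k R, Tendsto (fun j => v j * b * (v j).conjTranspose) atTop (𝓝 a)

/-- `matNthRoot a j` is the (unique, if it exists) positive `j`-th root `a^{1/j}` of a
positive matrix `a` over a C*-algebra. -/
def matNthRoot {R : Type*} [Ring R] [StarRing R] {m : Type*} [Fintype m] [DecidableEq m]
    (a : Matrix m m R) (j : ℕ) : Matrix m m R :=
  open scoped Classical in
  if h : ∃ b : Matrix m m R, IsPosElem b ∧ b ^ j = a then h.choose else 0

/-- The standard extension `τ ⊗ Tr` of a functional `τ` to matrices. -/
def traceExt {R : Type*} [Ring R] [Module ℂ R] {m : Type*} [Fintype m]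
    (τ : R →ₗ[ℂ] ℂ) (x : Matrix m m R) : ℂ :=
  ∑ i, τ (x i i)

/-- The dimension function `d_τ(a) = lim_{n → ∞} τ(a^{1/n})` associated to a tracial
state `τ` (the limit exists, so it agrees with the `limsup` used here). -/
def dimFun {R : Type*} [Ring R] [StarRing R] [Module ℂ R] {m : Type*} [Fintype m]
    [DecidableEq m] (τ : R →ₗ[ℂ] ℂ) (a : Matrix m m R) : ℝ :=
  Filter.limsup (fun j : ℕ => (traceExt τ (matNthRoot a (j + 1))).re) atTop

/-- A unital C*-algebra `R` has *strict comparison* (of positive elements, with respect to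
tracial states) if `d_τ(a) < d_τ(b)` for all tracial states `τ` implies `a ≾ b`. -/
def HasStrictComparison (R : Type*) [Ring R] [StarRing R] [Module ℂ R]
    [TopologicalSpace R] : Prop :=
  ∀ (m k : ℕ) (a : Matrix (Fin m) (Fin m) R) (b : Matrix (Fin k) (Fin k) R),
    IsPosElem a → IsPosElem b →
    (∀ τ : R →ₗ[ℂ] ℂ, IsTracialState τ → dimFun τ a < dimFun τ b) →
    CuntzSub a b

/-- The Cuntz semigroup `W(R)` is *almost divisible*: for every positive contraction `a`
over `R` and every `k ≠ 0` there is `x = ⟨c⟩ ∈ W(R)` with `k ⬝ x ≤ ⟨a⟩ ≤ (k+1) ⬝ x`. -/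
def AlmostDivisible (R : Type*) [Ring R] [StarRing R] [TopologicalSpace R] : Prop :=
  ∀ (m : ℕ) (a : Matrix (Fin m) (Fin m) R),
    IsPosElem a → IsPosElem ((1 : Matrix (Fin m) (Fin m) R) - a) →
    ∀ k : ℕ, k ≠ 0 →
      ∃ (l : ℕ) (c : Matrix (Fin l) (Fin l) R), IsPosElem c ∧
        CuntzSub (Matrix.blockDiagonal fun _ : Fin k => c) a ∧
        CuntzSub a (Matrix.blockDiagonal fun _ : Fin (k + 1) => c)

/-- A unital C*-algebra is *pure* if it has strict comparison and almost divisible Cuntz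
semigroup. -/
def IsPure (R : Type*) [Ring R] [StarRing R] [Module ℂ R] [TopologicalSpace R] : Prop :=
  HasStrictComparison R ∧ AlmostDivisible R

/-- The order on projections over `R` is determined by traces. -/
def ProjOrderDeterminedByTraces (R : Type*) [Ring R] [StarRing R] [Module ℂ R] : Prop :=
  ∀ (k l : ℕ) (p : Matrix (Fin k) (Fin k) R) (q : Matrix (Fin l) (Fin l) R),
    p * p = p → star p = p → q * q = q → star q = q →
    (∀ τ : R →ₗ[ℂ] ℂ, IsTracialState τ → (traceExt τ p).re < (traceExt τ q).re) →
    ∃ v : Matrix (Fin l) (Fin k) R,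
      v.conjTranspose * v = p ∧ IsPosElem (q - v * v.conjTranspose)

/-- A unital C*-algebra has stable rank one if its invertible elements are dense. -/
def HasStableRankOne (R : Type*) [Ring R] [TopologicalSpace R] : Prop :=
  Dense {x : R | IsUnit x}

/-- A unital C*-algebra is simple if it has no nontrivial closed two-sided ideals. -/
def IsSimpleCStarAlgebra (A : Type*) [CStarAlgebra A] : Prop :=
  ∀ I : TwoSidedIdeal A, IsClosed (I : Set A) → I = ⊥ ∨ I = ⊤
/-! ### Corners `pRp` by a projection `p` -/

section CornerSection

variable {R : Type*} [Ring R] [StarRing R] [Algebra ℂ R] [StarModule ℂ R]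

/-- The corner `p R p` of a unital C*-algebra `R` by a projection `p`, as a unital
`*`-algebra with unit `p`. -/
def Corner (p : R) (_hp : p * p = p) (_hsp : star p = p) : Type _ :=
  {x : R // p * x * p = x}

namespace Corner

variable {p : R} {hp : p * p = p} {hsp : star p = p}

theorem mem_mul_left (hp : p * p = p) {x : R} (hx : p * x * p = x) : p * x = x := by
  conv_lhs => rw [← hx]
  simp only [← mul_assoc]
  rw [hp, hx]

theorem mem_mul_right (hp : p * p = p) {x : R} (hx : p * x * p = x) : x * p = x := by
  conv_lhs => rw [← hx]
  rw [mul_assoc, mul_assoc, hp, ← mul_assoc, hx]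

instance : Add (Corner p hp hsp) :=
  ⟨fun x y => ⟨x.1 + y.1, by rw [mul_add, add_mul, x.2, y.2]⟩⟩

instance : Zero (Corner p hp hsp) :=
  ⟨⟨0, by rw [mul_zero, zero_mul]⟩⟩

instance : Neg (Corner p hp hsp) :=
  ⟨fun x => ⟨-x.1, by rw [mul_neg, neg_mul, x.2]⟩⟩

instance : Mul (Corner p hp hsp) :=
  ⟨fun x y => ⟨x.1 * y.1, by
    rw [← mul_assoc p x.1 y.1, mem_mul_left hp x.2, mul_assoc x.1 y.1 p,
      mem_mul_right hp y.2]⟩⟩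

instance : One (Corner p hp hsp) :=
  ⟨⟨p, by rw [hp, hp]⟩⟩

instance : SMul ℂ (Corner p hp hsp) :=
  ⟨fun c x => ⟨c • x.1, by rw [mul_smul_comm, smul_mul_assoc, x.2]⟩⟩

instance : Star (Corner p hp hsp) :=
  ⟨fun x => ⟨star x.1, by
    conv_rhs => rw [← x.2]
    rw [star_mul, star_mul, hsp, ← mul_assoc]⟩⟩

@[simp] theorem val_add (x y : Corner p hp hsp) : (x + y).1 = x.1 + y.1 := rfl
@[simp] theorem val_mul (x y : Corner p hp hsp) : (x * y).1 = x.1 * y.1 := rfl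
@[simp] theorem val_zero : (0 : Corner p hp hsp).1 = 0 := rfl
@[simp] theorem val_one : (1 : Corner p hp hsp).1 = p := rfl
@[simp] theorem val_neg (x : Corner p hp hsp) : (-x).1 = -x.1 := rfl
@[simp] theorem val_smul (c : ℂ) (x : Corner p hp hsp) : (c • x).1 = c • x.1 := rfl
@[simp] theorem val_star (x : Corner p hp hsp) : (star x).1 = star x.1 := rfl

instance instRing : Ring (Corner p hp hsp) where
  add_assoc x y z := Subtype.ext <| by simp [add_assoc]
  zero_add x := Subtype.ext <| by simp
  add_zero x := Subtype.ext <| by simp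
  add_comm x y := Subtype.ext <| by simp [add_comm]
  neg_add_cancel x := Subtype.ext <| by simp
  nsmul := nsmulRec
  zsmul := zsmulRec
  mul_assoc x y z := Subtype.ext <| by simp [mul_assoc]
  one_mul x := Subtype.ext <| by simpa using mem_mul_left hp x.2
  mul_one x := Subtype.ext <| by simpa using mem_mul_right hp x.2
  left_distrib x y z := Subtype.ext <| by simp [left_distrib]
  right_distrib x y z := Subtype.ext <| by simp [right_distrib]
  zero_mul x := Subtype.ext <| by simp
  mul_zero x := Subtype.ext <| by simp

instance instStarRing : StarRing (Corner p hp hsp) where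
  star_involutive x := Subtype.ext <| by simp
  star_mul x y := Subtype.ext <| by simp
  star_add x y := Subtype.ext <| by simp

instance instModule : Module ℂ (Corner p hp hsp) where
  one_smul x := Subtype.ext <| by simp
  mul_smul c d x := Subtype.ext <| by simp [mul_smul]
  smul_zero c := Subtype.ext <| by simp
  smul_add c x y := Subtype.ext <| by simp
  add_smul c d x := Subtype.ext <| by simp [add_smul]
  zero_smul x := Subtype.ext <| by simp

instance instTop [TopologicalSpace R] : TopologicalSpace (Corner p hp hsp) :=
  instTopologicalSpaceSubtype

end Corner

end CornerSection

/-! ### Sequence algebras: `A^∞ = ℓ^∞(ℕ, A)/c₀(ℕ, A)` via representing sequences -/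

/-- A sequence in a normed space is null (i.e. lies in `c₀(ℕ, A)`). -/
def IsNullSeq {A : Type*} [Norm A] (x : ℕ → A) : Prop :=
  Tendsto (fun n => ‖x n‖) atTop (𝓝 0)

/-- A sequence in a normed space is bounded (i.e. lies in `ℓ^∞(ℕ, A)`). -/
def IsBddSeq {A : Type*} [Norm A] (x : ℕ → A) : Prop :=
  ∃ M : ℝ, ∀ n, ‖x n‖ ≤ M

/-- A linear map `β : A →ₗ[ℂ] ℓ^∞(ℕ, P)` represents a unital *-homomorphism
`A → P^∞ = ℓ^∞(ℕ, P)/c₀(ℕ, P)` : it takes values in bounded sequences and is unital,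
multiplicative and star-preserving modulo `c₀(ℕ, P)`. -/
structure RepresentsHomToSeqAlg {A P : Type*} [CStarAlgebra A] [CStarAlgebra P]
    (β : A →ₗ[ℂ] (ℕ → P)) : Prop where
  bdd : ∀ x : A, IsBddSeq (β x)
  unital : IsNullSeq (β 1 - 1)
  mul : ∀ x y : A, IsNullSeq (β (x * y) - β x * β y)
  star : ∀ x : A, IsNullSeq (β (star x) - star (β x))

/-- A Banach limit: a linear functional on (bounded) complex sequences which is unital,
shift-invariant, positive and bounded. -/
structure IsBanachLimit (L : (ℕ → ℂ) →ₗ[ℂ] ℂ) : Prop where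
  unital : L 1 = 1
  shift : ∀ x : ℕ → ℂ, IsBddSeq x → L (fun n => x (n + 1)) = L x
  pos : ∀ x : ℕ → ℂ, IsBddSeq x → (∀ n, 0 ≤ x n) → 0 ≤ L x
  norm_le : ∀ (x : ℕ → ℂ) (M : ℝ), (∀ n, ‖x n‖ ≤ M) → ‖L x‖ ≤ M

/-- A C*-algebra is *exact* iff it is nuclearly embeddable (Kirchberg): it admits a faithful
representation `π : A → B(H)` which approximately factors through matrix algebras by
completely positive contractions in the point-norm topology. -/
def IsExactCStar (A : Type*) [CStarAlgebra A] : Prop :=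
  ∃ (H : Type) (_ : NormedAddCommGroup H) (_ : InnerProductSpace ℂ H) (_ : CompleteSpace H)
    (π : A →⋆ₐ[ℂ] (H →L[ℂ] H)), Function.Injective π ∧
      ∀ (S : Finset A) (ε : ℝ), 0 < ε →
        ∃ (k : ℕ) (ψ : A →ₗ[ℂ] Matrix (Fin k) (Fin k) ℂ)
          (φ : Matrix (Fin k) (Fin k) ℂ →ₗ[ℂ] (H →L[ℂ] H)),
          IsCompletelyPositive ψ ∧ IsCompletelyPositive φ ∧
          (∀ a : A, ‖ψ a‖ ≤ ‖a‖) ∧ (∀ x, ‖φ x‖ ≤ ‖x‖) ∧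
          ∀ a ∈ S, ‖φ (ψ a) - π a‖ < ε

section

section L1
variable {M : Type*} [CStarAlgebra M] [PartialOrder M] [StarOrderedRing M]

lemma cs_norm_sq_le {x : M} {c : ℝ} (hc : 0 ≤ c) (h : ‖star x * x‖ ≤ c ^ 2) : ‖x‖ ≤ c := by
  rw [CStarRing.norm_star_mul_self, ← sq] at h
  exact le_of_sq_le_sq h hc

lemma sqrt_diff_le {G B : M} {κ : ℝ} (hκ : 0 ≤ κ) (hG : 0 ≤ G) (h1 : G ≤ B)
    (h2 : B ≤ G + algebraMap ℝ M κ) : ‖CFC.sqrt B - CFC.sqrt G‖ ≤ √κ := by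
  have h3 : CFC.sqrt (G + algebraMap ℝ M κ) ≤ CFC.sqrt G + algebraMap ℝ M (√κ) := by
    have hk : 0 ≤ algebraMap ℝ M (√κ) := algebraMap_nonneg M (Real.sqrt_nonneg _)
    have hs := CFC.sqrt_nonneg G
    have e : (CFC.sqrt G + algebraMap ℝ M (√κ)) * (CFC.sqrt G + algebraMap ℝ M (√κ))
        = (G + algebraMap ℝ M κ) + (2 * √κ) • CFC.sqrt G := by
      have := CFC.sqrt_mul_sqrt_self G hG
      have e2 : algebraMap ℝ M (√κ) * algebraMap ℝ M (√κ) = algebraMap ℝ M κ := by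
        rw [← map_mul, Real.mul_self_sqrt hκ]
      have e3 : algebraMap ℝ M (√κ) * CFC.sqrt G = (√κ) • CFC.sqrt G := by
        rw [← Algebra.smul_def]
      have e4 : CFC.sqrt G * algebraMap ℝ M (√κ) = (√κ) • CFC.sqrt G := by
        rw [← Algebra.commutes, e3]
      rw [add_mul, mul_add, mul_add, this, e2, e3, e4, two_mul, add_smul]; abel
    have : CFC.sqrt ((CFC.sqrt G + algebraMap ℝ M (√κ)) * (CFC.sqrt G + algebraMap ℝ M (√κ)))
        = CFC.sqrt G + algebraMap ℝ M (√κ) := CFC.sqrt_mul_self _ (add_nonneg hs hk)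
    rw [← this, e]
    apply CFC.sqrt_le_sqrt
    exact le_add_of_nonneg_right (smul_nonneg (by positivity) hs)
  have h4 := CFC.sqrt_le_sqrt _ _ h1
  have h5 := (CFC.sqrt_le_sqrt _ _ h2).trans h3
  rw [CStarAlgebra.norm_le_iff_le_algebraMap _ (Real.sqrt_nonneg _) (sub_nonneg.2 h4)]
  exact sub_le_iff_le_add'.2 h5

lemma cfc_mul_sqrt_le {G b : M} (hG : 0 ≤ G) (h1 : G ≤ b) (k : ℝ → ℝ) (hk : Continuous k)
    {c : ℝ} (hc : 0 ≤ c) (h : ∀ t, 0 ≤ t → t * (k t) ^ 2 ≤ c ^ 2) :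
    ‖cfc k b * CFC.sqrt G‖ ≤ c := by
  have hb : 0 ≤ b := hG.trans h1
  have hsa : IsSelfAdjoint (cfc k b) := cfc_predicate _ _
  have hg : IsSelfAdjoint (CFC.sqrt G) := (CFC.sqrt_nonneg G).isSelfAdjoint
  rw [← norm_star]
  apply cs_norm_sq_le hc
  have e : star (star (cfc k b * CFC.sqrt G)) * star (cfc k b * CFC.sqrt G)
      = star (cfc k b) * G * cfc k b := by
    rw [star_star, star_mul, hsa.star_eq, hg.star_eq]
    have := CFC.sqrt_mul_sqrt_self G hG
    simp only [mul_assoc]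
    rw [← mul_assoc (CFC.sqrt G), this]
  rw [e]
  refine (CStarAlgebra.norm_le_norm_of_nonneg_of_le (star_left_conjugate_nonneg hG _)
    (star_left_conjugate_le_conjugate h1 _)).trans ?_
  have e2 : star (cfc k b) * b * cfc k b = cfc (fun t => k t * t * k t) b := by
    rw [cfc_mul _ _ _ (by fun_prop) (by fun_prop), cfc_mul _ _ _ (by fun_prop) (by fun_prop),
      cfc_id' ℝ b, hsa.star_eq]
  rw [e2]
  refine norm_cfc_le (by positivity) fun t ht => ?_
  have ht0 : 0 ≤ t := spectrum_nonneg_of_nonneg hb ht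
  have := h t ht0
  rw [Real.norm_eq_abs, abs_of_nonneg (by have := sq_nonneg (k t); nlinarith [mul_nonneg ht0 this])]
  nlinarith

def fdel (δ t : ℝ) : ℝ := 1 / √(max t 0 + δ)

lemma fdel_cont {δ : ℝ} (hδ : 0 < δ) : Continuous (fdel δ) := by
  unfold fdel
  refine Continuous.div continuous_const (by fun_prop) fun t => ?_
  have : 0 < max t 0 + δ := by positivity
  positivity

lemma fdel_mul {δ t : ℝ} (hδ : 0 < δ) (ht : 0 ≤ t) : fdel δ t * √(t + δ) = 1 := by
  unfold fdel; rw [max_eq_left ht]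
  have : 0 < √(t + δ) := by positivity
  field_simp

lemma fdel_sq {δ t : ℝ} (hδ : 0 < δ) (ht : 0 ≤ t) : fdel δ t ^ 2 * (t + δ) = 1 := by
  have := fdel_mul hδ ht
  have h2 : √(t + δ) ^ 2 = t + δ := Real.sq_sqrt (by positivity)
  calc _ = (fdel δ t * √(t + δ)) ^ 2 := by rw [mul_pow, h2]
    _ = 1 := by rw [this]; norm_num

lemma fdel_nonneg (δ t : ℝ) : 0 ≤ fdel δ t := by unfold fdel; positivity

lemma fdel_near {δ t : ℝ} (hδ : 0 < δ) (ht : 0 ≤ t) :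
    0 ≤ √t - t * fdel δ t ∧ √t - t * fdel δ t ≤ √δ := by
  have h0 : 0 < √(t + δ) := by positivity
  have h1 : √t ≤ √(t + δ) := Real.sqrt_le_sqrt (by linarith)
  have h2 : √(t + δ) ≤ √t + √δ := by
    rw [Real.sqrt_le_left (by positivity)]
    nlinarith [Real.sq_sqrt ht, Real.sq_sqrt hδ.le, Real.sqrt_nonneg t, Real.sqrt_nonneg δ, mul_nonneg (Real.sqrt_nonneg t) (Real.sqrt_nonneg δ)]
  have e : √t - t * fdel δ t = √t * (√(t + δ) - √t) * fdel δ t := by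
    have := fdel_mul hδ ht
    have h3 := Real.mul_self_sqrt ht
    calc _ = √t * (fdel δ t * √(t+δ)) - t * fdel δ t := by rw [this, mul_one]
      _ = √t * (fdel δ t * √(t+δ)) - (√t * √t) * fdel δ t := by rw [h3]
      _ = _ := by ring
  have hf := fdel_nonneg δ t
  rw [e]
  refine ⟨mul_nonneg (mul_nonneg (Real.sqrt_nonneg _) (by linarith)) hf, ?_⟩
  have h4 : √t * fdel δ t ≤ 1 := by
    rw [← fdel_mul hδ ht, mul_comm]; gcongr
  have h5 : 0 ≤ √t * fdel δ t := by positivity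
  have h6 : 0 ≤ √δ := Real.sqrt_nonneg _
  nlinarith [Real.sqrt_nonneg t]

lemma kr_core {G y : M} {κ : ℝ} (hκ : 0 ≤ κ) (hG : 0 ≤ G) (h1 : G ≤ star y * y)
    (h2 : star y * y ≤ G + algebraMap ℝ M κ) :
    ∃ (T : M) (z : ℕ → M), Tendsto (fun n => y * z n) atTop (𝓝 T) ∧ star T * T = G ∧
      ‖T - y‖ ≤ √κ := by
  set b := star y * y with hb
  have hb0 : 0 ≤ b := star_mul_self_nonneg y
  have hbs : IsSelfAdjoint b := hb0.isSelfAdjoint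
  set g := CFC.sqrt G with hgdef
  have hgs : IsSelfAdjoint g := (CFC.sqrt_nonneg G).isSelfAdjoint
  have hgg : g * g = G := CFC.sqrt_mul_sqrt_self G hG
  let δ : ℕ → ℝ := fun n => 1 / ((n : ℝ) + 1)
  have hδ : ∀ n, 0 < δ n := fun n => by positivity
  have hδ0 : Tendsto δ atTop (𝓝 0) := tendsto_one_div_add_atTop_nhds_zero_nat
  have hsδ0 : Tendsto (fun n => √(δ n)) atTop (𝓝 0) := by
    simpa [Function.comp_def] using (Real.continuous_sqrt.tendsto 0).comp hδ0
  let p : ℕ → M := fun n => cfc (fdel (δ n)) b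
  have hps : ∀ n, IsSelfAdjoint (p n) := fun n => cfc_predicate _ _
  have hpc : ∀ n, Continuous (fdel (δ n)) := fun n => fdel_cont (hδ n)
  -- norm of y * q * g
  have key : ∀ (h : ℝ → ℝ) (_ : Continuous h) (c : ℝ) (_ : 0 ≤ c)
      (_ : ∀ t, 0 ≤ t → (t * h t) ^ 2 ≤ c ^ 2), ‖y * (cfc h b * g)‖ ≤ c := by
    intro h hh c hc hle
    have hq : IsSelfAdjoint (cfc h b) := cfc_predicate _ _
    have hx : IsSelfAdjoint (cfc (fun t => √t * h t) b) := cfc_predicate _ _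
    have := cfc_mul_sqrt_le hG h1 (fun t => √t * h t) (by fun_prop) hc (fun t ht => by
      have h3 := Real.sq_sqrt ht
      calc t * (√t * h t) ^ 2 = (t * h t) ^ 2 := by rw [mul_pow, h3]; ring
        _ ≤ _ := hle t ht)
    refine le_trans (le_of_eq ?_) this
    have e : star (y * (cfc h b * g)) * (y * (cfc h b * g))
       = star (cfc (fun t => √t * h t) b * g) * (cfc (fun t => √t * h t) b * g) := by
      have e1 : cfc h b * b * cfc h b = cfc (fun t => √t * h t) b * cfc (fun t => √t * h t) b := by
        rw [← cfc_mul _ _ _ (by fun_prop) (by fun_prop)]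
        conv_lhs => enter [1, 2]; rw [← cfc_id' ℝ b]
        rw [← cfc_mul _ _ _ (by fun_prop) (by fun_prop),
          ← cfc_mul _ _ _ (by fun_prop) (by fun_prop)]
        refine cfc_congr fun t ht => ?_
        have ht0 : 0 ≤ t := spectrum_nonneg_of_nonneg hb0 ht
        have h3 := Real.mul_self_sqrt ht0
        calc h t * t * h t = h t * (√t * √t) * h t := by rw [h3]
          _ = _ := by ring
      simp only [star_mul, hq.star_eq, hgs.star_eq, hx.star_eq]
      calc _ = g * (cfc h b * (star y * y) * cfc h b) * g := by simp only [mul_assoc]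
        _ = _ := by rw [← hb, e1]; simp only [mul_assoc]
    have e2 := congrArg norm e
    rw [CStarRing.norm_star_mul_self, CStarRing.norm_star_mul_self] at e2
    exact (mul_self_inj (norm_nonneg _) (norm_nonneg _)).1 e2
  let T : ℕ → M := fun n => y * (p n * g)
  have hcau : CauchySeq T := by
    refine cauchySeq_of_le_tendsto_0 (fun n => 2 * √(δ n)) (fun n m N hn hm => ?_)
      (by simpa using hsδ0.const_mul 2)
    rw [dist_eq_norm]
    have e : T n - T m = y * (cfc (fun t => fdel (δ n) t - fdel (δ m) t) b * g) := by
      rw [cfc_sub _ _ _ (by fun_prop) (hpc m).continuousOn]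
      simp only [T, p]; noncomm_ring
    rw [e]
    have hle : ∀ k, N ≤ k → √(δ k) ≤ √(δ N) := fun k hk => by
      apply Real.sqrt_le_sqrt
      have : (N:ℝ) ≤ k := by exact_mod_cast hk
      simp only [δ]; gcongr
    refine key _ ((hpc n).sub (hpc m)) _ (by positivity) fun t ht => ?_
    have a1 := fdel_near (hδ n) ht
    have a2 := fdel_near (hδ m) ht
    have := hle n hn
    have := hle m hm
    have a3 := Real.sqrt_nonneg (δ N)
    rw [Pi.sub_apply]
    apply sq_le_sq'
    · linarith [a1.1, a1.2, a2.1, a2.2]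
    · linarith [a1.1, a1.2, a2.1, a2.2]
  obtain ⟨T0, hT0⟩ := cauchySeq_tendsto_of_complete hcau
  refine ⟨T0, fun n => p n * g, hT0, ?_, ?_⟩
  · have l1 : Tendsto (fun n => star (T n) * T n) atTop (𝓝 (star T0 * T0)) := hT0.star.mul hT0
    refine tendsto_nhds_unique l1 ?_
    rw [tendsto_iff_norm_sub_tendsto_zero]
    refine squeeze_zero (fun n => norm_nonneg _) (fun n => ?_) hδ0
    -- k = sqrt (1 - t f^2) = sqrt (δ f²)
    let k : ℝ → ℝ := fun t => √(δ n) * fdel (δ n) t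
    have hk : Continuous k := by simp only [k]; exact continuous_const.mul (hpc n)
    have hks : IsSelfAdjoint (cfc k b) := cfc_predicate _ _
    have e1 : 1 - p n * b * p n = cfc k b * cfc k b := by
      simp only [p]
      rw [← cfc_mul _ _ _ hk.continuousOn hk.continuousOn]
      conv_lhs => enter [2, 1, 2]; rw [← cfc_id' ℝ b]
      rw [← cfc_mul _ _ _ (by fun_prop) (by fun_prop),
          ← cfc_mul _ _ _ (by fun_prop) (by fun_prop),
          ← cfc_one ℝ b, ← cfc_sub _ _ _ (by fun_prop) (by fun_prop)]
      refine cfc_congr fun t ht => ?_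
      have ht0 : 0 ≤ t := spectrum_nonneg_of_nonneg hb0 ht
      have h3 := Real.mul_self_sqrt (hδ n).le
      have h4 := fdel_sq (hδ n) ht0
      simp only [k, Pi.one_apply]
      calc 1 - fdel (δ n) t * t * fdel (δ n) t = δ n * fdel (δ n) t ^ 2 := by rw [← h4]; ring
        _ = (√(δ n) * √(δ n)) * fdel (δ n) t ^ 2 := by rw [h3]
        _ = _ := by ring
    have e2 : star (T n) * T n - G = - (star (cfc k b * g) * (cfc k b * g)) := by
      rw [star_mul (cfc k b), hks.star_eq, hgs.star_eq]
      simp only [T, star_mul, (hps n).star_eq, hgs.star_eq]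
      calc _ = g * (p n * b * p n) * g - g * g := by rw [hgg, hb]; simp only [mul_assoc]
        _ = - (g * (1 - p n * b * p n) * g) := by noncomm_ring
        _ = _ := by rw [e1]; simp only [mul_assoc]
    rw [e2, norm_neg, CStarRing.norm_star_mul_self]
    have := cfc_mul_sqrt_le hG h1 k hk (Real.sqrt_nonneg (δ n)) (fun t ht => by
      have h4 := fdel_sq (hδ n) ht
      have h3 := Real.sq_sqrt (hδ n).le
      simp only [k, mul_pow, h3]
      have : 0 < fdel (δ n) t ^ 2 := by
        rcases (sq_nonneg (fdel (δ n) t)).lt_or_eq with h | h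
        · exact h
        · rw [← h] at h4; simp at h4
      nlinarith [hδ n, mul_pos (hδ n) (mul_pos (hδ n) this)])
    calc _ ≤ √(δ n) * √(δ n) := by gcongr
      _ = _ := Real.mul_self_sqrt (hδ n).le
  · have hlim : Tendsto (fun n => √(κ + δ n)) atTop (𝓝 (√κ)) := by
      have : Tendsto (fun n => κ + δ n) atTop (𝓝 (κ + 0)) := tendsto_const_nhds.add hδ0
      rw [add_zero] at this
      exact (Real.continuous_sqrt.tendsto _).comp this
    refine le_of_tendsto_of_tendsto ((hT0.sub_const y).norm) hlim (Eventually.of_forall fun n => ?_)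
    let s := cfc (fun t => √(t + δ n)) b
    have hss : s * s = b + algebraMap ℝ M (δ n) := by
      simp only [s]
      rw [← cfc_mul _ _ _ (by fun_prop) (by fun_prop)]
      have : cfc (fun t : ℝ => t + δ n) b = b + algebraMap ℝ M (δ n) := by
        rw [cfc_add_const _ _ _ (by fun_prop), cfc_id' ℝ b]
      rw [← this]
      refine cfc_congr fun t ht => ?_
      have ht0 : 0 ≤ t := spectrum_nonneg_of_nonneg hb0 ht
      exact Real.mul_self_sqrt (by have := hδ n; linarith)
    have hs0 : 0 ≤ s := cfc_nonneg fun t _ => Real.sqrt_nonneg _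
    have hs : CFC.sqrt (b + algebraMap ℝ M (δ n)) = s := by
      rw [← hss]; exact CFC.sqrt_mul_self s hs0
    have hps1 : p n * s = 1 := by
      simp only [p, s]
      rw [← cfc_mul _ _ _ (by fun_prop) (by fun_prop), ← cfc_one ℝ b]
      refine cfc_congr fun t ht => ?_
      have ht0 : 0 ≤ t := spectrum_nonneg_of_nonneg hb0 ht
      exact fdel_mul (hδ n) ht0
    have hyp : ‖y * p n‖ ≤ 1 := by
      apply cs_norm_sq_le zero_le_one
      have : star (y * p n) * (y * p n) = cfc (fun t => fdel (δ n) t * t * fdel (δ n) t) b := by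
        rw [cfc_mul _ _ _ (by fun_prop) (by fun_prop),
          cfc_mul _ _ _ (by fun_prop) (by fun_prop), cfc_id' ℝ b, star_mul, (hps n).star_eq]
        simp only [mul_assoc, hb, p]
      rw [this]
      refine norm_cfc_le (by positivity) fun t ht => ?_
      have ht0 : 0 ≤ t := spectrum_nonneg_of_nonneg hb0 ht
      have h4 := fdel_sq (hδ n) ht0
      have h5 := sq_nonneg (fdel (δ n) t)
      have h6 := hδ n
      rw [Real.norm_eq_abs, abs_of_nonneg (by nlinarith [mul_nonneg ht0 h5])]
      nlinarith
    have e : T n - y = (y * p n) * (g - s) := by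
      rw [mul_sub, mul_assoc y (p n) s, hps1, mul_one]; simp only [T, mul_assoc]
    show ‖T n - y‖ ≤ √(κ + δ n)
    rw [e]
    have := sqrt_diff_le (G := G) (B := b + algebraMap ℝ M (δ n)) (κ := κ + δ n)
      (by have := hδ n; linarith) hG
      (h1.trans (le_add_of_nonneg_right (algebraMap_nonneg M (hδ n).le)))
      (by rw [map_add, ← add_assoc]; gcongr)
    rw [hs, norm_sub_rev] at this
    calc _ ≤ ‖y * p n‖ * ‖g - s‖ := norm_mul_le _ _
      _ ≤ 1 * √(κ + δ n) := by gcongr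
      _ = _ := one_mul _

/-- cutoff functions -/
def krE (ε t : ℝ) : ℝ := min 1 (max 0 ((t - ε) / ε))
def krG (ε t : ℝ) : ℝ := krE ε t * (t - ε) * krE ε t

lemma krE_cont (ε : ℝ) : Continuous (krE ε) := by unfold krE; fun_prop
lemma krG_cont (ε : ℝ) : Continuous (krG ε) := by
  have := krE_cont ε
  unfold krG; fun_prop
lemma krE_nonneg (ε t : ℝ) : 0 ≤ krE ε t := by unfold krE; positivity
lemma krE_le_one (ε t : ℝ) : krE ε t ≤ 1 := by unfold krE; exact min_le_left _ _
lemma krE_zero {ε t : ℝ} (hε : 0 < ε) (ht : t ≤ ε) : krE ε t = 0 := by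
  unfold krE
  rw [max_eq_left (div_nonpos_of_nonpos_of_nonneg (by linarith) hε.le)]; simp
lemma krE_one {ε t : ℝ} (hε : 0 < ε) (ht : 2 * ε ≤ t) : krE ε t = 1 := by
  unfold krE
  refine min_eq_left (le_max_of_le_right ?_)
  rw [le_div_iff₀ hε]; linarith
lemma krG_nonneg {ε : ℝ} (hε : 0 < ε) (t : ℝ) : 0 ≤ krG ε t := by
  unfold krG
  rcases le_total t ε with h | h
  · simp [krE_zero hε h]
  · have := krE_nonneg ε t
    have : 0 ≤ t - ε := by linarith
    positivity
lemma krG_le {ε t : ℝ} (hε : 0 < ε) (ht : 0 ≤ t) {C : ℝ} (hC : 0 ≤ C) (h : t ≤ C + ε) :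
    krG ε t ≤ C := by
  rcases le_total t ε with h' | h'
  · unfold krG; simpa [krE_zero hε h'] using hC
  · have h0 := krE_nonneg ε t
    have h1 := krE_le_one ε t
    have : krE ε t * krE ε t ≤ 1 := by nlinarith
    unfold krG
    nlinarith [mul_nonneg h0 h0]
lemma krG_zero {ε : ℝ} (hε : 0 < ε) : krG ε 0 = 0 := by
  unfold krG; simp [krE_zero hε hε.le]

lemma norm_le_algebraMap {x : M} (hx : IsSelfAdjoint x) {c : ℝ} (h : ‖x‖ ≤ c) :
    x ≤ algebraMap ℝ M c :=
  hx.le_algebraMap_norm_self.trans (algebraMap_mono M h)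

lemma kr_lemma {a y : M} {ε : ℝ} (hε : 0 < ε) (ha : 0 ≤ a) (h : ‖star y * y - a‖ ≤ ε) :
    ∃ (T : M) (z : ℕ → M), Tendsto (fun n => y * z n) atTop (𝓝 T) ∧
      star T * T = cfc (krG ε) a ∧ ‖T - y‖ ≤ 4 * √ε := by
  have hy : IsSelfAdjoint (star y * y) := IsSelfAdjoint.star_mul_self y
  have hasa : IsSelfAdjoint a := ha.isSelfAdjoint
  have u1 : star y * y ≤ a + algebraMap ℝ M ε := by
    have := norm_le_algebraMap (hy.sub hasa) h
    rwa [sub_le_iff_le_add'] at this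
  have u2 : a - algebraMap ℝ M ε ≤ star y * y := by
    have := norm_le_algebraMap (hasa.sub hy) (c := ε) (by rwa [norm_sub_rev])
    rw [sub_le_iff_le_add] at this ⊢; rwa [add_comm] at this
  set e := cfc (krE ε) a with he
  have hec := krE_cont ε
  have hGc := krG_cont ε
  have hes : IsSelfAdjoint e := cfc_predicate _ _
  have eG : cfc (krG ε) a = star e * (a - algebraMap ℝ M ε) * e := by
    have : cfc (fun t : ℝ => t - ε) a = a - algebraMap ℝ M ε := by
      rw [cfc_sub _ _ _ (by fun_prop) (by fun_prop), cfc_id' ℝ a, cfc_const ε a]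
    rw [hes.star_eq, ← this, he, ← cfc_mul _ _ _ (by fun_prop) (by fun_prop),
      ← cfc_mul _ _ _ (by fun_prop) (by fun_prop)]
    rfl
  have hst : star (y * e) * (y * e) = star e * (star y * y) * e := by
    rw [star_mul]; simp only [mul_assoc]
  have hee : star e * e ≤ 1 := by
    rw [hes.star_eq, he, ← cfc_mul _ _ _ (by fun_prop) (by fun_prop), ← cfc_one ℝ a]
    refine cfc_mono (fun t _ => ?_) (by fun_prop) (by fun_prop)
    have h0 := krE_nonneg ε t
    have h1 := krE_le_one ε t
    simp only [Pi.one_apply]; nlinarith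
  obtain ⟨T, z, hT1, hT2, hT3⟩ := kr_core (M := M) (G := cfc (krG ε) a) (y := y * e)
    (κ := 2 * ε) (by positivity) (cfc_nonneg fun t _ => krG_nonneg hε t)
    (by rw [eG, hst]; exact star_left_conjugate_le_conjugate u2 e)
    (by
      rw [eG, hst]
      have h1 := star_left_conjugate_le_conjugate u1 e
      refine h1.trans ?_
      have e2 : star e * (a + algebraMap ℝ M ε) * e
        = star e * (a - algebraMap ℝ M ε) * e + (2 * ε) • (star e * e) := by
        simp only [Algebra.algebraMap_eq_smul_one, mul_sub, mul_add, sub_mul, add_mul,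
          mul_smul_comm, smul_mul_assoc, mul_one, two_mul, add_smul]; abel
      rw [e2, Algebra.algebraMap_eq_smul_one (2 * ε)]
      exact add_le_add_right (smul_le_smul_of_nonneg_left hee (by positivity)) _)
  refine ⟨T, fun n => e * z n, by simpa only [mul_assoc] using hT1, hT2, ?_⟩
  have h3 : ‖y * e - y‖ ≤ √(3 * ε) := by
    apply cs_norm_sq_le (Real.sqrt_nonneg _)
    rw [Real.sq_sqrt (by positivity)]
    have e1 : y * e - y = - (y * (1 - e)) := by noncomm_ring
    have hs : IsSelfAdjoint (1 - e) := (IsSelfAdjoint.one M).sub hes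
    have e2 : star (y * e - y) * (y * e - y) = star (1 - e) * (star y * y) * (1 - e) := by
      rw [e1, star_neg, star_mul]; noncomm_ring
    rw [e2]
    refine (CStarAlgebra.norm_le_norm_of_nonneg_of_le (star_left_conjugate_nonneg
      (star_mul_self_nonneg y) _) (star_left_conjugate_le_conjugate u1 _)).trans ?_
    have e3 : 1 - e = cfc (fun t => 1 - krE ε t) a := by
      rw [cfc_sub _ _ _ (by fun_prop) (by fun_prop), cfc_const (1:ℝ) a, map_one]
    have e4 : cfc (fun t : ℝ => t + ε) a = a + algebraMap ℝ M ε := by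
      rw [cfc_add_const _ _ _ (by fun_prop), cfc_id' ℝ a]
    rw [hs.star_eq, ← e4, e3, ← cfc_mul _ _ _ (by fun_prop) (by fun_prop),
      ← cfc_mul _ _ _ (by fun_prop) (by fun_prop)]
    refine norm_cfc_le (by positivity) fun t ht => ?_
    have ht0 : 0 ≤ t := spectrum_nonneg_of_nonneg ha ht
    have h0 := krE_nonneg ε t
    have h1 := krE_le_one ε t
    rcases le_total (2 * ε) t with h | h
    · rw [krE_one hε h]; simp; positivity
    · have h2 : 0 ≤ 1 - krE ε t := by linarith
      rw [Real.norm_eq_abs, abs_of_nonneg (by positivity)]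
      have h5 : (1 - krE ε t) * (1 - krE ε t) ≤ 1 := by nlinarith
      nlinarith [mul_nonneg h2 h2]
  have q1 : √(2 * ε) ≤ 2 * √ε := by
    rw [Real.sqrt_le_left (by positivity), mul_pow, Real.sq_sqrt hε.le]; linarith
  have q2 : √(3 * ε) ≤ 2 * √ε := by
    rw [Real.sqrt_le_left (by positivity), mul_pow, Real.sq_sqrt hε.le]; linarith
  calc ‖T - y‖ = ‖(T - y * e) + (y * e - y)‖ := by congr 1; abel
    _ ≤ ‖T - y * e‖ + ‖y * e - y‖ := norm_add_le _ _
    _ ≤ 4 * √ε := by linarith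

end L1
end

section

/-- exact row systems -/
structure IsRow {n : ℕ} {A N K : Type} [CStarAlgebra A] (blk : N → K) (J : K → Fin (n + 1))
    (v : N → A) : Prop where
  diag : ∀ a b, blk a = blk b → star (v a) * v a = star (v b) * v b
  off : ∀ a b, a ≠ b → J (blk a) = J (blk b) → star (v a) * v b = 0
  nrm : ∀ a, ‖v a‖ ≤ 1

def BD {N K : Type} (blk : N → K) (x : Matrix N N ℂ) : Prop := ∀ a b, blk a ≠ blk b → x a b = 0

/-- the real functional calculus, with the instance path of `CStarAlgebra` -/
def cfcR {M : Type} [CStarAlgebra M] (f : ℝ → ℝ) (a : M) : M := cfc f a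

lemma starHom_continuous {M M' : Type} [CStarAlgebra M] [CStarAlgebra M'] (φ : M →⋆ₐ[ℂ] M') :
    Continuous φ := by
  have : LipschitzWith 1 φ := LipschitzWith.of_dist_le_mul fun x y => by
    rw [dist_eq_norm, dist_eq_norm, ← map_sub]
    simpa using NonUnitalStarAlgHom.norm_apply_le φ (x - y)
  exact this.continuous

lemma map_cfcR {M M' : Type} [CStarAlgebra M] [CStarAlgebra M'] (φ : M →⋆ₐ[ℂ] M') {f : ℝ → ℝ}
    (hf : Continuous f) {a : M} (ha : IsSelfAdjoint a) : φ (cfcR f a) = cfcR f (φ a) :=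
  StarAlgHomClass.map_cfc (S := ℂ) (p := IsSelfAdjoint) (q := IsSelfAdjoint) φ f a
    (by fun_prop) (starHom_continuous φ) ha (ha.map φ)

lemma cfcR_pi {ι M : Type} [Fintype ι] [CStarAlgebra M] {f : ℝ → ℝ}
    (hf : Continuous f) {a : ι → M} (ha : IsSelfAdjoint a) : cfcR f a = fun i => cfcR f (a i) := by
  funext i
  exact map_cfcR (Pi.evalStarAlgHom ℂ (fun _ : ι => M) i) hf ha

section phi
variable {A N K : Type} [CStarAlgebra A] [Fintype N] [DecidableEq N]

def phi2 (y z : N → A) : Matrix N N ℂ →ₗ[ℂ] A where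
  toFun x := ∑ a, ∑ b, x a b • (y a * star (z b))
  map_add' x x' := by simp [add_smul, Finset.sum_add_distrib]
  map_smul' c x := by simp [Finset.smul_sum, smul_smul]

lemma phi2_apply (y z : N → A) (x : Matrix N N ℂ) :
    phi2 y z x = ∑ a, ∑ b, x a b • (y a * star (z b)) := rfl

def phi (v : N → A) : Matrix N N ℂ →ₗ[ℂ] A := phi2 v v

lemma star_phi2 (y z : N → A) (x : Matrix N N ℂ) : star (phi2 y z x) = phi2 z y (star x) := by
  simp only [phi2_apply, star_sum, star_smul, star_mul, star_star]
  rw [Finset.sum_comm]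
  simp [Matrix.star_apply]

end phi

section big
variable {A N K : Type} [CStarAlgebra A] [PartialOrder A] [StarOrderedRing A]
  [Fintype N] [DecidableEq N]

abbrev BigM (N A : Type) := CStarMatrix (Option N) (Option N) A

def rowM (y : N → A) : BigM N A :=
  CStarMatrix.ofMatrix (fun i j => i.elim (j.elim 0 y) (fun _ => 0))

@[simp] lemma rowM_ns (y : N → A) (a : N) : rowM y none (some a) = y a := rfl
@[simp] lemma rowM_nn (y : N → A) : rowM y none none = 0 := rfl
@[simp] lemma rowM_s (y : N → A) (a : N) (j : Option N) : rowM y (some a) j = 0 := rfl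

lemma ofM_apply {m k A : Type} (f : m → k → A) (i : m) (j : k) :
    (CStarMatrix.ofMatrix f : CStarMatrix m k A) i j = f i j := rfl

def hatM (A : Type) [CStarAlgebra A] : Matrix N N ℂ →⋆ₙₐ[ℂ] BigM N A where
  toFun x := CStarMatrix.ofMatrix (fun i j => i.elim 0 (fun a => j.elim 0 (fun b => algebraMap ℂ A (x a b))))
  map_smul' c x := by
    refine CStarMatrix.ext fun i j => ?_
    cases i <;> cases j <;> simp [CStarMatrix.smul_apply, ofM_apply, Algebra.smul_def]
  map_zero' := by
    refine CStarMatrix.ext fun i j => ?_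
    cases i <;> cases j <;> simp [ofM_apply]
  map_add' x y := by
    refine CStarMatrix.ext fun i j => ?_
    cases i <;> cases j <;> simp [CStarMatrix.add_apply, ofM_apply]
  map_mul' x y := by
    refine CStarMatrix.ext fun i j => ?_
    cases i <;> cases j <;>
      simp [CStarMatrix.mul_apply, Fintype.sum_option, Matrix.mul_apply, map_sum, ofM_apply]
  map_star' x := by
    refine CStarMatrix.ext fun i j => ?_
    cases i <;> cases j <;> simp [CStarMatrix.star_apply, Matrix.star_apply,
      Algebra.algebraMap_eq_smul_one, star_smul, ofM_apply]

def diagM : (Option N → A) →⋆ₐ[ℂ] BigM N A where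
  toFun c := CStarMatrix.ofMatrix (Matrix.diagonal c)
  map_one' := by rw [Pi.one_def, Matrix.diagonal_one]; rfl
  map_zero' := by rw [Pi.zero_def, Matrix.diagonal_zero]; rfl
  map_add' x y := by exact (Matrix.diagonal_add x y).symm
  map_mul' x y := by
    refine CStarMatrix.ext fun i j => ?_
    simp only [CStarMatrix.mul_apply, ofM_apply]
    by_cases h : i = j <;> simp [Matrix.diagonal_apply, h]
  commutes' r := by
    refine CStarMatrix.ext fun i j => ?_
    simp [CStarMatrix.algebraMap_apply, Matrix.diagonal_apply, Pi.algebraMap_apply, ofM_apply]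
  map_star' x := by
    refine CStarMatrix.ext fun i j => ?_
    simp only [CStarMatrix.star_apply, ofM_apply, Matrix.diagonal_apply]
    by_cases h : i = j
    · simp [h]
    · simp [h, Ne.symm h]

lemma diagM_apply (c : Option N → A) (i j : Option N) :
    diagM c i j = if i = j then c i else 0 := by
  exact Matrix.diagonal_apply c i j

lemma rowM_star_mul (y z : N → A) (a b : N) :
    (star (rowM y) * rowM z) (some a) (some b) = star (y a) * z b := by
  simp [CStarMatrix.mul_apply, CStarMatrix.star_apply, Fintype.sum_option]

lemma rowM_phi2 (y z : N → A) (x : Matrix N N ℂ) :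
    (rowM y * hatM A x * star (rowM z)) none none = phi2 y z x := by
  simp only [CStarMatrix.mul_apply, CStarMatrix.star_apply, Fintype.sum_option, hatM, phi2_apply]
  simp [Finset.sum_mul]
  rw [Finset.sum_comm]
  simp only [ofM_apply, Option.elim]
  refine Finset.sum_congr rfl fun a _ => Finset.sum_congr rfl fun b _ => ?_
  rw [← Algebra.commutes, mul_assoc, ← Algebra.smul_def]

lemma phi2_norm_le (y z : N → A) (x : Matrix N N ℂ) :
    ‖phi2 y z x‖ ≤ ‖rowM y‖ * ‖x‖ * ‖rowM z‖ := by
  rw [← rowM_phi2]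
  refine CStarMatrix.norm_entry_le_norm.trans ?_
  refine (norm_mul_le _ _).trans ?_
  rw [norm_star]
  gcongr
  refine (norm_mul_le _ _).trans ?_
  gcongr
  exact NonUnitalStarAlgHom.norm_apply_le (hatM (N := N) A) x

/-- row restricted by a predicate -/
def rst {A N : Type} [CStarAlgebra A] (p : N → Prop) (y : N → A) : N → A :=
  open scoped Classical in fun a => if p a then y a else 0

lemma rst_pos {A N : Type} [CStarAlgebra A] {p : N → Prop} {y : N → A} {a : N} (h : p a) :
    rst p y a = y a := if_pos h
lemma rst_neg {A N : Type} [CStarAlgebra A] {p : N → Prop} {y : N → A} {a : N} (h : ¬ p a) :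
    rst p y a = 0 := if_neg h

lemma IsRow.restr {A N K : Type} [CStarAlgebra A] {n : ℕ} {blk : N → K} {J : K → Fin (n + 1)}
    {v : N → A} (h : IsRow blk J v)
    (X : K → Prop) : IsRow blk J (rst (fun a => X (blk a)) v) where
  diag a b hab := by
    by_cases hx : X (blk a)
    · have hy : X (blk b) := hab ▸ hx
      simpa [rst, hx, hy] using h.diag a b hab
    · have hy : ¬ X (blk b) := hab ▸ hx
      simp [rst, hx, hy]
  off a b hab hJ := by
    by_cases hx : X (blk a)
    · by_cases hy : X (blk b)
      · simpa [rst, hx, hy] using h.off a b hab hJ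
      · simp [rst, hy]
    · simp [rst, hx]
  nrm a := by
    by_cases hx : X (blk a)
    · simpa [rst, hx] using h.nrm a
    · simp [rst, hx]

lemma rowM_sub (y z : N → A) : rowM y - rowM z = rowM (y - z) := by
  refine CStarMatrix.ext fun i j => ?_
  cases i <;> cases j <;> simp [CStarMatrix.sub_apply]

lemma rowM_norm_sq_le {y : N → A} {c : ℝ} (hc : 0 ≤ c) (h1 : ∀ a b, a ≠ b → star (y a) * y b = 0)
    (h2 : ∀ a, ‖star (y a) * y a‖ ≤ c) : ‖rowM y‖ ^ 2 ≤ c := by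
  rw [sq, ← CStarRing.norm_star_mul_self]
  have : star (rowM y) * rowM y = diagM (fun i => i.elim 0 (fun a => star (y a) * y a)) := by
    refine CStarMatrix.ext fun i j => ?_
    rw [diagM_apply]
    cases i <;> cases j
    · simp [CStarMatrix.mul_apply, CStarMatrix.star_apply, Fintype.sum_option]
    · simp [CStarMatrix.mul_apply, CStarMatrix.star_apply, Fintype.sum_option]
    · simp [CStarMatrix.mul_apply, CStarMatrix.star_apply, Fintype.sum_option]
    · rw [rowM_star_mul]
      split_ifs with h
      · simp at h; subst h; rfl
      · exact h1 _ _ (fun h' => h (by rw [h']))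
  rw [this]
  refine (NonUnitalStarAlgHom.norm_apply_le (diagM (N := N) (A := A)) _).trans ?_
  refine (pi_norm_le_iff_of_nonneg hc).2 fun i => ?_
  cases i
  · simpa using hc
  · exact h2 _

variable [DecidableEq K] {n : ℕ}

lemma phi_eq_sum_colour (blk : N → K) (J : K → Fin (n + 1)) (y : N → A) {x : Matrix N N ℂ}
    (hx : BD blk x) : phi y x = ∑ j, phi2 (rst (fun a => J (blk a) = j) y) (rst (fun a => J (blk a) = j) y) x := by
  simp only [phi, phi2_apply]
  rw [Finset.sum_comm (γ := Fin (n + 1))]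
  refine Finset.sum_congr rfl fun a _ => ?_
  rw [Finset.sum_comm (γ := Fin (n + 1))]
  refine Finset.sum_congr rfl fun b _ => ?_
  rw [Finset.sum_eq_single (J (blk a))]
  · by_cases h : blk a = blk b
    · simp [rst, h]
    · simp [hx a b h]
  · intro j _ hj
    simp [rst, hj.symm]
  · simp

/-- single colour estimate -/
lemma row_norm_le {blk : N → K} {J : K → Fin (n + 1)} {v : N → A} (h : IsRow blk J v)
    (j : Fin (n + 1)) (hj : ∀ a, J (blk a) ≠ j → v a = 0) {δ : ℝ} (hδ : 0 ≤ δ)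
    (h2 : ∀ a, ‖star (v a) * v a‖ ≤ δ) : ‖rowM v‖ ^ 2 ≤ δ := by
  refine rowM_norm_sq_le hδ (fun a b hab => ?_) h2
  by_cases ha : J (blk a) = j
  · by_cases hb : J (blk b) = j
    · exact h.off a b hab (ha.trans hb.symm)
    · rw [hj b hb, mul_zero]
  · rw [hj a ha, star_zero, zero_mul]

lemma phi_colour_le {blk : N → K} {J : K → Fin (n + 1)} {v : N → A} (h : IsRow blk J v)
    (j : Fin (n + 1)) (hj : ∀ a, J (blk a) ≠ j → v a = 0) {δ : ℝ} (hδ : 0 ≤ δ)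
    (h2 : ∀ a, ‖star (v a) * v a‖ ≤ δ) (x : Matrix N N ℂ) : ‖phi v x‖ ≤ δ * ‖x‖ := by
  refine (phi2_norm_le v v x).trans ?_
  have := row_norm_le h j hj hδ h2
  nlinarith [norm_nonneg x, mul_le_mul_of_nonneg_right this (norm_nonneg x)]

lemma phi_row_le {blk : N → K} {J : K → Fin (n + 1)} {v : N → A} (h : IsRow blk J v)
    {δ : ℝ} (hδ : 0 ≤ δ) (h2 : ∀ a, ‖star (v a) * v a‖ ≤ δ) {x : Matrix N N ℂ} (hx : BD blk x) :
    ‖phi v x‖ ≤ (n + 1) * δ * ‖x‖ := by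
  rw [phi_eq_sum_colour blk J v hx]
  refine (norm_sum_le _ _).trans ?_
  have : ∀ j ∈ (Finset.univ : Finset (Fin (n + 1))), ‖phi2 (rst (fun a => J (blk a) = j) v)
      (rst (fun a => J (blk a) = j) v) x‖ ≤ δ * ‖x‖ := fun j _ =>
    phi_colour_le (h.restr (fun k => J k = j)) j (fun a ha => rst_neg (p := fun a => J (blk a) = j) ha) hδ (fun a => by
      by_cases ha : J (blk a) = j
      · rw [rst_pos (p := fun a => J (blk a) = j) ha]; exact h2 a
      · rw [rst_neg (p := fun a => J (blk a) = j) ha]; simpa using hδ) x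
  refine (Finset.sum_le_sum this).trans ?_
  simp [mul_assoc]

lemma IsRow.nrm_sq {blk : N → K} {J : K → Fin (n + 1)} {v : N → A} (h : IsRow blk J v) (a : N) :
    ‖star (v a) * v a‖ ≤ 1 := by
  rw [CStarRing.norm_star_mul_self]
  have := h.nrm a
  nlinarith [norm_nonneg (v a)]

lemma phi2_sub_le (y z : N → A) (x : Matrix N N ℂ) : ‖phi2 z z x - phi2 y y x‖ ≤
    ‖rowM z - rowM y‖ * ‖x‖ * (‖rowM z‖ + ‖rowM y‖) := by
  have e : phi2 z z x - phi2 y y x = phi2 (z - y) z x + phi2 y (z - y) x := by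
    simp only [phi2_apply, ← Finset.sum_sub_distrib, ← Finset.sum_add_distrib, ← smul_sub, ← smul_add]
    refine Finset.sum_congr rfl fun a _ => Finset.sum_congr rfl fun b _ => ?_
    congr 1
    simp only [Pi.sub_apply, star_sub]; noncomm_ring
  rw [e]
  refine (norm_add_le _ _).trans ((add_le_add (phi2_norm_le _ _ _) (phi2_norm_le _ _ _)).trans ?_)
  rw [rowM_sub]
  apply le_of_eq; ring

lemma kr_rows {blk : N → K} {J : K → Fin (n + 1)} {y : N → A} {c : N → A} {ε : ℝ} (hε : 0 < ε)
    (hε1 : ε ≤ 1) (hc : ∀ a, 0 ≤ c a) (hcb : ∀ a b, blk a = blk b → c a = c b)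
    (hc1 : ∀ a, ‖c a‖ ≤ 1 + ε)
    (hj : ∀ j, ‖star (rowM (rst (fun a => J (blk a) = j) y)) * rowM (rst (fun a => J (blk a) = j) y)
      - diagM (fun i => i.elim 0 (rst (fun a => J (blk a) = j) c))‖ ≤ ε) :
    ∃ T : N → A, IsRow blk J T ∧
      (∀ x, BD blk x → ‖phi T x - phi y x‖ ≤ (n + 1) * (12 * √ε) * ‖x‖) ∧
      (∀ p : A, (∀ a, p * y a = y a) → ∀ a, p * T a = T a) := by
  let yj := fun j => rst (fun a => J (blk a) = j) y
  let cj : Fin (n + 1) → Option N → A := fun j i => i.elim 0 (rst (fun a => J (blk a) = j) c)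
  have hcj0 : ∀ j i, 0 ≤ cj j i := by
    rintro j (_ | a)
    · exact le_rfl
    · by_cases h : J (blk a) = j
      · simp only [cj, Option.elim]; rw [rst_pos (p := fun a => J (blk a) = j) h]; exact hc a
      · simp only [cj, Option.elim]; rw [rst_neg (p := fun a => J (blk a) = j) h]
  have hcj1 : ∀ j i, ‖cj j i‖ ≤ 1 + ε := by
    rintro j (_ | a)
    · simp [cj]; linarith
    · by_cases h : J (blk a) = j
      · simp only [cj, Option.elim]; rw [rst_pos (p := fun a => J (blk a) = j) h]; exact hc1 a
      · simp only [cj, Option.elim]; rw [rst_neg (p := fun a => J (blk a) = j) h]; simp; linarith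
  have hD0 : ∀ j, 0 ≤ diagM (cj j) := fun j => by
    have hsa : ∀ i, ∃ r, cj j i = star r * r := fun i =>
      CStarAlgebra.nonneg_iff_eq_star_mul_self.1 (hcj0 j i)
    choose r hr using hsa
    have : cj j = star r * r := funext hr
    rw [this, map_mul, map_star]
    exact star_mul_self_nonneg _
  have hex := fun j => kr_lemma (M := BigM N A) hε (hD0 j) (hj j)
  choose T z hT1 hT2 hT3 using hex
  have hGc := krG_cont ε
  have hsaj : ∀ j, IsSelfAdjoint (cj j) := fun j => by
    ext i; exact (hcj0 j i).isSelfAdjoint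
  have hw : ∀ j, star (T j) * T j = diagM (fun i => cfc (krG ε) (cj j i)) := by
    intro j
    have h1 := map_cfcR (diagM (N := N) (A := A)) hGc (hsaj j)
    rw [cfcR_pi hGc (hsaj j)] at h1
    exact (hT2 j).trans h1.symm
  -- entries
  have happ : ∀ j, Continuous fun X : BigM N A => X j := fun j => by
    exact (continuous_apply j : Continuous fun X : Option N → Option N → A => X j)
  have happ2 : ∀ i j, Continuous fun X : BigM N A => X i j := fun i j =>
    (continuous_apply j).comp (happ i)
  have hrow0 : ∀ j a i, T j (some a) i = 0 := by
    intro j a i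
    have := ((happ2 (some a) i).tendsto (T j)).comp (hT1 j)
    refine tendsto_nhds_unique this ?_
    have e : ∀ m, (rowM (rst (fun a => J (blk a) = j) y) * z j m) (some a) i = 0 := fun m => by
      rw [CStarMatrix.mul_apply]; simp
    simp only [Function.comp_def, e]
    exact tendsto_const_nhds
  have hTT : ∀ j a b, star (T j none (some a)) * T j none (some b)
      = if a = b then cfc (krG ε) (cj j (some a)) else 0 := by
    intro j a b
    have := congrArg (fun X : BigM N A => X (some a) (some b)) (hw j)
    simp only [diagM_apply, CStarMatrix.mul_apply, CStarMatrix.star_apply, Fintype.sum_option,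
      hrow0, mul_zero, Finset.sum_const_zero, add_zero, Option.some.injEq] at this
    exact this
  have hGle : ∀ j i, ‖cfc (krG ε) (cj j i)‖ ≤ 1 := fun j i => by
    rcases subsingleton_or_nontrivial A with hA | hA
    · rw [Subsingleton.elim (cfc (krG ε) (cj j i)) 0]; simp
    refine norm_cfc_le zero_le_one fun t ht => ?_
    rw [Real.norm_eq_abs, abs_of_nonneg (krG_nonneg hε t)]
    refine krG_le hε (spectrum_nonneg_of_nonneg (hcj0 j i) ht) zero_le_one ?_
    have := spectrum.norm_le_norm_of_mem ht
    exact ((le_abs_self t).trans this).trans (hcj1 j i)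
  let V : N → A := fun a => T (J (blk a)) none (some a)
  have hcjb : ∀ a, cj (J (blk a)) (some a) = c a := fun a => by
    simp only [cj, Option.elim]; rw [rst_pos (p := fun b => J (blk b) = J (blk a)) rfl]
  have hV : IsRow blk J V := by
    refine ⟨fun a b hab => ?_, fun a b hab hJ => ?_, fun a => ?_⟩
    · simp only [V, hTT, if_true, hcjb, hcb a b hab]
    · simp only [V]; rw [← hJ, hTT, if_neg hab]
    · refine cs_norm_sq_le zero_le_one ?_
      simp only [V, hTT, if_true]; simpa using hGle _ _
  have hrT : ∀ j, rowM (rst (fun a => J (blk a) = j) V) = T j := by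
    intro j
    refine CStarMatrix.ext fun i k => ?_
    cases i with
    | some a => rw [hrow0]; rfl
    | none =>
      have z0 : ∀ k, star (T j none k) * T j none k = 0 → T j none k = 0 := fun k hk =>
        CStarRing.star_mul_self_eq_zero_iff _ |>.1 hk
      cases k with
      | none =>
        rw [rowM_nn]; symm; apply z0
        have := congrArg (fun X : BigM N A => X none none) (hw j)
        simp only [diagM_apply, CStarMatrix.mul_apply, CStarMatrix.star_apply, Fintype.sum_option,
          hrow0, mul_zero, Finset.sum_const_zero, add_zero, if_true] at this
        rw [this]
        simp only [cj, Option.elim]; rw [cfc_apply_zero, krG_zero hε, map_zero]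
      | some a =>
        rw [rowM_ns]
        by_cases h : J (blk a) = j
        · rw [rst_pos (p := fun a => J (blk a) = j) h]; simp only [V, h]
        · rw [rst_neg (p := fun a => J (blk a) = j) h]; symm; apply z0
          rw [hTT, if_pos rfl]
          simp only [cj, Option.elim]; rw [rst_neg (p := fun a => J (blk a) = j) h, cfc_apply_zero, krG_zero hε, map_zero]
  refine ⟨V, hV, fun x hx => ?_, fun p hp a => ?_⟩
  · rw [phi_eq_sum_colour blk J V hx, phi_eq_sum_colour blk J y hx, ← Finset.sum_sub_distrib]
    refine (norm_sum_le _ _).trans ?_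
    have : ∀ j ∈ (Finset.univ : Finset (Fin (n + 1))), ‖phi2 (rst (fun a => J (blk a) = j) V)
        (rst (fun a => J (blk a) = j) V) x - phi2 (rst (fun a => J (blk a) = j) y)
        (rst (fun a => J (blk a) = j) y) x‖ ≤ (12 * √ε) * ‖x‖ := by
      intro j _
      refine (phi2_sub_le _ _ x).trans ?_
      rw [hrT]
      have n1 := hT3 j
      have n2 : ‖T j‖ ≤ 1 := by
        apply cs_norm_sq_le zero_le_one
        rw [hw]
        refine (NonUnitalStarAlgHom.norm_apply_le (diagM (N := N) (A := A)) _).trans ?_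
        rw [one_pow]
        exact (pi_norm_le_iff_of_nonneg zero_le_one).2 (hGle j)
      have n3 : ‖rowM (rst (fun a => J (blk a) = j) y)‖ ≤ 2 := by
        apply cs_norm_sq_le zero_le_two
        have h1 : ‖diagM (cj j)‖ ≤ 1 + ε :=
          (NonUnitalStarAlgHom.norm_apply_le (diagM (N := N) (A := A)) _).trans
            ((pi_norm_le_iff_of_nonneg (by linarith)).2 (hcj1 j))
        have h2 := norm_le_norm_add_norm_sub' (star (rowM (rst (fun a => J (blk a) = j) y)) * rowM (rst (fun a => J (blk a) = j) y)) (diagM (cj j))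
        have h3 := hj j
        simp only [cj] at h1 h2 ⊢
        linarith
      have : 0 ≤ √ε := Real.sqrt_nonneg _
      calc _ ≤ (4 * √ε) * ‖x‖ * (1 + 2) := by gcongr
        _ = _ := by ring
    refine (Finset.sum_le_sum this).trans ?_
    simp [mul_assoc]
  · have l := ((happ2 none (some a)).tendsto (T (J (blk a)))).comp (hT1 (J (blk a)))
    have l2 := l.const_mul p
    refine tendsto_nhds_unique (l2.congr fun m => ?_) l
    simp only [Function.comp_def, CStarMatrix.mul_apply, Fintype.sum_option, rowM_nn, zero_mul,
      rowM_ns, zero_add, Finset.mul_sum]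
    refine Finset.sum_congr rfl fun b _ => ?_
    by_cases h : J (blk b) = J (blk a)
    · rw [rst_pos (p := fun b => J (blk b) = J (blk a)) h, ← mul_assoc, hp]
    · rw [rst_neg (p := fun b => J (blk b) = J (blk a)) h]; simp

end big
end

section

/-- completely positive maps into a matrix algebra -/
def CPm {A N : Type} [CStarAlgebra A] [Fintype N] (ψ : A →ₗ[ℂ] Matrix N N ℂ) : Prop :=
  ∀ (k : ℕ) (a : Fin k → A), Matrix.PosSemidef
    (Matrix.of fun (p q : Fin k × N) => ψ (star (a p.1) * a q.1) p.2 q.2)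

def RowND (n : ℕ) (A : Type) [CStarAlgebra A] : Prop :=
  ∀ (S : Finset A) (ε : ℝ), 0 < ε → ∃ (N K : Type) (_ : Fintype N) (_ : DecidableEq N)
    (_ : Fintype K) (_ : DecidableEq K) (blk : N → K) (J : K → Fin (n + 1)) (v : N → A)
    (ψ : A →ₗ[ℂ] Matrix N N ℂ), IsRow blk J v ∧ (∀ b, BD blk (ψ b)) ∧ CPm ψ ∧
    (∀ b, ‖ψ b‖ ≤ ‖b‖) ∧ ∀ b ∈ S, ‖phi v (ψ b) - b‖ < ε

lemma phi_apply {A N : Type} [CStarAlgebra A] [Fintype N] [DecidableEq N] (v : N → A)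
    (x : Matrix N N ℂ) : phi v x = ∑ a, ∑ b, x a b • (v a * star (v b)) := rfl

lemma nonneg_ex {M : Type} [CStarAlgebra M] [PartialOrder M] [StarOrderedRing M] {a : M}
    (h : 0 ≤ a) : ∃ y, a = star y * y := CStarAlgebra.nonneg_iff_eq_star_mul_self.1 h

open scoped MatrixOrder in
lemma psd_ex {N : Type} [Fintype N] [DecidableEq N] {X : Matrix N N ℂ}
    (h : X.PosSemidef) : ∃ y, X = star y * y := 
  nonneg_ex (Matrix.nonneg_iff_posSemidef.2 h)

lemma isPosElem_sum {A ι : Type} [CStarAlgebra A] [Fintype ι] {k : ℕ} (z : ι → Fin k → A) :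
    IsPosElem (Matrix.of fun p q => ∑ l, star (z l p) * z l q : Matrix (Fin k) (Fin k) A) := by
  letI := CStarAlgebra.spectralOrder A
  letI := CStarAlgebra.spectralOrderedRing A
  cases k with
  | zero => exact ⟨0, by ext i; exact i.elim0⟩
  | succ k =>
    let R : ι → CStarMatrix (Fin (k + 1)) (Fin (k + 1)) A := fun l =>
      CStarMatrix.ofMatrix (fun q p => if q = 0 then z l p else 0)
    have h : 0 ≤ ∑ l, star (R l) * R l := Finset.sum_nonneg fun l _ => star_mul_self_nonneg _
    obtain ⟨y, hy⟩ := nonneg_ex h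
    refine ⟨CStarMatrix.ofMatrix.symm y, ?_⟩
    have : (Matrix.of fun p q => ∑ l, star (z l p) * z l q : Matrix (Fin (k + 1)) (Fin (k + 1)) A)
        = CStarMatrix.ofMatrix.symm (∑ l, star (R l) * R l) := by
      ext p q
      have e : (∑ l, star (R l) * R l) p q = ∑ l, (star (R l) * R l) p q := by
        have : ∀ s : Finset ι, (∑ l ∈ s, star (R l) * R l) p q = ∑ l ∈ s, (star (R l) * R l) p q := by
          intro s
          classical
          induction s using Finset.induction_on with
          | empty => simp
          | insert a s ha ih => rw [Finset.sum_insert ha, Finset.sum_insert ha, ← ih]; rfl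
        exact this _
      refine Eq.trans ?_ e.symm
      refine Finset.sum_congr rfl fun l _ => ?_
      rw [CStarMatrix.mul_apply]
      simp [CStarMatrix.star_apply, R, ofM_apply]
    rw [this, hy]; rfl

section L6
variable {A : Type} [CStarAlgebra A] {n s : ℕ} {r : Fin s → ℕ}

def bdHom (s : ℕ) (r : Fin s → ℕ) : FDBlock s r →⋆ₐ[ℂ] Matrix (Σ i, Fin (r i)) (Σ i, Fin (r i)) ℂ where
  toFun x := Matrix.blockDiagonal' x
  map_one' := Matrix.blockDiagonal'_one
  map_mul' x y := Matrix.blockDiagonal'_mul x y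
  map_zero' := Matrix.blockDiagonal'_zero
  map_add' x y := Matrix.blockDiagonal'_add x y
  commutes' c := by
    ext ⟨i, a⟩ ⟨j, b⟩
    by_cases h : i = j
    · subst h
      simp [Matrix.blockDiagonal'_apply, Matrix.algebraMap_matrix_apply, Pi.algebraMap_apply]
    · rw [Matrix.blockDiagonal'_apply_ne _ _ _ h, Matrix.algebraMap_matrix_apply, if_neg]
      rintro ⟨⟩; exact h rfl
  map_star' x := (Matrix.blockDiagonal'_conjTranspose x).symm

lemma bdHom_norm (x : FDBlock s r) : ‖bdHom s r x‖ = ‖x‖ := by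
  have hi : Function.Injective (bdHom s r) := Matrix.blockDiagonal'_injective
  exact NonUnitalStarAlgHom.norm_map _ hi x

lemma bdHom_BD (x : FDBlock s r) : BD (Sigma.fst : (Σ i, Fin (r i)) → Fin s) (bdHom s r x) := by
  rintro ⟨i, a⟩ ⟨j, b⟩ h
  exact Matrix.blockDiagonal'_apply_ne _ _ _ h

lemma bdHom_blockDiag {x : Matrix (Σ i, Fin (r i)) (Σ i, Fin (r i)) ℂ}
    (h : BD (Sigma.fst : (Σ i, Fin (r i)) → Fin s) x) : bdHom s r (Matrix.blockDiag' x) = x := by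
  ext ⟨i, a⟩ ⟨j, b⟩
  by_cases hij : i = j
  · subst hij; exact Matrix.blockDiagonal'_apply_eq _ _ _ _
  · rw [h _ _ hij]; exact Matrix.blockDiagonal'_apply_ne _ _ _ hij

lemma phi_supp {N K : Type} [Fintype N] [DecidableEq N] [DecidableEq K]
    {blk : N → K} {J : K → Fin (n + 1)} {v : N → A} {x : Matrix N N ℂ} {j : Fin (n + 1)}
    (hx : BD blk x) (hj : ∀ a b, J (blk a) ≠ j → x a b = 0) :
    phi v x = phi (rst (fun a => J (blk a) = j) v) x := by
  rw [phi_apply, phi_apply]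
  refine Finset.sum_congr rfl fun a _ => Finset.sum_congr rfl fun b _ => ?_
  by_cases h : J (blk a) = j
  · by_cases h2 : blk a = blk b
    · simp [rst, h, ← h2]
    · simp [hx a b h2]
  · simp [hj a b h]

lemma phi_mul_phi {N K : Type} [Fintype N] [DecidableEq N] [DecidableEq K]
    {blk : N → K} {J : K → Fin (n + 1)} {v : N → A} (hv : IsRow blk J v)
    {x y : Matrix N N ℂ} {j : Fin (n + 1)}
    (hx : BD blk x) (hj : ∀ a b, J (blk a) ≠ j → x a b = 0) 
    (hy : BD blk y) (hj' : ∀ a b, J (blk a) ≠ j → y a b = 0) :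
    phi v x * phi v y = ∑ a, ∑ d, (x * y) a d • (v a * (star (v a) * v a) * star (v d)) := by
  rw [phi_apply, phi_apply, Finset.sum_mul]
  refine Finset.sum_congr rfl fun a _ => ?_
  rw [Finset.sum_mul]
  simp only [Finset.mul_sum, Matrix.mul_apply, Finset.sum_smul]
  have key : ∀ b c d, (x a b • (v a * star (v b))) * (y c d • (v c * star (v d))) =
      if b = c then (x a b * y b d) • (v a * (star (v a) * v a) * star (v d)) else 0 := by
    intro b c d
    have e : (x a b • (v a * star (v b))) * (y c d • (v c * star (v d))) =
      (x a b * y c d) • (v a * (star (v b) * v c) * star (v d)) := by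
      rw [smul_mul_smul_comm]; simp only [mul_assoc]
    rw [e]
    split_ifs with h
    · subst h
      by_cases h2 : blk a = blk b
      · rw [hv.diag a b h2]
      · simp [hx a b h2]
    · by_cases h1 : J (blk a) = j
      · by_cases h2 : J (blk c) = j
        · by_cases h3 : blk a = blk b
          · rw [hv.off b c h (by rw [← h3, h1, h2])]; simp
          · simp [hx a b h3]
        · simp [hj' c d h2]
      · simp [hj a b h1]
  simp only [key]
  rw [Finset.sum_comm (γ := N) (s := Finset.univ) (t := Finset.univ)
    (f := fun d b => (x a b * y b d) • (v a * (star (v a) * v a) * star (v d)))]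
  refine Finset.sum_congr rfl fun b _ => ?_
  rw [Finset.sum_comm]
  refine Finset.sum_congr rfl fun d _ => ?_
  simp

lemma phi_star_mul {N : Type} [Fintype N] [DecidableEq N] (v : N → A) (x y : Matrix N N ℂ) :
    phi v (star x * y) = ∑ c, star (∑ a, x c a • star (v a)) * (∑ b, y c b • star (v b)) := by
  simp only [phi_apply, Matrix.mul_apply, Finset.sum_smul, star_sum, star_smul, star_star,
    Matrix.star_apply, Finset.sum_mul, Finset.mul_sum, smul_mul_smul_comm]
  have h1 : ∀ a, (∑ b, ∑ c, (star (x c a) * y c b) • (v a * star (v b))) =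
      ∑ c, ∑ b, (star (x c a) * y c b) • (v a * star (v b)) := fun a => Finset.sum_comm
  simp only [h1]
  rw [Finset.sum_comm]
  refine Finset.sum_congr rfl fun c _ => ?_
  first
  | rfl
  | exact Finset.sum_comm

lemma nd_of_rows {v : (Σ i, Fin (r i)) → A} {J : Fin s → Fin (n + 1)} (hv : IsRow Sigma.fst J v) :
    IsCompletelyPositive ((phi v).comp (bdHom s r).toAlgHom.toLinearMap) ∧
    ∀ j : Fin (n + 1), (∀ x ∈ blockSupp J j, ‖(phi v).comp (bdHom s r).toAlgHom.toLinearMap x‖ ≤ ‖x‖) ∧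
        OrderZeroOn ((phi v).comp (bdHom s r).toAlgHom.toLinearMap) (blockSupp J j) := by
  letI := CStarAlgebra.spectralOrder A
  letI := CStarAlgebra.spectralOrderedRing A
  have hap : ∀ x, (phi v).comp (bdHom s r).toAlgHom.toLinearMap x = phi v (bdHom s r x) := fun x => rfl
  have hsupp : ∀ j, ∀ x ∈ blockSupp J j, ∀ a b : Σ i, Fin (r i), J a.1 ≠ j → bdHom s r x a b = 0 := by
    rintro j x hx ⟨i, a⟩ ⟨i', b⟩ h
    by_cases hi : i = i'
    · subst hi
      have : bdHom s r x ⟨i, a⟩ ⟨i, b⟩ = x i a b := Matrix.blockDiagonal'_apply_eq _ _ _ _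
      rw [this, hx i h]; rfl
    · exact bdHom_BD x _ _ hi
  refine ⟨?_, fun j => ⟨fun x hx => ?_, ?_⟩⟩
  · rintro k x ⟨y, rfl⟩
    let z : (Fin k × (Σ i, Fin (r i))) → Fin k → A := fun l p => ∑ b, bdHom s r (y l.1 p) l.2 b • star (v b)
    have := isPosElem_sum z
    convert this using 1
    ext p q
    simp only [Matrix.map_apply, hap, Matrix.of_apply, Fintype.sum_prod_type, z]
    rw [Matrix.mul_apply]
    simp only [map_sum, Matrix.star_apply, map_mul, map_star, phi_star_mul]
  · rw [hap, phi_supp (bdHom_BD x) (hsupp j x hx), ← bdHom_norm]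
    refine (phi_colour_le (hv.restr (fun i => J i = j)) j (fun a ha => rst_neg (p := fun a : Σ i, Fin (r i) => J a.1 = j) ha)
      zero_le_one (fun a => (hv.restr (fun i => J i = j)).nrm_sq a) _).trans (by rw [one_mul])
  · intro e he f hf h1 h2
    simp only [hap]
    rw [phi_mul_phi hv (bdHom_BD e) (hsupp j e he) (bdHom_BD f) (hsupp j f hf),
      phi_mul_phi hv (bdHom_BD f) (hsupp j f hf) (bdHom_BD e) (hsupp j e he), ← map_mul, ← map_mul,
      h1, h2]
    simp

lemma nd_of_psi {ψ : A →ₗ[ℂ] Matrix (Σ i, Fin (r i)) (Σ i, Fin (r i)) ℂ} (h : CPm ψ) 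
    (ψ' : A →ₗ[ℂ] FDBlock s r) (hψ' : ∀ b i, ψ' b i = Matrix.blockDiag' (ψ b) i) :
    IsCompletelyPositive ψ' := by
  rintro k x ⟨y, rfl⟩
  have hps : Matrix.PosSemidef (Matrix.of fun (p q : Fin k × (Σ i, Fin (r i))) => 
      ψ ((star y * y) p.1 q.1) p.2 q.2) := by
    have := Matrix.posSemidef_sum (Finset.univ : Finset (Fin k)) (fun l _ => h k (y l))
    convert this using 1
    ext p q
    simp only [Matrix.mul_apply, map_sum, Matrix.star_apply, Matrix.sum_apply, Matrix.of_apply]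
  have hi : ∀ i, ∃ Z : Matrix (Fin k × Fin (r i)) (Fin k × Fin (r i)) ℂ, 
     (Matrix.of fun (p q : Fin k × Fin (r i)) => ψ' ((star y * y) p.1 q.1) i p.2 q.2) = star Z * Z := by
    intro i
    have := hps.submatrix (fun p : Fin k × Fin (r i) => ((p.1, ⟨i, p.2⟩) : Fin k × (Σ i, Fin (r i))))
    obtain ⟨Z, hZ⟩ := psd_ex this
    refine ⟨Z, ?_⟩
    rw [← hZ]
    ext p q
    simp [hψ', Matrix.blockDiag'_apply]
  choose Z hZ using hi
  refine ⟨Matrix.of fun p q i => Matrix.of fun e f => Z i (p, e) (q, f), ?_⟩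
  ext p q i e f
  have := congrFun (congrFun (hZ i) (p, e)) (q, f)
  simp only [Matrix.of_apply] at this
  rw [Matrix.map_apply, this, Matrix.mul_apply, Matrix.mul_apply, Fintype.sum_prod_type]
  simp only [Finset.sum_apply, Pi.mul_apply, Matrix.sum_apply, Matrix.mul_apply, Matrix.star_apply, Matrix.of_apply, Pi.star_apply]

theorem nd_of_rowND (h : RowND n A) : NuclearDimensionLE n A := by
  intro S ε hε
  obtain ⟨N, K, _, _, _, _, blk, J, v, ψ, hv, hbd, hcp, hn, hS⟩ := h S ε hε
  let eK := Fintype.equivFin K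
  let s := Fintype.card K
  let r : Fin s → ℕ := fun i => Fintype.card {a : N // eK (blk a) = i}
  let g : (Σ i, Fin (r i)) ≃ N := (Equiv.sigmaCongrRight fun i => 
    (Fintype.equivFin {a : N // eK (blk a) = i}).symm).trans (Equiv.sigmaFiberEquiv fun a => eK (blk a))
  have hg : ∀ a, eK (blk (g a)) = a.1 := by
    rintro ⟨i, a⟩
    exact ((Fintype.equivFin {a : N // eK (blk a) = i}).symm a).2
  have hg2 : ∀ a, blk (g a) = eK.symm a.1 := fun a => by rw [← hg, Equiv.symm_apply_apply]
  let J' : Fin s → Fin (n + 1) := fun i => J (eK.symm i)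
  have hv' : IsRow Sigma.fst J' (v ∘ g) := by
    refine ⟨fun a b hab => hv.diag _ _ (by rw [hg2, hg2, hab]), fun a b hab hJ => 
      hv.off _ _ (fun h => hab (g.injective h)) (by rw [hg2, hg2]; exact hJ), fun a => hv.nrm _⟩
  let ψ2 : A →ₗ[ℂ] Matrix (Σ i, Fin (r i)) (Σ i, Fin (r i)) ℂ := 
    { toFun := fun b => (ψ b).submatrix g g
      map_add' := fun a b => by rw [map_add]; rfl
      map_smul' := fun a b => by rw [map_smul]; rfl }
  have hbd2 : ∀ b, BD Sigma.fst (ψ2 b) := fun b a c hac => hbd b _ _ (by 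
    rw [hg2, hg2]; exact fun h => hac (eK.symm.injective h))
  have hcp2 : CPm ψ2 := fun k a => by
    exact (hcp k a).submatrix (fun p : Fin k × (Σ i, Fin (r i)) => (p.1, g p.2))
  have hphi : ∀ b, phi (v ∘ g) (ψ2 b) = phi v (ψ b) := fun b => by
    rw [phi_apply, phi_apply, ← Equiv.sum_comp g]
    refine Finset.sum_congr rfl fun a _ => ?_
    rw [← Equiv.sum_comp g]; rfl
  have hn2 : ∀ b, ‖ψ2 b‖ ≤ ‖b‖ := fun b => by
    refine le_trans (le_of_eq ?_) (hn b)
    let R := Matrix.reindexAlgEquiv ℂ ℂ g.symm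
    let R' : Matrix N N ℂ →⋆ₐ[ℂ] Matrix (Σ i, Fin (r i)) (Σ i, Fin (r i)) ℂ :=
      { R.toAlgHom with map_star' := fun x => by ext; simp [R, Matrix.star_apply] }
    exact NonUnitalStarAlgHom.norm_map R' R.injective (ψ b)
  let ψ' : A →ₗ[ℂ] FDBlock s r := 
    { toFun := fun b => Matrix.blockDiag' (ψ2 b)
      map_add' := fun a b => by rw [map_add]; rfl
      map_smul' := fun a b => by rw [map_smul]; rfl }
  have hb' : ∀ b, bdHom s r (ψ' b) = ψ2 b := fun b => bdHom_blockDiag (hbd2 b)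
  refine ⟨s, r, J', ψ', _, nd_of_psi hcp2 ψ' (fun b i => rfl), (nd_of_rows hv').1, fun a => ?_, (nd_of_rows hv').2, fun a ha => ?_⟩
  · rw [← bdHom_norm, hb']; exact hn2 a
  · have : (phi (v ∘ g)).comp (bdHom s r).toAlgHom.toLinearMap (ψ' a) = phi v (ψ a) := by
      rw [← hphi, ← hb']; rfl
    rw [this]; exact hS a ha

end L6
end

section

section OZ
variable {A N K : Type} [CStarAlgebra A] [Fintype N] [DecidableEq N]

def lin (f : N → N → A) (X : Matrix N N ℂ) : A := ∑ a, ∑ b, X a b • f a b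

lemma lin_single (f : N → N → A) (a b : N) : lin f (Matrix.single a b 1) = f a b := by
  unfold lin
  rw [Finset.sum_eq_single a, Finset.sum_eq_single b]
  · simp
  · intro c _ hc; simp [Matrix.single_apply, hc.symm]
  · simp
  · intro c _ hc; simp [Matrix.single_apply, hc.symm]
  · simp

lemma lin_add (f : N → N → A) (X Y : Matrix N N ℂ) : lin f (X + Y) = lin f X + lin f Y := by
  simp [lin, add_smul, Finset.sum_add_distrib]
lemma lin_sub (f : N → N → A) (X Y : Matrix N N ℂ) : lin f (X - Y) = lin f X - lin f Y := by
  simp [lin, sub_smul, Finset.sum_sub_distrib]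

structure OZ (blk : N → K) (f : N → N → A) : Prop where
  pos : ∀ a b, blk a = blk b → ∃ w : Fin 2 → Fin 2 → A, f a a = ∑ l, star (w l 0) * w l 0 ∧
    f a b = ∑ l, star (w l 0) * w l 1 ∧ f b a = ∑ l, star (w l 1) * w l 0
  orth : ∀ X Y, BD blk X → BD blk Y → X * Y = 0 → Y * X = 0 → lin f X * lin f Y = 0

variable {blk : N → K} {f : N → N → A}

lemma BD_single {a b : N} (hab : blk a = blk b) : BD blk (Matrix.single a b (1 : ℂ)) := by
  intro c d hcd
  rw [Matrix.single_apply, if_neg]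
  rintro ⟨rfl, rfl⟩; exact hcd hab

lemma BD.add {X Y : Matrix N N ℂ} (hX : BD blk X) (hY : BD blk Y) : BD blk (X + Y) := fun a b hab => by
  simp [hX a b hab, hY a b hab]
lemma BD.sub {X Y : Matrix N N ℂ} (hX : BD blk X) (hY : BD blk Y) : BD blk (X - Y) := fun a b hab => by
  simp [hX a b hab, hY a b hab]


lemma OZ.star_eq (h : OZ blk f) {a b : N} (hab : blk a = blk b) : star (f a b) = f b a := by
  obtain ⟨w, h1, h2, h3⟩ := h.pos a b hab
  rw [h2, h3]; simp [star_sum]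

lemma OZ.P1 (h : OZ blk f) {a b : N} (hab : blk a = blk b) {z : A} (hz : z * f a a = 0) : z * f a b = 0 := by
  letI := CStarAlgebra.spectralOrder A
  letI := CStarAlgebra.spectralOrderedRing A
  obtain ⟨w, h1, h2, h3⟩ := h.pos a b hab
  have e : ∑ l, star (w l 0 * star z) * (w l 0 * star z) = 0 := by
    have : z * f a a * star z = 0 := by rw [hz, zero_mul]
    rw [h1, Finset.mul_sum, Finset.sum_mul] at this
    rw [← this]
    refine Finset.sum_congr rfl fun l _ => ?_
    simp [star_mul, mul_assoc]
  have e2 := (Finset.sum_eq_zero_iff_of_nonneg (fun l _ => star_mul_self_nonneg (w l 0 * star z))).1 e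
  rw [h2, Finset.mul_sum]
  refine Finset.sum_eq_zero fun l _ => ?_
  have e3 := (CStarRing.star_mul_self_eq_zero_iff _).1 (e2 l (Finset.mem_univ l))
  have e4 : z * star (w l 0) = 0 := by rw [← star_star (z * star (w l 0)), star_mul, star_star, e3, star_zero]
  rw [← mul_assoc, e4, zero_mul]

lemma OZ.R0 (h : OZ blk f) {a b c d : N} (hab : blk a = blk b) (hcd : blk c = blk d) (hbc : b ≠ c) :
    f a b * f c d = 0 := by
  have e1 : f b b * f c c = 0 := by
    have := h.orth (Matrix.single b b 1) (Matrix.single c c 1) (BD_single rfl) (BD_single rfl)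
      (Matrix.single_mul_single_of_ne _ _ _ _ hbc _) (Matrix.single_mul_single_of_ne _ _ _ _ hbc.symm _)
    rwa [lin_single, lin_single] at this
  have e2 : f b b * f c d = 0 := h.P1 hcd e1
  have e3 : f d c * f b b = 0 := by
    rw [← star_star (f d c * f b b), star_mul, h.star_eq rfl, h.star_eq hcd.symm, e2, star_zero]
  have e4 : f d c * f b a = 0 := h.P1 hab.symm e3
  rw [← star_star (f a b * f c d), star_mul, h.star_eq hab, h.star_eq hcd, e4, star_zero]

lemma OZ.three (h : OZ blk f) {a b c : N} (hab : blk a = blk b) (hac : blk a = blk c) :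
    f a a * f a c = f a b * f b c := by
  by_cases heq : a = b
  · subst heq; rfl
  have hbc : blk b = blk c := hab.symm.trans hac
  let e : N → N → Matrix N N ℂ := fun x y => Matrix.single x y 1
  have es : ∀ x y z, e x y * e y z = e x z := fun x y z => by
    simp [e]
  have en : ∀ x y z w, y ≠ z → e x y * e z w = 0 := fun x y z w hyz => 
    Matrix.single_mul_single_of_ne _ _ _ _ hyz _
  have heq' : b ≠ a := fun h => heq h.symm
  let X := e a a + e a b + (e b a + e b b)
  have hX : BD blk X := ((BD_single rfl).add (BD_single hab)).add ((BD_single hab.symm).add (BD_single rfl))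
  have lX : lin f X = f a a + f a b + (f b a + f b b) := by
    simp only [X, e, lin_add, lin_single]
  have key : ∃ Y, BD blk Y ∧ X * Y = 0 ∧ Y * X = 0 ∧ ∀ u, blk u = blk a → 
      (lin f Y * f c u = (f a c - f b c) * f c u ∨ lin f Y * f c u = - ((f a c - f b c) * f c u)) := by
    by_cases h1 : c = a ∨ c = b
    · refine ⟨e a a - e a b - (e b a - e b b), 
        ((BD_single rfl).sub (BD_single hab)).sub ((BD_single hab.symm).sub (BD_single rfl)), ?_, ?_, ?_⟩
      · simp only [X, add_mul, mul_sub, es, en _ _ _ _ heq, en _ _ _ _ heq']; abel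
      · simp only [X, mul_add, sub_mul, es, en _ _ _ _ heq, en _ _ _ _ heq']; abel
      · intro u hu
        simp only [e, lin_sub, lin_single]
        rcases h1 with rfl | rfl
        · left
          simp only [sub_mul, h.R0 hab hu.symm heq', h.R0 (a := b) rfl hu.symm heq']; abel
        · right
          simp only [sub_mul, h.R0 (a := a) rfl (hab.symm.trans hu.symm) heq, h.R0 hab.symm (hab.symm.trans hu.symm) heq]; abel
    · push Not at h1
      refine ⟨e a c - e b c, (BD_single hac).sub (BD_single hbc), ?_, ?_, fun u hu => Or.inl ?_⟩
      · simp only [X, add_mul, mul_sub, es, en _ _ _ _ heq, en _ _ _ _ heq']; abel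
      · simp only [X, mul_add, sub_mul, en _ _ _ _ h1.1, en _ _ _ _ h1.2]; abel
      · simp only [e, lin_sub, lin_single]
  obtain ⟨Y, hY, hXY, hYX, hl⟩ := key
  have h0 := h.orth X Y hX hY hXY hYX
  set G := f a a * f a c - f a b * f b c with hG
  have s1 : ∀ t u, blk t = blk a → blk u = blk a → f t a * G * f c u = 0 := by
    intro t u ht hu
    have e1 : f t a * lin f X = f t a * (f a a + f a b) := by
      rw [lX, mul_add, mul_add _ (f b a), h.R0 ht hab.symm heq, h.R0 ht rfl heq, add_zero, add_zero]
    have e2 : f t a * lin f X * (lin f Y * f c u) = 0 := by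
      rw [mul_assoc, ← mul_assoc (lin f X), h0, zero_mul, mul_zero]
    have e3 : f t a * (f a a + f a b) * ((f a c - f b c) * f c u) = 0 := by
      rw [e1] at e2
      rcases hl u hu with h3 | h3
      · rw [h3] at e2; exact e2
      · rw [h3, mul_neg, neg_eq_zero] at e2; exact e2
    have e4 : (f a a + f a b) * (f a c - f b c) = G := by
      rw [add_mul, mul_sub, mul_sub, h.R0 rfl hbc heq, h.R0 hab hac heq', hG]; abel
    rw [← e3, ← e4]; simp only [mul_assoc]
  have hGs : star G = f c a * f a a - f c b * f b a := by
    rw [hG, star_sub, star_mul, star_mul, h.star_eq hac, h.star_eq rfl, h.star_eq hbc, h.star_eq hab]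
  have s2 : ∀ t, blk t = blk a → f t a * G = 0 := by
    intro t ht
    have : f t a * G * star G = 0 := by
      rw [hGs, mul_sub, ← mul_assoc, ← mul_assoc, s1 t a ht rfl, s1 t b ht hab.symm]; simp
    rw [← CStarRing.mul_star_self_eq_zero_iff, star_mul, ← mul_assoc, this, zero_mul]
  have s3 : star G * G = 0 := by
    rw [hGs, sub_mul, mul_assoc, mul_assoc, s2 a rfl, s2 b hab.symm]; simp
  exact sub_eq_zero.1 ((CStarRing.star_mul_self_eq_zero_iff _).1 s3)

lemma OZ.comm (h : OZ blk f) {a b : N} (hab : blk a = blk b) : 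
    (∑ c, f c c) * f a b = f a a * f a b ∧ f a b * (∑ c, f c c) = f a a * f a b := by
  constructor
  · rw [Finset.sum_mul, Finset.sum_eq_single a]
    · intro c _ hc; exact h.R0 rfl hab hc
    · simp
  · rw [Finset.mul_sum, Finset.sum_eq_single b, h.three hab hab]
    · intro c _ hc; exact h.R0 hab rfl hc.symm
    · simp

lemma OZ.sum_nonneg [PartialOrder A] [StarOrderedRing A] (h : OZ blk f) : 0 ≤ ∑ c, f c c := by
  refine Finset.sum_nonneg fun c _ => ?_
  obtain ⟨w, h1, h2, h3⟩ := h.pos c c rfl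
  rw [h1]; exact Finset.sum_nonneg fun l _ => star_mul_self_nonneg _

/-- scalar function for the rows -/
def kf (δ t : ℝ) : ℝ := (√(|t| + δ))⁻¹

lemma kf_cont {δ : ℝ} (hδ : 0 < δ) : Continuous (kf δ) := by
  unfold kf
  refine Continuous.inv₀ (by fun_prop) fun t => ?_
  have : 0 < |t| + δ := by positivity
  exact (Real.sqrt_pos.2 this).ne'

lemma kf_sq {δ t : ℝ} (hδ : 0 < δ) (ht : 0 ≤ t) : kf δ t * kf δ t = (t + δ)⁻¹ := by
  unfold kf
  rw [← mul_inv, Real.mul_self_sqrt (by positivity), abs_of_nonneg ht]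

lemma k_props [PartialOrder A] [StarOrderedRing A] {g : A} (hg : 0 ≤ g) {δ : ℝ} (hδ : 0 < δ) :
    ∃ k : A, star k = k ∧ (∀ x, Commute g x → Commute k x) ∧ ‖k * k * g‖ ≤ 1 ∧ 
      1 - k * k * g = δ • (k * k) ∧ ‖k * k * (k * k) * g‖ ≤ δ⁻¹ := by
  have hc := kf_cont hδ
  have e1 : cfc (kf δ) g * cfc (kf δ) g * g = cfc (fun t => kf δ t * kf δ t * t) g := by
    conv_lhs => rw [← cfc_mul _ _ _ (by fun_prop) (by fun_prop)]; arg 2; rw [← cfc_id' ℝ g]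
    rw [← cfc_mul _ _ _ (by fun_prop) (by fun_prop)]
  have e2 : cfc (kf δ) g * cfc (kf δ) g * (cfc (kf δ) g * cfc (kf δ) g) * g = 
      cfc (fun t => kf δ t * kf δ t * (kf δ t * kf δ t * t)) g := by
    rw [mul_assoc (cfc (kf δ) g * cfc (kf δ) g), e1,← cfc_mul _ _ _ (by fun_prop) (by fun_prop), ← cfc_mul _ _ _ (by fun_prop) (by fun_prop)]
  refine ⟨cfc (kf δ) g, cfc_predicate (kf δ) g, fun x hx => ?_, ?_, ?_, ?_⟩
  · exact hx.cfc_real (kf δ)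
  · rw [e1]
    refine norm_cfc_le zero_le_one fun t ht => ?_
    have ht := spectrum_nonneg_of_nonneg hg ht
    rw [kf_sq hδ ht, Real.norm_of_nonneg (by positivity), inv_mul_le_iff₀ (by positivity)]; linarith
  · rw [e1, ← cfc_mul _ _ _ (by fun_prop) (by fun_prop), ← cfc_one ℝ g, ← cfc_sub _ _ _ (by fun_prop) (by fun_prop), ← cfc_smul _ _ _ (by fun_prop)]
    refine cfc_congr fun t ht => ?_
    have ht := spectrum_nonneg_of_nonneg hg ht
    simp only [kf_sq hδ ht, smul_eq_mul]
    field_simp; simp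
  · rw [e2]
    refine norm_cfc_le (by positivity) fun t ht => ?_
    have ht := spectrum_nonneg_of_nonneg hg ht
    rw [kf_sq hδ ht, Real.norm_of_nonneg (by positivity)]
    have h1 : (t + δ)⁻¹ ≤ δ⁻¹ := by gcongr; linarith
    have h2 : (t + δ)⁻¹ * t ≤ 1 := by rw [inv_mul_le_iff₀ (by positivity)]; linarith
    calc _ ≤ δ⁻¹ * 1 := by gcongr
      _ = _ := by ring

lemma OZ.rows (h : OZ blk f) (hn : ∀ a, ‖f a a‖ ≤ 1) {δ : ℝ} (hδ : 0 < δ) : ∃ v : N → A,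
    (∀ a b, blk a = blk b → star (v a) * v a = star (v b) * v b) ∧ 
    (∀ a b, a ≠ b → star (v a) * v b = 0) ∧ (∀ a, ‖v a‖ ≤ 1) ∧ 
    (∀ a b, blk a = blk b → ‖v a * star (v b) - f a b‖ ≤ √δ) := by
  letI := CStarAlgebra.spectralOrder A
  letI := CStarAlgebra.spectralOrderedRing A
  obtain ⟨k, k1, k2, k3, k4, k5⟩ := k_props h.sum_nonneg hδ
  have hk : ∀ a b, blk a = blk b → k * f a b = f a b * k := fun a b hab => 
    k2 _ (by rw [Commute, SemiconjBy, (h.comm hab).1, (h.comm hab).2])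
  have hex : ∀ a, ∃ b, blk b = blk a := fun a => ⟨a, rfl⟩
  let o : N → N := fun a => (hex a).choose
  have ho : ∀ a, blk (o a) = blk a := fun a => (hex a).choose_spec
  have ho2 : ∀ a b, blk a = blk b → o a = o b := fun a b hab => by
    simp only [o, hab]
  have hvv : ∀ a b, star (f a (o a) * k) * (f b (o b) * k) = if a = b then k * k * (∑ c, f c c) * f (o a) (o a) else 0 := by
    intro a b
    rw [star_mul, k1, h.star_eq (ho a).symm]
    have e : k * f (o a) a * (f b (o b) * k) = k * (f (o a) a * f b (o b)) * k := by simp only [mul_assoc]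
    rw [e]
    split_ifs with hab
    · subst hab
      rw [← h.three (ho a) rfl, mul_assoc, mul_assoc, ← hk _ _ rfl, ← mul_assoc (f _ _) k, ← hk _ _ rfl, mul_assoc,
        ← (h.comm (rfl : blk (o a) = blk (o a))).1]
      simp only [mul_assoc]
    · rw [h.R0 (ho a) (ho b).symm hab]; simp
  refine ⟨fun a => f a (o a) * k, fun a b hab => ?_, fun a b hab => ?_, fun a => ?_, fun a b hab => ?_⟩
  · rw [hvv, hvv, if_pos rfl, if_pos rfl, ho2 a b hab]
  · rw [hvv, if_neg hab]
  · refine cs_norm_sq_le zero_le_one ?_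
    rw [hvv, if_pos rfl, one_pow]
    exact (norm_mul_le _ _).trans (mul_le_one₀ k3 (norm_nonneg _) (hn _))
  · have e : f a (o a) * k * star (f b (o b) * k) = k * k * (∑ c, f c c) * f a b := by
      rw [star_mul, k1, h.star_eq (ho b).symm, ← hk _ _ (ho a).symm, mul_assoc _ (f a (o a)), ← mul_assoc (f a (o a)), ← hk _ _ (ho a).symm, 
        ← ho2 a b hab, mul_assoc k (f a (o a)), ← h.three (ho a).symm hab, ← (h.comm hab).1]
      simp only [mul_assoc]
    have e2 : k * k * (∑ c, f c c) * f a b - f a b = - (δ • (k * k * f a b)) := by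
      rw [← smul_mul_assoc, ← k4]; noncomm_ring
    rw [e, e2, norm_neg, norm_smul, Real.norm_of_nonneg hδ.le]
    have e3 : (k * k * f a b) * star (k * k * f a b) = k * k * (k * k) * (∑ c, f c c) * f a a := by
      rw [star_mul, star_mul, k1, h.star_eq hab]
      have : k * k * f a b * (f b a * (k * k)) = k * k * (f a b * f b a) * k * k := by simp only [mul_assoc]
      rw [this, ← h.three hab rfl]
      have : k * k * (f a a * f a a) * k * k = k * k * (k * k) * (f a a * f a a) := by
        have e5 := hk a a rfl
        have e6 : f a a * f a a * k = k * (f a a * f a a) := by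
          rw [mul_assoc, ← e5, ← mul_assoc, ← e5, mul_assoc]
        rw [mul_assoc (k * k) (f a a * f a a) k, e6, ← mul_assoc (k * k) k,
          mul_assoc (k * k * k) (f a a * f a a) k, e6]
        simp only [mul_assoc]
      rw [this, ← (h.comm rfl).1]; simp only [mul_assoc]
    have e4 : ‖k * k * f a b‖ ≤ (√δ)⁻¹ := by
      rw [← norm_star]
      refine cs_norm_sq_le (by positivity) ?_
      rw [star_star, e3, inv_pow, Real.sq_sqrt hδ.le]
      calc _ ≤ δ⁻¹ * 1 := (norm_mul_le _ _).trans (by gcongr; exact hn a)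
        _ = _ := mul_one _
    calc _ ≤ δ * (√δ)⁻¹ := by gcongr
      _ = √δ := by rw [← div_eq_mul_inv, Real.div_sqrt]



theorem rowND_of_nd {n : ℕ} (h : NuclearDimensionLE n A) : RowND n A := by
  intro S ε hε
  obtain ⟨s, r, J, ψ, φ, hψ, hφ, hψn, hφj, hS⟩ := h S (ε / 2) (half_pos hε)
  let N := Σ i, Fin (r i)
  let blk : N → Fin s := Sigma.fst
  let ψ' : A →ₗ[ℂ] Matrix N N ℂ := (bdHom s r).toAlgHom.toLinearMap ∘ₗ ψ
  let e : N → N → FDBlock s r := fun a b => Matrix.blockDiag' (Matrix.single a b 1)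
  have he : ∀ a b, blk a = blk b → bdHom s r (e a b) = Matrix.single a b 1 := fun a b hab =>
    bdHom_blockDiag (BD_single hab)
  have hinj : Function.Injective (bdHom s r) := Matrix.blockDiagonal'_injective
  have hbs : ∀ (X : Matrix N N ℂ) j, (∀ a b, J (blk a) ≠ j → X a b = 0) → 
      (Matrix.blockDiag' X : FDBlock s r) ∈ blockSupp J j := by
    intro X j hX i hi
    ext a b
    exact hX ⟨i, a⟩ ⟨i, b⟩ hi
  -- the decomposition of `φ`
  have hsum : ∀ X : Matrix N N ℂ, φ (Matrix.blockDiag' X) = lin (fun a b => φ (e a b)) X := by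
    intro X
    have h1 : X = ∑ a, ∑ b, X a b • Matrix.single a b (1 : ℂ) := by
      conv_lhs => rw [Matrix.matrix_eq_sum_single X]
      simp
    let L : Matrix N N ℂ →ₗ[ℂ] FDBlock s r := 
      { toFun := fun X => Matrix.blockDiag' X, map_add' := fun _ _ => rfl, map_smul' := fun _ _ => rfl }
    have h2 : φ (Matrix.blockDiag' X) = (φ ∘ₗ L) X := rfl
    rw [h2]
    conv_lhs => rw [h1]
    simp only [map_sum, map_smul]
    rfl
  let f : Fin (n + 1) → N → N → A := fun j a b => if J (blk a) = j ∧ blk a = blk b then φ (e a b) else 0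
  have hf : ∀ j, OZ blk (f j) := by
    intro j
    constructor
    · intro a b hab
      by_cases hj : J (blk a) = j
      · have hj' : J (blk b) = j := hab ▸ hj
        simp only [f, hj, hj', hab, and_self, if_true]
        let y : Matrix (Fin 2) (Fin 2) (FDBlock s r) := Matrix.of ![![e a a, e a b], ![0, 0]]
        obtain ⟨w, hw⟩ := hφ 2 (star y * y) ⟨y, rfl⟩
        have key : ∀ p q, φ ((star y * y) p q) = ∑ l, star (w l p) * w l q := by
          intro p q
          have := congrFun (congrFun hw p) q
          rw [Matrix.map_apply] at this
          rw [this, Matrix.mul_apply]; rfl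
        have hst : ∀ x z, blk x = blk z → star (e x z) = e z x := fun x z hxz => by
          apply hinj
          rw [map_star, he _ _ hxz, he _ _ hxz.symm]
          ext p q; simp [Matrix.star_apply, Matrix.single_apply, and_comm]
        have hmu : ∀ x y z, blk x = blk y → blk y = blk z → e x y * e y z = e x z := fun x y z h1 h2 => by
          apply hinj
          rw [map_mul, he _ _ h1, he _ _ h2, he _ _ (h1.trans h2)]; simp
        have c00 : (star y * y) 0 0 = e a a := by
          simp [Matrix.mul_apply, y, Matrix.star_apply, hst _ _ rfl, hmu _ _ _ rfl rfl]
        have c01 : (star y * y) 0 1 = e a b := by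
          simp [Matrix.mul_apply, y, Matrix.star_apply, hst _ _ rfl, hmu _ _ _ rfl hab]
        have c10 : (star y * y) 1 0 = e b a := by
          simp [Matrix.mul_apply, y, Matrix.star_apply, hst _ _ hab, hmu _ _ _ hab.symm rfl]
        refine ⟨w, ?_, ?_, ?_⟩
        · rw [← key, c00]
        · rw [← key, c01]
        · rw [← key, c10]
      · have hj' : ¬ J (blk b) = j := hab ▸ hj
        exact ⟨0, by simp [f, hj], by simp [f, hj], by simp [f, hj']⟩
    · intro X Y hX hY hXY hYX
      let cut : Matrix N N ℂ → Matrix N N ℂ := fun X a b => if J (blk a) = j then X a b else 0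
      have hcut : ∀ X, BD blk X → lin (f j) X = φ (Matrix.blockDiag' (cut X)) := by
        intro X hX
        rw [hsum]
        refine Finset.sum_congr rfl fun a _ => Finset.sum_congr rfl fun b _ => ?_
        by_cases h1 : J (blk a) = j
        · by_cases h2 : blk a = blk b
          · simp [f, cut, h1, h2]
          · simp [hX a b h2, cut]
        · simp [f, cut, h1]
      have hcBD : ∀ X, BD blk X → BD blk (cut X) := fun X hX a b hab => by simp [cut, hX a b hab]
      have hm : ∀ X Y, BD blk X → BD blk Y → X * Y = 0 → 
          (Matrix.blockDiag' (cut X) * Matrix.blockDiag' (cut Y) : FDBlock s r) = 0 := by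
        intro X Y hX hY hXY
        apply hinj
        rw [map_mul, bdHom_blockDiag (hcBD X hX), bdHom_blockDiag (hcBD Y hY), map_zero]
        ext a b
        have h1 := congrFun (congrFun hXY a) b
        rw [Matrix.mul_apply] at h1
        rw [Matrix.mul_apply]
        by_cases hj : J (blk a) = j
        · rw [← h1]
          refine Finset.sum_congr rfl fun c _ => ?_
          by_cases hc : blk a = blk c
          · simp [cut, hj, ← hc]
          · simp [cut, hX a c hc]
        · simp [cut, hj]
      have hmem : ∀ X, (Matrix.blockDiag' (cut X) : FDBlock s r) ∈ blockSupp J j := fun X => 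
        hbs _ j fun a b h => by simp [cut, h]
      rw [hcut X hX, hcut Y hY]
      exact ((hφj j).2 _ (hmem X) _ (hmem Y) (hm X Y hX hY hXY) (hm Y X hY hX hYX)).1
  have hfn : ∀ j a, ‖f j a a‖ ≤ 1 := by
    intro j a
    by_cases hj : J (blk a) = j
    · simp only [f, hj, and_self, if_true]
      refine ((hφj j).1 _ (hbs _ j fun x y hx => ?_)).trans ?_
      · rw [Matrix.single_apply, if_neg]
        rintro ⟨rfl, rfl⟩; exact hx hj
      · rw [← bdHom_norm, he a a rfl]
        have : star (Matrix.single a a (1 : ℂ)) * Matrix.single a a 1 = Matrix.single a a 1 := by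
          have : star (Matrix.single a a (1 : ℂ)) = Matrix.single a a 1 := by
            ext p q; simp [Matrix.star_apply, Matrix.single_apply, and_comm]
          rw [this]; simp
        have h2 : ‖Matrix.single a a (1 : ℂ)‖ * ‖Matrix.single a a (1 : ℂ)‖ = ‖Matrix.single a a (1 : ℂ)‖ := by
          rw [← CStarRing.norm_star_mul_self, this]
        by_contra h
        push Not at h
        nlinarith
    · simp [f, hj]
  -- choice of `δ`
  let C : ℝ := ∑ b ∈ S, ∑ x, ∑ y, ‖ψ' b x y‖
  have hC : 0 ≤ C := by positivity
  let η := ε / 2 / (C + 1)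
  have hη : 0 < η := by positivity
  choose v hv1 hv2 hv3 hv4 using fun j => (hf j).rows (hfn j) (δ := η ^ 2) (by positivity)
  refine ⟨N, Fin s, inferInstance, inferInstance, inferInstance, inferInstance, blk, J, 
    fun a => v (J (blk a)) a, ψ', ⟨fun a b hab => ?_, fun a b hab hJ => ?_, fun a => hv3 _ a⟩, 
    fun b => bdHom_BD _, ?_, fun b => ?_, fun b hb => ?_⟩
  · simp only [hab]; exact hv1 _ a b hab
  · simp only [hJ]; exact hv2 _ a b hab
  · intro k a
    let y : Matrix (Fin k) (Fin k) A := Matrix.of fun p q => if p.1 = 0 then a q else 0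
    by_cases hk : k = 0
    · subst hk
      convert Matrix.PosSemidef.zero using 1
      ext p; exact p.1.elim0
    obtain ⟨w, hw⟩ := hψ k (star y * y) ⟨y, rfl⟩
    have key : ∀ p q, ψ (star (a p) * a q) = ∑ l, star (w l p) * w l q := by
      intro p q
      have := congrFun (congrFun hw p) q
      rw [Matrix.map_apply] at this
      have e1 : (star y * y) p q = star (a p) * a q := by
        rw [Matrix.mul_apply, Finset.sum_eq_single ⟨0, Nat.pos_of_ne_zero hk⟩]
        · simp [y, Matrix.star_apply]
        · intro l _ hl
          have : l.1 ≠ 0 := fun h => hl (Fin.ext h)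
          simp [y, this]
        · simp
      rw [← e1, this, Matrix.mul_apply]; rfl
    have : (Matrix.of fun (p q : Fin k × N) => ψ' (star (a p.1) * a q.1) p.2 q.2) = 
      ∑ l, (Matrix.of fun (c : N) (q : Fin k × N) => bdHom s r (w l q.1) c q.2).conjTranspose * 
        (Matrix.of fun (c : N) (q : Fin k × N) => bdHom s r (w l q.1) c q.2) := by
      ext p q
      have : ψ' (star (a p.1) * a q.1) = bdHom s r (ψ (star (a p.1) * a q.1)) := rfl
      rw [Matrix.of_apply, this, key, map_sum, Matrix.sum_apply, Matrix.sum_apply]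
      refine Finset.sum_congr rfl fun l _ => ?_
      rw [map_mul, map_star, Matrix.mul_apply, Matrix.mul_apply]
      rfl
    rw [this]
    exact Matrix.posSemidef_sum _ fun l _ => Matrix.posSemidef_conjTranspose_mul_self _
  · exact (bdHom_norm (ψ b)).le.trans (hψn b)
  · have e1 : φ (ψ b) = ∑ x, ∑ y, ψ' b x y • φ (e x y) := by
      have : ψ b = Matrix.blockDiag' (ψ' b) := (Matrix.blockDiag'_blockDiagonal' _).symm
      conv_lhs => rw [this]
      exact hsum _
    have e2 : ‖phi (fun a => v (J (blk a)) a) (ψ' b) - φ (ψ b)‖ ≤ ε / 2 := by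
      rw [e1, phi_apply, ← Finset.sum_sub_distrib]
      have : ∀ x, ‖∑ y, ψ' b x y • (v (J (blk x)) x * star (v (J (blk y)) y)) - ∑ y, ψ' b x y • φ (e x y)‖ ≤ 
          ∑ y, ‖ψ' b x y‖ * η := by
        intro x
        rw [← Finset.sum_sub_distrib]
        refine norm_sum_le_of_le _ fun y _ => ?_
        rw [← smul_sub, norm_smul]
        by_cases hxy : blk x = blk y
        · gcongr
          have := hv4 (J (blk x)) x y hxy
          rw [Real.sqrt_sq hη.le] at this
          simpa only [f, hxy, and_self, if_true] using this
        · rw [show ψ' b x y = 0 from bdHom_BD _ _ _ hxy]; simp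
      refine (norm_sum_le_of_le _ fun x _ => this x).trans ?_
      simp only [← Finset.sum_mul]
      have h1 : ∑ x, ∑ y, ‖ψ' b x y‖ ≤ C := 
        Finset.single_le_sum (f := fun b => ∑ x, ∑ y, ‖ψ' b x y‖) (fun b _ => by positivity) hb
      calc _ ≤ (C + 1) * η := by gcongr; linarith
        _ = ε / 2 := by simp only [η]; field_simp
    have e3 := hS b hb
    calc _ ≤ ‖phi (fun a => v (J (blk a)) a) (ψ' b) - φ (ψ b)‖ + ‖φ (ψ b) - b‖ := norm_sub_le_norm_sub_add_norm_sub _ _ _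
      _ < ε := by linarith

end OZ
end

section

lemma cstarMatrix_tendsto_zero {m A : Type} [Fintype m] [CStarAlgebra A] [PartialOrder A]
    [StarOrderedRing A]
    {M : ℕ → CStarMatrix m m A} (h : ∀ i j, Tendsto (fun k => M k i j) atTop (𝓝 0)) :
    Tendsto (fun k => ‖M k‖) atTop (𝓝 0) := by
  have : Tendsto M atTop (𝓝 0) := by
    have key : ∀ (g : ℕ → m → m → A), (∀ i j, Tendsto (fun k => g k i j) atTop (𝓝 0)) →
        Tendsto g atTop (𝓝 (0 : m → m → A)) := by
      intro g hg
      rw [tendsto_pi_nhds]; intro i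
      rw [tendsto_pi_nhds]; intro j
      exact hg i j
    exact key M h
  simpa using this.norm

theorem rowND_of_asymp {n : ℕ} {P A : Type} [CStarAlgebra P] [CStarAlgebra A] (hA : RowND n A)
    (ι : P →⋆ₐ[ℂ] A) (β : ℕ → A →ₗ[ℂ] P) {C : ℝ} (hC : ∀ k a, ‖β k a‖ ≤ C * ‖a‖)
    (hmul : ∀ a b, Tendsto (fun k => β k (a * b) - β k a * β k b) atTop (𝓝 0))
    (hstar : ∀ a, Tendsto (fun k => β k (star a) - star (β k a)) atTop (𝓝 0))
    (hι : ∀ p, Tendsto (fun k => β k (ι p) - p) atTop (𝓝 0)) : RowND n P := by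
  letI := CStarAlgebra.spectralOrder P
  letI := CStarAlgebra.spectralOrderedRing P
  letI := CStarAlgebra.spectralOrder A
  letI := CStarAlgebra.spectralOrderedRing A
  classical
  have hC0 : ∀ a, 0 ≤ C * ‖a‖ := fun a => (norm_nonneg _).trans (hC 0 a)
  have bz : ∀ {f : ℕ → P} (a : A), Tendsto f atTop (𝓝 0) → Tendsto (fun k => f k * β k a) atTop (𝓝 0) := by
    intro f a hf
    refine squeeze_zero_norm (a := fun k => ‖f k‖ * (C * ‖a‖)) (fun k => ?_) ?_
    · exact (norm_mul_le _ _).trans (by gcongr; exact hC k a)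
    · simpa using (hf.norm).mul_const (C * ‖a‖)
  have zb : ∀ {f : ℕ → P} (a : A), Tendsto f atTop (𝓝 0) → Tendsto (fun k => β k a * f k) atTop (𝓝 0) := by
    intro f a hf
    refine squeeze_zero_norm (a := fun k => (C * ‖a‖) * ‖f k‖) (fun k => ?_) ?_
    · exact (norm_mul_le _ _).trans (by gcongr; exact hC k a)
    · simpa using (hf.norm).const_mul (C * ‖a‖)
  have H1 : ∀ a b, Tendsto (fun k => star (β k a) * β k b - β k (star a * b)) atTop (𝓝 0) := by
    intro a b
    have := (((bz b (hstar a)).add (hmul (star a) b)).neg)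
    simp only [add_zero, neg_zero] at this
    refine this.congr fun k => ?_
    noncomm_ring
  have H2 : ∀ a b, Tendsto (fun k => β k a * star (β k b) - β k (a * star b)) atTop (𝓝 0) := by
    intro a b
    have := (((zb a (hstar b)).add (hmul a (star b))).neg)
    simp only [add_zero, neg_zero] at this
    refine this.congr fun k => ?_
    noncomm_ring
  have hone : Tendsto (fun k => β k 1 - 1) atTop (𝓝 0) := by simpa using hι 1
  have hnb : ∀ a, ‖a‖ ≤ 1 → ∀ ε > 0, ∀ᶠ k in atTop, ‖star (β k a) * β k a‖ ≤ 1 + ε := by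
    intro a ha ε hε
    obtain ⟨z, hz⟩ : ∃ z, 1 - star a * a = star z * z := by
      apply nonneg_ex
      rw [sub_nonneg, ← CStarAlgebra.norm_le_one_iff_of_nonneg _ (star_mul_self_nonneg _),
        CStarRing.norm_star_mul_self]
      nlinarith [norm_nonneg a]
    have h : Tendsto (fun k => star (β k a) * β k a + star (β k z) * β k z - 1) atTop (𝓝 0) := by
      have := ((H1 a a).add (H1 z z)).add hone
      simp only [add_zero] at this
      refine this.congr fun k => ?_
      have h2 : β k (star z * z) = β k 1 - β k (star a * a) := by rw [← hz, map_sub]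
      rw [h2]; abel
    filter_upwards [(tendsto_zero_iff_norm_tendsto_zero.1 h).eventually (gt_mem_nhds hε)] with k hk
    have h3 : ‖star (β k a) * β k a + star (β k z) * β k z‖ ≤ 1 + ε := by
      have e : star (β k a) * β k a + star (β k z) * β k z = 1 +
        (star (β k a) * β k a + star (β k z) * β k z - 1) := by abel
      rw [e]
      rcases subsingleton_or_nontrivial P with hs | hs
      · rw [Subsingleton.elim (1 + _) (0 : P), norm_zero]; positivity
      · refine (norm_add_le _ _).trans ?_
        rw [CStarRing.norm_one]; gcongr
    refine le_trans ?_ h3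
    exact CStarAlgebra.norm_le_norm_of_nonneg_of_le (star_mul_self_nonneg _)
      (le_add_of_nonneg_right (star_mul_self_nonneg _))
  intro S ε hε
  let C' := max C 0 + 1
  have hC' : 0 < C' := by positivity
  obtain ⟨N, K, _, _, _, _, blk, J, v, ψ, hv, hbd, hcp, hn, hS⟩ := hA (S.image ι) (ε / 4 / C') (by positivity)
  let R : ℝ := ∑ p ∈ S, ‖p‖
  have hR : 0 ≤ R := by positivity
  let t : ℝ := ε / 4 / ((n + 1) * 12 * (R + 1))
  have ht : 0 < t := by positivity
  let ε1 : ℝ := min 1 (t ^ 2)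
  have hε1 : 0 < ε1 := by positivity
  have hε1' : √ε1 ≤ t := by
    rw [Real.sqrt_le_left ht.le]; exact min_le_right _ _
  -- representatives
  let c' : ℕ → K → P := fun k κ => if h : ∃ a, blk a = κ then star (β k (v h.choose)) * β k (v h.choose) else 0
  have hc' : ∀ a, ∃ b, blk b = blk a ∧ ∀ k, c' k (blk a) = star (β k (v b)) * β k (v b) := by
    intro a
    have h : ∃ b, blk b = blk a := ⟨a, rfl⟩
    exact ⟨h.choose, h.choose_spec, fun k => by simp [c', h]⟩
  have ev1 : ∀ j : Fin (n + 1), ∀ᶠ k in atTop,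
      ‖star (rowM (rst (fun a => J (blk a) = j) (fun a => β k (v a)))) * rowM (rst (fun a => J (blk a) = j) (fun a => β k (v a)))
      - diagM (fun i => i.elim 0 (rst (fun a => J (blk a) = j) (fun a => c' k (blk a))))‖ ≤ ε1 := by
    intro j
    refine Eventually.mono (Tendsto.eventually (cstarMatrix_tendsto_zero ?_) (gt_mem_nhds hε1)) (fun k h => h.le)
    intro x y
    cases x with
    | none => 
      refine tendsto_const_nhds.congr fun k => ?_
      rw [CStarMatrix.sub_apply, diagM_apply]
      cases y <;> simp [CStarMatrix.mul_apply, CStarMatrix.star_apply, Fintype.sum_option]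
    | some a =>
      cases y with
      | none => 
        refine tendsto_const_nhds.congr fun k => ?_
        rw [CStarMatrix.sub_apply, diagM_apply]
        simp [CStarMatrix.mul_apply, CStarMatrix.star_apply, Fintype.sum_option]
      | some b =>
        simp only [CStarMatrix.sub_apply, diagM_apply, rowM_star_mul]
        by_cases ha : J (blk a) = j
        · by_cases hb : J (blk b) = j
          · by_cases hab : a = b
            · subst hab
              obtain ⟨b, hb1, hb2⟩ := hc' a
              have := (H1 (v a) (v a)).sub (H1 (v b) (v b))
              simp only [sub_zero] at this
              refine this.congr fun k => ?_
              rw [hv.diag b a hb1]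
              simp [rst, ha, hb2]
            · refine (H1 (v a) (v b)).congr fun k => ?_
              rw [hv.off a b hab (ha.trans hb.symm)]
              simp [rst, ha, hb, hab]
          · have hab : a ≠ b := fun h => hb (h ▸ ha)
            refine tendsto_const_nhds.congr fun k => ?_
            simp [rst, hb, hab]
        · refine tendsto_const_nhds.congr fun k => ?_
          simp [rst, ha]
  have ev2 : ∀ a : N, ∀ᶠ k in atTop, ‖c' k (blk a)‖ ≤ 1 + ε1 := by
    intro a
    obtain ⟨b, hb1, hb2⟩ := hc' a
    simp only [hb2]
    exact hnb _ (hv.nrm b) _ hε1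
  have ev3 : ∀ p ∈ S, ∀ᶠ k in atTop, ‖phi (fun a => β k (v a)) (ψ (ι p)) - β k (phi v (ψ (ι p)))‖ < ε / 4 := by
    intro p _
    have : Tendsto (fun k => phi (fun a => β k (v a)) (ψ (ι p)) - β k (phi v (ψ (ι p)))) atTop (𝓝 0) := by
      simp only [phi_apply, map_sum, map_smul, ← Finset.sum_sub_distrib, ← smul_sub]
      rw [show (0 : P) = ∑ a : N, ∑ b : N, (ψ (ι p)) a b • 0 by simp]
      exact tendsto_finsetSum _ fun a _ => tendsto_finsetSum _ fun b _ => (H2 (v a) (v b)).const_smul _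
    exact (tendsto_zero_iff_norm_tendsto_zero.1 this).eventually (gt_mem_nhds (by positivity))
  have ev4 : ∀ p ∈ S, ∀ᶠ k in atTop, ‖β k (ι p) - p‖ < ε / 4 := fun p _ =>
    (tendsto_zero_iff_norm_tendsto_zero.1 (hι p)).eventually (gt_mem_nhds (by positivity))
  rw [← Finset.eventually_all] at ev3 ev4
  obtain ⟨k, h1, h2, h3, h4⟩ := ((eventually_all.2 ev1).and ((eventually_all.2 ev2).and (ev3.and ev4))).exists
  obtain ⟨T, hT, hT2, -⟩ := kr_rows (y := fun a => β k (v a)) (c := fun a => c' k (blk a)) hε1 (min_le_left _ _)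
    (fun a => by obtain ⟨b, -, hb⟩ := hc' a; simp only [hb]; exact star_mul_self_nonneg _)
    (fun a b h => by simp only [h]) h2 h1
  refine ⟨N, K, inferInstance, inferInstance, inferInstance, inferInstance, blk, J, T, 
    ψ.comp ι.toAlgHom.toLinearMap, hT, fun b => hbd _, fun k a => ?_, fun b => ?_, fun p hp => ?_⟩
  · have := hcp k (fun i => ι (a i))
    convert this using 5
    simp [map_star]
  · exact (hn _).trans (NonUnitalStarAlgHom.norm_apply_le ι b)
  · change ‖phi T (ψ (ι p)) - p‖ < ε
    have e : phi T (ψ (ι p)) - p = (phi T (ψ (ι p)) - phi (fun a => β k (v a)) (ψ (ι p))) + 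
      (phi (fun a => β k (v a)) (ψ (ι p)) - β k (phi v (ψ (ι p)))) + 
      (β k (phi v (ψ (ι p)) - ι p)) + (β k (ι p) - p) := by rw [map_sub]; abel
    have i1 := hT2 _ (hbd (ι p))
    have i2 := h3 p hp
    have i4 := h4 p hp
    have i3 : ‖β k (phi v (ψ (ι p)) - ι p)‖ < ε / 4 := by
      have := hS _ (Finset.mem_image_of_mem ι hp)
      calc _ ≤ C * ‖phi v (ψ (ι p)) - ι p‖ := hC _ _
        _ ≤ C' * ‖phi v (ψ (ι p)) - ι p‖ := by
            gcongr; exact (le_max_left C 0).trans (by simp [C'])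
        _ < C' * (ε / 4 / C') := by gcongr
        _ = ε / 4 := by field_simp
    have i0 : ‖ψ (ι p)‖ ≤ R := by
      refine (hn _).trans ((NonUnitalStarAlgHom.norm_apply_le ι p).trans ?_)
      exact Finset.single_le_sum (f := fun p => ‖p‖) (fun _ _ => norm_nonneg _) hp
    have i5 : (n + 1) * (12 * √ε1) * ‖ψ (ι p)‖ ≤ ε / 4 := by
      calc _ ≤ (n + 1) * (12 * t) * (R + 1) := by gcongr; linarith
        _ = ε / 4 := by simp only [t]; field_simp
    rw [e]
    refine (norm_add_le _ _).trans_lt ?_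
    have := norm_add₃_le (a := phi T (ψ (ι p)) - phi (fun a => β k (v a)) (ψ (ι p))) (b := 
      (phi (fun a => β k (v a)) (ψ (ι p)) - β k (phi v (ψ (ι p))))) (c := β k (phi v (ψ (ι p)) - ι p))
    linarith
end

section

/-- asymptotic equality of sequences -/
def Eqv {A : Type} [CStarAlgebra A] (f g : ℕ → A) : Prop := Tendsto (fun k => f k - g k) atTop (𝓝 0)
def Bdd {A : Type} [CStarAlgebra A] (f : ℕ → A) : Prop := ∃ M : ℝ, ∀ k, ‖f k‖ ≤ M

section eqv
variable {A : Type} [CStarAlgebra A]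

lemma Bdd.nn {f : ℕ → A} (h : Bdd f) : ∃ M : ℝ, 0 ≤ M ∧ ∀ k, ‖f k‖ ≤ M := by
  obtain ⟨M, hM⟩ := h
  exact ⟨M, (norm_nonneg _).trans (hM 0), hM⟩
lemma Bdd.mul {f g : ℕ → A} (hf : Bdd f) (hg : Bdd g) : Bdd (f * g) := by
  obtain ⟨M, h0, hM⟩ := hf.nn
  obtain ⟨M', h0', hM'⟩ := hg.nn
  exact ⟨M * M', fun k => (norm_mul_le _ _).trans (by gcongr; exacts [hM k, hM' k])⟩
lemma Bdd.const (a : A) : Bdd (fun _ => a) := ⟨‖a‖, fun _ => le_rfl⟩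
lemma Bdd.sub {f g : ℕ → A} (hf : Bdd f) (hg : Bdd g) : Bdd (f - g) := by
  obtain ⟨M, h0, hM⟩ := hf.nn
  obtain ⟨M', h0', hM'⟩ := hg.nn
  exact ⟨M + M', fun k => (norm_sub_le _ _).trans (by gcongr; exacts [hM k, hM' k])⟩
lemma Bdd.star {f : ℕ → A} (hf : Bdd f) : Bdd (star f) := by
  obtain ⟨M, hM⟩ := hf
  exact ⟨M, fun k => by simpa using hM k⟩
lemma Eqv.refl (f : ℕ → A) : Eqv f f := by simp [Eqv]
lemma Eqv.symm {f g : ℕ → A} (h : Eqv f g) : Eqv g f := by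
  have := Tendsto.neg h
  simpa [Eqv] using this
lemma Eqv.trans {f g h : ℕ → A} (h1 : Eqv f g) (h2 : Eqv g h) : Eqv f h := by
  have := Tendsto.add h1 h2
  simpa [Eqv] using this
instance : Trans (Eqv (A := A)) Eqv Eqv := ⟨Eqv.trans⟩
lemma Eqv.add {f g f' g' : ℕ → A} (h1 : Eqv f g) (h2 : Eqv f' g') : Eqv (f + f') (g + g') := by
  have := Tendsto.add h1 h2
  rw [add_zero] at this
  exact this.congr fun k => by simp only [Pi.add_apply]; abel
lemma Eqv.sub {f g f' g' : ℕ → A} (h1 : Eqv f g) (h2 : Eqv f' g') : Eqv (f - f') (g - g') := by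
  have := Tendsto.sub h1 h2
  rw [sub_zero] at this
  exact this.congr fun k => by simp only [Pi.sub_apply]; abel
lemma Eqv.mul_left {f g h : ℕ → A} (hh : Bdd h) (h1 : Eqv f g) : Eqv (h * f) (h * g) := by
  obtain ⟨M, h0, hM⟩ := hh.nn
  refine squeeze_zero_norm (a := fun k => M * ‖f k - g k‖) (fun k => ?_) (by simpa using (Tendsto.norm h1).const_mul M)
  rw [Pi.mul_apply, Pi.mul_apply, ← mul_sub]
  exact (norm_mul_le _ _).trans (by gcongr; exact hM k)
lemma Eqv.mul_right {f g h : ℕ → A} (hh : Bdd h) (h1 : Eqv f g) : Eqv (f * h) (g * h) := by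
  obtain ⟨M, h0, hM⟩ := hh.nn
  refine squeeze_zero_norm (a := fun k => ‖f k - g k‖ * M) (fun k => ?_) (by simpa using (Tendsto.norm h1).mul_const M)
  rw [Pi.mul_apply, Pi.mul_apply, ← sub_mul]
  exact (norm_mul_le _ _).trans (by gcongr; exact hM k)
lemma Eqv.star {f g : ℕ → A} (h1 : Eqv f g) : Eqv (star f) (star g) := by
  have : Tendsto (fun k => Star.star (f k - g k)) atTop (𝓝 (Star.star 0)) := (continuous_star.tendsto _).comp h1
  rw [star_zero] at this
  exact this.congr fun k => by simp
end eqv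

section rok
variable {P A : Type} [CStarAlgebra P] [CStarAlgebra A]

lemma condexp_props {ι : P →⋆ₐ[ℂ] A} {E : A →ₗ[ℂ] P} (hE : IsCondExpect ι E) :
    (∃ C : ℝ, 0 ≤ C ∧ ∀ a, ‖E a‖ ≤ C * ‖a‖) ∧ ∀ a, E (star a) = star (E a) := by
  letI := CStarAlgebra.spectralOrder P
  letI := CStarAlgebra.spectralOrderedRing P
  letI := CStarAlgebra.spectralOrder A
  letI := CStarAlgebra.spectralOrderedRing A
  let F : A →ₚ[ℂ] P := PositiveLinearMap.mk₀ E fun x hx => by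
    obtain ⟨y, rfl⟩ := nonneg_ex hx
    obtain ⟨z, hz⟩ := hE.pos y
    rw [hz]; exact star_mul_self_nonneg _
  constructor
  · obtain ⟨C, hC⟩ := PositiveLinearMap.exists_norm_apply_le F
    exact ⟨C, C.2, hC⟩
  · intro a
    exact map_star F a

lemma neg_part_ex {M : Type} [CStarAlgebra M] {g : M} (hsa : IsSelfAdjoint g) :
    ∃ x z : M, star x = x ∧ x * g * x = - (star z * z) ∧ (z = 0 → ∃ y, g = star y * y) := by
  letI := CStarAlgebra.spectralOrder M
  letI := CStarAlgebra.spectralOrderedRing M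
  have hx0 : 0 ≤ g⁻ := CFC.negPart_nonneg g
  have hxs : star g⁻ = g⁻ := (IsSelfAdjoint.of_nonneg hx0)
  have h1 : g = g⁺ - g⁻ := (CFC.posPart_sub_negPart g hsa).symm
  have e1 : g⁻ * g * g⁻ = - (g⁻ * g⁻ * g⁻) := by
    have h2 : g⁻ * g⁺ = 0 := CFC.negPart_mul_posPart g
    have : g⁻ * g = - (g⁻ * g⁻) := by
      conv_lhs => rw [h1]
      rw [mul_sub]
      conv_lhs => rw [← h1]
      rw [h2, zero_sub]
    rw [this, neg_mul]
  obtain ⟨z, hz⟩ : ∃ z : M, g⁻ * g⁻ * g⁻ = star z * z := by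
    apply nonneg_ex
    have := star_left_conjugate_nonneg hx0 g⁻
    rwa [hxs] at this
  refine ⟨g⁻, z, hxs, by rw [e1, hz], fun h => ?_⟩
  rw [h, mul_zero] at hz
  have hxx : g⁻ * g⁻ = 0 := by
    rw [← CStarRing.star_mul_self_eq_zero_iff, star_mul, hxs]
    rw [← mul_assoc, hz, zero_mul]
  have hn : g⁻ = 0 := by
    rw [← CStarRing.star_mul_self_eq_zero_iff, hxs, hxx]
  apply nonneg_ex
  rw [h1, hn, sub_zero]
  exact CFC.posPart_nonneg g

/-- complete positivity of `E`, for the matrix `E (v j * star (v k))` -/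
lemma condexp_cp {ι : P →⋆ₐ[ℂ] A} {E : A →ₗ[ℂ] P} (hE : IsCondExpect ι E) {m : ℕ} (v : Fin m → A) :
    ∃ y : Fin m → Fin m → P, ∀ j k, E (v j * star (v k)) = ∑ l, star (y l j) * y l k := by
  letI := CStarAlgebra.spectralOrder P
  letI := CStarAlgebra.spectralOrderedRing P
  have hs := (condexp_props hE).2
  let g : CStarMatrix (Fin m) (Fin m) P := CStarMatrix.ofMatrix fun j k => E (v j * star (v k))
  have hg : ∀ j k, g j k = E (v j * star (v k)) := fun j k => rfl
  have hsa : IsSelfAdjoint g := by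
    refine CStarMatrix.ext fun j k => ?_
    rw [CStarMatrix.star_apply, hg, hg, ← hs]; simp
  obtain ⟨x, z, hxs, hz, hfin⟩ := neg_part_ex hsa
  obtain ⟨y, hy⟩ : ∃ y, g = star y * y := by
    have hpos : ∀ i, 0 ≤ (x * g * x) i i := by
      intro i
      have : (x * g * x) i i = E (star (∑ k, star (v k) * ι (x k i)) * (∑ k, star (v k) * ι (x k i))) := by
        simp only [star_sum, Finset.sum_mul, Finset.mul_sum, map_sum, star_mul, star_star]
        simp only [CStarMatrix.mul_apply, Finset.sum_mul]
        refine Finset.sum_congr rfl fun k _ => Finset.sum_congr rfl fun j _ => ?_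
        have := hE.bimodule (star (x j i)) (x k i) (v j * star (v k))
        rw [map_star, ] at this
        rw [mul_assoc (star (ι _)), ← mul_assoc (v j), ← mul_assoc, this]
        have h3 : x i j = star (x j i) := by
          conv_lhs => rw [← hxs]
          rw [CStarMatrix.star_apply]
        rw [h3, hg]
      rw [this]
      obtain ⟨y, hy⟩ := hE.pos (∑ k, star (v k) * ι (x k i))
      rw [hy]; exact star_mul_self_nonneg _
    have hz0 : ∀ l i, z l i = 0 := by
      intro l i
      have h1 := hpos i
      rw [hz, CStarMatrix.neg_apply, CStarMatrix.mul_apply] at h1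
      simp only [CStarMatrix.star_apply] at h1
      have h2 : ∑ l, star (z l i) * z l i = 0 := 
        le_antisymm (neg_nonneg.1 h1) (Finset.sum_nonneg fun l _ => star_mul_self_nonneg _)
      rw [Finset.sum_eq_zero_iff_of_nonneg (fun l _ => star_mul_self_nonneg _)] at h2
      exact (CStarRing.star_mul_self_eq_zero_iff _).1 (h2 l (Finset.mem_univ _))
    have hz1 : z = 0 := CStarMatrix.ext fun l i => hz0 l i
    exact hfin hz1
  refine ⟨fun l j => y l j, fun j k => ?_⟩
  rw [← hg, hy, CStarMatrix.mul_apply]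
  exact Finset.sum_congr rfl fun l _ => by rw [CStarMatrix.star_apply]
end rok
end

section

section rok
variable {P A : Type} [CStarAlgebra P] [CStarAlgebra A]

def Qf (ι : P →⋆ₐ[ℂ] A) (E : A →ₗ[ℂ] P) (s e a : A) : A := e * a - s * e * ι (E (e * a))

lemma condexp_right {ι : P →⋆ₐ[ℂ] A} {E : A →ₗ[ℂ] P} (hE : IsCondExpect ι E) (x : A) (p : P) : E (x * ι p) = E x * p := by
  simpa using hE.bimodule 1 p x
lemma condexp_left {ι : P →⋆ₐ[ℂ] A} {E : A →ₗ[ℂ] P} (hE : IsCondExpect ι E) (x : A) (p : P) : E (ι p * x) = p * E x := by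
  simpa using hE.bimodule p 1 x

lemma Qf_mul {ι : P →⋆ₐ[ℂ] A} {E : A →ₗ[ℂ] P} (hE : IsCondExpect ι E) (s e a : A) (p : P) : Qf ι E s e (a * ι p) = Qf ι E s e a * ι p := by
  unfold Qf
  rw [← mul_assoc, condexp_right hE, map_mul]; noncomm_ring


lemma qb_star1 {ι : P →⋆ₐ[ℂ] A} {E : A →ₗ[ℂ] P} (hE : IsCondExpect ι E) {m : ℕ} {u v : Fin m → A}
    (hqb : IsQuasiBasis ι E u v) (a : A) : ∑ k, star (v k) * ι (E (star (u k) * a)) = a := by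
  have := congrArg star (hqb (star a)).2
  rw [star_star, star_sum] at this
  refine Eq.trans (Finset.sum_congr rfl fun k _ => ?_) this.symm
  rw [star_mul, ← map_star, ← (condexp_props hE).2, star_mul, star_star]

lemma qb_star2 {ι : P →⋆ₐ[ℂ] A} {E : A →ₗ[ℂ] P} (hE : IsCondExpect ι E) {m : ℕ} {u v : Fin m → A}
    (hqb : IsQuasiBasis ι E u v) (a : A) : ∑ k, ι (E (a * star (v k))) * star (u k) = a := by
  have := congrArg star (hqb (star a)).1
  rw [star_star, star_sum] at this
  refine Eq.trans (Finset.sum_congr rfl fun k _ => ?_) this.symm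
  rw [star_mul, ← map_star, ← (condexp_props hE).2, star_mul, star_star]

lemma Qf_sum {ι : P →⋆ₐ[ℂ] A} {E : A →ₗ[ℂ] P} (hE : IsCondExpect ι E) {m : ℕ} {u v : Fin m → A}
    (hqb : IsQuasiBasis ι E u v) (s e : A) (hs : s = ∑ i, u i * v i) :
    ∑ k, Qf ι E s e (star (v k)) * star (Qf ι E s e (u k)) = e * star s * star e
      - e * star e * star e * star s - s * e * e * star e + s * e * ι (E (e * star e)) * star e * star s := by
  have h1 : ∀ k, Qf ι E s e (star (v k)) * star (Qf ι E s e (u k)) = 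
      e * (star (v k) * star (u k)) * star e
      - e * (star (v k) * ι (E (star (u k) * star e))) * star e * star s
      - s * e * (ι (E (e * star (v k))) * star (u k)) * star e 
      + s * e * (ι (E (e * star (v k))) * ι (E (star (u k) * star e))) * star e * star s := by
    intro k
    unfold Qf
    rw [star_sub, star_mul, star_mul, star_mul, ← map_star, ← (condexp_props hE).2, star_mul]
    noncomm_ring
  simp only [h1, Finset.sum_add_distrib, Finset.sum_sub_distrib, ← Finset.mul_sum, ← Finset.sum_mul]
  rw [qb_star1 hE hqb, qb_star2 hE hqb]
  have h2 : ∑ k, star (v k) * star (u k) = star s := by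
    rw [hs, star_sum]; simp
  have h3 : ∑ k, ι (E (e * star (v k))) * ι (E (star (u k) * star e)) = ι (E (e * star e)) := by
    simp only [← map_mul, ← condexp_right hE, ← map_sum]
    congr 2
    simp only [mul_assoc, ← Finset.mul_sum]
    rw [qb_star1 hE hqb]
  rw [h2, h3]

lemma Qf_sum' {ι : P →⋆ₐ[ℂ] A} {E : A →ₗ[ℂ] P} (hE : IsCondExpect ι E) {m : ℕ} {u v : Fin m → A}
    (hqb : IsQuasiBasis ι E u v) (s e : A) {y : Fin m → Fin m → P} 
    (hy : ∀ j k, E (v j * star (v k)) = ∑ l, star (y l j) * y l k) :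
    ∑ l, (∑ j, Qf ι E s e (u j) * ι (star (y l j))) * star (∑ j, Qf ι E s e (u j) * ι (star (y l j))) 
     = ∑ k, Qf ι E s e (star (v k)) * star (Qf ι E s e (u k)) := by
  have h1 : ∀ k, Qf ι E s e (star (v k)) = ∑ j, Qf ι E s e (u j) * ι (∑ l, star (y l j) * y l k) := by
    intro k
    conv_lhs => rw [(hqb (star (v k))).1]
    have : ∀ w : Fin m → A, Qf ι E s e (∑ j, w j) = ∑ j, Qf ι E s e (w j) := by
      intro w
      simp only [Qf, Finset.mul_sum, map_sum, Finset.sum_sub_distrib]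
    rw [this]
    refine Finset.sum_congr rfl fun j _ => ?_
    rw [Qf_mul hE, hy]
  simp only [h1, star_sum, star_mul, map_sum, map_mul, Finset.sum_mul, Finset.mul_sum, map_star, star_star]
  rw [Finset.sum_comm]
  refine Finset.sum_congr rfl fun k _ => ?_
  rw [Finset.sum_comm]
  refine Finset.sum_congr rfl fun j _ => Finset.sum_congr rfl fun l _ => ?_
  noncomm_ring

lemma Qf_expand {ι : P →⋆ₐ[ℂ] A} {E : A →ₗ[ℂ] P} (hE : IsCondExpect ι E) {m : ℕ} {u v : Fin m → A}
    (hqb : IsQuasiBasis ι E u v) (s e a : A) {y : Fin m → Fin m → P} 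
    (hy : ∀ j k, E (v j * star (v k)) = ∑ l, star (y l j) * y l k) :
    Qf ι E s e a = ∑ l, (∑ j, Qf ι E s e (u j) * ι (star (y l j))) * ι (∑ k, y l k * E (star (u k) * a)) := by
  have this : ∀ w : Fin m → A, Qf ι E s e (∑ j, w j) = ∑ j, Qf ι E s e (w j) := by
    intro w
    simp only [Qf, Finset.mul_sum, map_sum, Finset.sum_sub_distrib]
  conv_lhs => rw [(hqb a).1]
  rw [this]
  have h2 : ∀ j, E (v j * a) = ∑ k, (∑ l, star (y l j) * y l k) * E (star (u k) * a) := by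
    intro j
    conv_lhs => rw [← qb_star1 hE hqb a]
    rw [Finset.mul_sum, map_sum]
    refine Finset.sum_congr rfl fun k _ => ?_
    rw [← mul_assoc, condexp_right hE, hy]
  simp only [Qf_mul hE]
  simp only [h2, map_sum, map_mul, Finset.sum_mul, Finset.mul_sum]
  rw [Finset.sum_comm]
  conv_rhs => rw [Finset.sum_comm]
  refine Finset.sum_congr rfl fun k _ => ?_
  conv_rhs => rw [Finset.sum_comm]
  refine Finset.sum_congr rfl fun j _ => Finset.sum_congr rfl fun l _ => ?_
  noncomm_ring

theorem rowND_of_rokhlin {n : ℕ} (ι : P →⋆ₐ[ℂ] A) (hι : Function.Injective ι)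
    (E : A →ₗ[ℂ] P) (hE : IsCondExpect ι E)
    (m : ℕ) (u v : Fin m → A) (hqb : IsQuasiBasis ι E u v)
    (hRok : CondExpectHasRokhlin ι E (∑ i, u i * v i)) (hA : RowND n A) : RowND n P := by
  letI := CStarAlgebra.spectralOrder A
  letI := CStarAlgebra.spectralOrderedRing A
  obtain ⟨e, heb, hee, hes, hec, ⟨w, hw1, hw2, hew⟩, -⟩ := hRok
  set s := ∑ i, u i * v i with hs
  obtain ⟨⟨C, hC0, hC⟩, hEs⟩ := condexp_props hE
  obtain ⟨y, hy⟩ := condexp_cp hE v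
  have hin : ∀ p, ‖ι p‖ = ‖p‖ := fun p => NonUnitalStarAlgHom.norm_map ι hι p
  replace hee : Eqv (e * e) e := tendsto_zero_iff_norm_tendsto_zero.2 hee
  replace hes : Eqv (star e) e := tendsto_zero_iff_norm_tendsto_zero.2 hes
  replace hec : ∀ a, Eqv (e * fun _ => a) ((fun _ => a) * e) := fun a => tendsto_zero_iff_norm_tendsto_zero.2 (hec a)
  let EE : (ℕ → A) → (ℕ → A) := fun f k => ι (E (f k))
  replace hew : Eqv (EE e) (fun _ => w) := tendsto_zero_iff_norm_tendsto_zero.2 hew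
  have heb' : Bdd e := heb
  have hEE : ∀ {f g}, Eqv f g → Eqv (EE f) (EE g) := by
    intro f g h
    refine squeeze_zero_norm (a := fun k => C * ‖f k - g k‖) (fun k => ?_) (by simpa using (Tendsto.norm h).const_mul C)
    change ‖ι (E (f k)) - ι (E (g k))‖ ≤ _
    rw [← map_sub, ← map_sub, hin]; exact hC _
  have hEB : ∀ {f}, Bdd f → Bdd (EE f) := by
    rintro f ⟨M, hM⟩
    exact ⟨C * M, fun k => by change ‖ι (E (f k))‖ ≤ _; rw [hin]; exact (hC _).trans (by gcongr; exact hM k)⟩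
  -- `s` central
  have hsc : ∀ a, a * s = s * a := by
    intro a
    have h1 : a * s = ∑ i, ∑ j, u j * ι (E (v j * a * u i)) * v i := by
      rw [hs, Finset.mul_sum]
      refine Finset.sum_congr rfl fun i _ => ?_
      rw [← mul_assoc]
      conv_lhs => rw [(hqb (a * u i)).1]
      rw [Finset.sum_mul]
      simp only [mul_assoc]
    rw [h1, Finset.sum_comm, hs, Finset.sum_mul]
    refine Finset.sum_congr rfl fun j _ => ?_
    rw [mul_assoc]
    conv_rhs => rw [(hqb (v j * a)).2]
    rw [Finset.mul_sum]
    simp only [mul_assoc]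
  have hwc : ∀ a, a * w = w * a := by
    intro a
    calc a * w = w * s * (a * w) := by rw [hw1, one_mul]
      _ = w * (s * a) * w := by noncomm_ring
      _ = w * (a * s) * w := by rw [hsc]
      _ = w * a * (s * w) := by noncomm_ring
      _ = w * a := by rw [hw2, mul_one]
  have hws : star w = w := by
    have h1 : Eqv (star (EE e)) (EE e) := by
      have : star (EE e) = EE (star e) := by
        funext k
        change star (ι (E (e k))) = ι (E (star (e k)))
        rw [hEs, map_star]
      rw [this]; exact hEE hes
    have h2 : Eqv (fun _ : ℕ => star w) (fun _ : ℕ => w) := 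
      (hew.star.symm.trans h1).trans hew
    have h3 : Tendsto (fun _ : ℕ => star w - w) atTop (𝓝 0) := h2
    exact sub_eq_zero.1 (tendsto_nhds_unique tendsto_const_nhds h3)
  have hss : star s = s := by
    have h1 : star s * w = 1 := by
      have := congrArg star hw1
      rwa [star_mul, star_one, hws] at this
    calc star s = star s * (w * s) := by rw [hw1, mul_one]
      _ = s := by rw [← mul_assoc, h1, one_mul]
  have hw' : ι (E w) = w := by
    have h1 : Eqv (EE (EE e)) (fun _ => ι (E w)) := hEE hew
    have h2 : EE (EE e) = EE e := by
      funext k; change ι (E (ι (E (e k)))) = ι (E (e k)); rw [hE.restricts]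
    rw [h2] at h1
    have h3 : Tendsto (fun _ : ℕ => ι (E w) - w) atTop (𝓝 0) := h1.symm.trans hew
    exact sub_eq_zero.1 (tendsto_nhds_unique tendsto_const_nhds h3)
  have hs' : ι (E s) = s := by
    have h1 : E s * E w = 1 := by
      rw [← condexp_right hE, hw', hw2]
      simpa using hE.restricts 1
    have h2 : ι (E s) * w = 1 := by
      rw [← hw', ← map_mul, h1, map_one]
    calc ι (E s) = ι (E s) * (w * s) := by rw [hw1, mul_one]
      _ = s := by rw [← mul_assoc, h2, one_mul]
  let cs : ℕ → A := fun _ => s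
  let cw : ℕ → A := fun _ => w
  have hcs : ∀ f : ℕ → A, f * cs = cs * f := fun f => funext fun k => hsc (f k)
  have hcw : ∀ f : ℕ → A, f * cw = cw * f := fun f => funext fun k => hwc (f k)
  have hcsw : cs * cw = 1 := funext fun k => hw2
  have bcs : Bdd cs := Bdd.const s
  have bcw : Bdd cw := Bdd.const w
  have hcss : star cs = cs := funext fun k => hss
  have heS : Eqv (e * star e) e := (Eqv.mul_left heb' hes).trans hee
  have hQ : ∀ l, Tendsto (fun k => ∑ j, Qf ι E s (e k) (u j) * ι (star (y l j))) atTop (𝓝 0) := by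
    have h1 : Eqv (e * cs * star e - e * star e * star e * cs - cs * e * e * star e 
        + cs * e * EE (e * star e) * star e * cs) (cs * e - cs * e - cs * e + cs * e) := by
      refine Eqv.add (Eqv.sub (Eqv.sub ?_ ?_) ?_) ?_
      · rw [hcs, mul_assoc]; exact Eqv.mul_left bcs heS
      · rw [hcs]; exact Eqv.mul_left bcs ((Eqv.mul_right heb'.star heS).trans heS)
      · rw [mul_assoc, mul_assoc]
        refine Eqv.mul_left bcs ?_
        exact (Eqv.mul_left heb' heS).trans hee
      · rw [hcs]
        refine Eqv.mul_left bcs ?_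
        have h2 : Eqv (EE (e * star e)) cw := (hEE heS).trans hew
        refine (Eqv.mul_right heb'.star (Eqv.mul_left (bcs.mul heb') h2)).trans ?_
        have : cs * e * cw * star e = e * star e := by
          rw [mul_assoc cs, hcw, ← mul_assoc, hcsw, one_mul]
        rw [this]; exact heS
    have h2 : Tendsto (fun k => ∑ l, (∑ j, Qf ι E s (e k) (u j) * ι (star (y l j))) * 
        star (∑ j, Qf ι E s (e k) (u j) * ι (star (y l j)))) atTop (𝓝 0) := by
      refine Tendsto.congr (fun k => ?_) h1
      rw [Qf_sum' hE hqb s (e k) hy, Qf_sum hE hqb s (e k) hs]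
      simp only [Pi.add_apply, Pi.sub_apply, Pi.mul_apply, Pi.star_apply, cs, hss, EE]
      noncomm_ring
    intro l
    rw [tendsto_zero_iff_norm_tendsto_zero]
    have h3 := (tendsto_zero_iff_norm_tendsto_zero.1 h2).sqrt
    rw [Real.sqrt_zero] at h3
    refine squeeze_zero (fun _ => norm_nonneg _) (fun k => ?_) h3
    apply Real.le_sqrt_of_sq_le
    rw [sq, ← CStarRing.norm_self_mul_star]
    refine CStarAlgebra.norm_le_norm_of_nonneg_of_le (mul_star_self_nonneg _) ?_
    exact Finset.single_le_sum (f := fun l => (∑ j, Qf ι E s (e k) (u j) * ι (star (y l j))) * 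
        star (∑ j, Qf ι E s (e k) (u j) * ι (star (y l j)))) (fun _ _ => mul_star_self_nonneg _) (Finset.mem_univ l)
  let b : A → ℕ → A := fun a => cs * EE (e * fun _ => a)
  have hbb : ∀ a, Bdd (b a) := fun a => bcs.mul (hEB (heb'.mul (Bdd.const a)))
  have hQ2 : ∀ a, Eqv (e * fun _ => a) (e * b a) := by
    intro a
    have h1 : Tendsto (fun k => Qf ι E s (e k) a) atTop (𝓝 0) := by
      simp only [fun k => Qf_expand hE hqb s (e k) a hy]
      rw [show (0 : A) = ∑ l : Fin m, 0 * ι (∑ k, y l k * E (star (u k) * a)) by simp]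
      exact tendsto_finsetSum _ fun l _ => (hQ l).mul_const _
    refine Tendsto.congr (fun k => ?_) h1
    simp only [Qf, Pi.mul_apply, b, cs, EE]
    rw [← mul_assoc (e k) s, hsc]
  have hback : ∀ f : ℕ → P, Bdd f → Eqv (cs * EE (e * fun k => ι (f k))) (fun k => ι (f k)) := by
    intro f hf
    have h1 : EE (e * fun k => ι (f k)) = EE e * fun k => ι (f k) := by
      funext k
      simp only [EE, Pi.mul_apply]
      rw [condexp_right hE, map_mul]
    have hb : Bdd (fun k => ι (f k)) := by
      obtain ⟨M, hM⟩ := hf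
      exact ⟨M, fun k => by rw [hin]; exact hM k⟩
    rw [h1]
    refine (Eqv.mul_left bcs (Eqv.mul_right hb hew)).trans ?_
    rw [← mul_assoc, show cs * (fun _ => w) = 1 from hcsw, one_mul]
    exact Eqv.refl _
  let β : ℕ → A →ₗ[ℂ] P := fun k => 
    { toFun := fun a => E s * E (e k * a)
      map_add' := fun x y => by rw [mul_add, map_add, mul_add]
      map_smul' := fun c x => by simp }
  have hβ : ∀ a k, ι (β k a) = b a k := by
    intro a k
    change ι (E s * E (e k * a)) = s * ι (E (e k * a))
    rw [map_mul, hs']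
  have hβb : ∀ a, Bdd (fun k => β k a) := by
    intro a
    obtain ⟨M, hM⟩ := hbb a
    exact ⟨M, fun k => by rw [← hin, hβ]; exact hM k⟩
  have tr : ∀ f : ℕ → P, Tendsto (fun k => ι (f k)) atTop (𝓝 0) → Tendsto f atTop (𝓝 0) := by
    intro f hf
    rw [tendsto_zero_iff_norm_tendsto_zero] at hf ⊢
    simpa only [hin] using hf
  have bE : ∀ {f g}, Eqv f g → Eqv (cs * EE f) (cs * EE g) := fun h => Eqv.mul_left bcs (hEE h)
  obtain ⟨M, hM0, hM⟩ := heb'.nn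
  refine rowND_of_asymp hA ι β (C := ‖E s‖ * (C * M)) (fun k a => ?_) (fun x z => ?_) (fun x => ?_) (fun p => ?_)
  · change ‖E s * E (e k * a)‖ ≤ _
    refine (norm_mul_le _ _).trans ?_
    rw [mul_assoc]
    gcongr
    refine (hC _).trans ?_
    rw [mul_assoc]
    gcongr
    exact (norm_mul_le _ _).trans (by gcongr; exact hM k)
  · apply tr
    have h1 : Eqv (b (x * z)) (b x * b z) := by
      have hbxz : b x * b z = fun k => ι (β k x * β k z) := by
        funext k; rw [map_mul, hβ, hβ]; rfl
      have h2 : Eqv (e * (b x * b z)) (e * fun _ => x * z) := by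
        rw [← mul_assoc]
        refine (Eqv.mul_right (hbb z) (hQ2 x).symm).trans ?_
        refine (Eqv.mul_right (hbb z) (hec x)).trans ?_
        rw [mul_assoc]
        refine (Eqv.mul_left (Bdd.const x) (hQ2 z).symm).trans ?_
        rw [← mul_assoc]
        refine (Eqv.mul_right (Bdd.const z) (hec x).symm).trans ?_
        rw [mul_assoc]
        exact Eqv.refl _
      have h3 : Eqv (cs * EE (e * (b x * b z))) (b x * b z) := by
        rw [hbxz]
        exact hback _ ((hβb x).mul (hβb z))
      exact (bE h2.symm).trans h3
    refine Tendsto.congr (fun k => ?_) h1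
    rw [map_sub, map_mul ι, hβ, hβ, hβ]; rfl
  · apply tr
    have h1 : Eqv (b (star x)) (star (b x)) := by
      have h2 : star (b x) = cs * EE ((fun _ => star x) * star e) := by
        funext k
        change star (s * ι (E (e k * x))) = s * ι (E (star x * star (e k)))
        rw [star_mul, hss, hsc, ← map_star, ← hEs, star_mul]
      rw [h2]
      exact bE ((hec (star x)).trans (Eqv.mul_left (Bdd.const _) hes.symm))
    refine Tendsto.congr (fun k => ?_) h1
    rw [map_sub, map_star ι, hβ, hβ]; rfl
  · apply tr
    refine Tendsto.congr (fun k => ?_) (hback (fun _ => p) (Bdd.const p))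
    rw [map_sub, hβ]
end rok
end

section

section cs
variable {A N K : Type} [CStarAlgebra A] [Fintype N] [DecidableEq N]

lemma cauchy_schwarz (x y : N → A) : ‖∑ q, star (x q) * y q‖ ^ 2 ≤
    ‖∑ q, star (x q) * x q‖ * ‖∑ q, star (y q) * y q‖ := by
  letI := CStarAlgebra.spectralOrder A
  letI := CStarAlgebra.spectralOrderedRing A
  have h1 : ∀ x y : N → A, rowM (fun q => star (x q)) * star (rowM (fun q => star (y q))) =
      diagM (fun i => i.elim (∑ q, star (x q) * y q) (fun _ => 0)) := by
    intro x y
    refine CStarMatrix.ext fun i j => ?_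
    rw [diagM_apply]
    cases i <;> cases j <;> simp [CStarMatrix.mul_apply, CStarMatrix.star_apply, Fintype.sum_option]
  have h2 : ∀ x : N → A, ‖rowM (fun q => star (x q))‖ ^ 2 ≤ ‖∑ q, star (x q) * x q‖ := by
    intro x
    rw [sq, ← CStarRing.norm_self_mul_star, h1]
    refine (NonUnitalStarAlgHom.norm_apply_le _ _).trans ?_
    rw [pi_norm_le_iff_of_nonneg (norm_nonneg _)]
    rintro (_ | i) <;> simp
  have h3 : ‖∑ q, star (x q) * y q‖ ≤ ‖rowM (fun q => star (x q))‖ * ‖rowM (fun q => star (y q))‖ := by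
    have : ∑ q, star (x q) * y q = (rowM (fun q => star (x q)) * star (rowM (fun q => star (y q)))) none none := by
      rw [h1, diagM_apply]; simp
    rw [this]
    refine CStarMatrix.norm_entry_le_norm.trans ((norm_mul_le _ _).trans ?_)
    rw [norm_star]
  calc _ ≤ (‖rowM (fun q => star (x q))‖ * ‖rowM (fun q => star (y q))‖) ^ 2 := by gcongr
    _ = ‖rowM (fun q => star (x q))‖ ^ 2 * ‖rowM (fun q => star (y q))‖ ^ 2 := by ring
    _ ≤ _ := by gcongr <;> exact h2 _
end cs

section cpm
variable {A N K : Type} [CStarAlgebra A] [Fintype N] [DecidableEq N]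

lemma CPm.gen {ψ : A →ₗ[ℂ] Matrix N N ℂ} (h : CPm ψ) {T : Type} [Fintype T] (a : T → A) : 
    Matrix.PosSemidef (Matrix.of fun (p q : T × N) => ψ (star (a p.1) * a q.1) p.2 q.2) := by
  have := (h _ (fun i => a ((Fintype.equivFin T).symm i))).submatrix 
    (fun p : T × N => (Fintype.equivFin T p.1, p.2))
  convert this using 1
  ext p q; simp

lemma CPm.factor {ψ : A →ₗ[ℂ] Matrix N N ℂ} (h : CPm ψ) {T : Type} [Fintype T] [DecidableEq T] (a : T → A) : 
    ∃ B : T → Matrix (T × N) N ℂ, ∀ p q, ψ (star (a p) * a q) = (B p).conjTranspose * B q := by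
  obtain ⟨y, hy⟩ := psd_ex (h.gen a)
  refine ⟨fun p => Matrix.of fun c e => y c (p, e), fun p q => ?_⟩
  ext e f
  have := congrFun (congrFun hy (p, e)) (q, f)
  simp only [Matrix.of_apply, Matrix.mul_apply, Matrix.star_apply] at this
  rw [this]
  simp [Matrix.mul_apply]

lemma CPm.conj {ψ : A →ₗ[ℂ] Matrix N N ℂ} (h : CPm ψ) {N' : Type} [Fintype N'] (V : Matrix N N' ℂ)
    {ψ' : A →ₗ[ℂ] Matrix N' N' ℂ} (h' : ∀ b, ψ' b = V.conjTranspose * ψ b * V) : CPm ψ' := by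
  intro k a
  obtain ⟨B, hB⟩ := h.factor a
  have := Matrix.posSemidef_conjTranspose_mul_self 
    (Matrix.of fun (c : Fin k × N) (p : Fin k × N') => (B p.1 * V) c p.2)
  convert this using 1
  ext p q
  simp only [Matrix.of_apply, h', hB]
  rw [show V.conjTranspose * ((B p.1).conjTranspose * B q.1) * V = (B p.1 * V).conjTranspose * (B q.1 * V) by
    rw [Matrix.conjTranspose_mul]; simp only [Matrix.mul_assoc]]
  rw [Matrix.mul_apply, Matrix.mul_apply]; rfl

lemma CPm.add {ψ ψ' : A →ₗ[ℂ] Matrix N N ℂ} (h : CPm ψ) (h' : CPm ψ') : CPm (ψ + ψ') := by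
  intro k a
  convert (h k a).add (h' k a) using 1
  ext p q; simp

lemma CPm.comp {ψ : A →ₗ[ℂ] Matrix N N ℂ} (h : CPm ψ) {B : Type} [CStarAlgebra B] (f : B →⋆ₙₐ[ℂ] A)
    {ψ' : B →ₗ[ℂ] Matrix N N ℂ} (h' : ∀ b, ψ' b = ψ (f b)) : CPm ψ' := by
  intro k a
  convert h k (fun i => f (a i)) using 1
  ext p q; simp [h', map_star, map_mul]

open scoped MatrixOrder in
lemma CPm.mono {ψ : A →ₗ[ℂ] Matrix N N ℂ} (h : CPm ψ) (b : A) : 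
    ‖ψ (star b * b)‖ ≤ ‖b‖ ^ 2 * ‖ψ 1‖ := by
  letI := CStarAlgebra.spectralOrder A
  letI := CStarAlgebra.spectralOrderedRing A
  have hp : ∀ z, 0 ≤ ψ (star z * z) := by
    intro z
    obtain ⟨B, hB⟩ := h.factor (T := Unit) (fun _ => z)
    rw [hB () (), Matrix.nonneg_iff_posSemidef]
    exact Matrix.posSemidef_conjTranspose_mul_self _
  have h1 : star b * b ≤ algebraMap ℝ A (‖b‖ ^ 2) := by
    have := IsSelfAdjoint.le_algebraMap_norm_self (IsSelfAdjoint.star_mul_self b)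
    rwa [CStarRing.norm_star_mul_self, ← sq] at this
  obtain ⟨z, hz⟩ := nonneg_ex (sub_nonneg.2 h1)
  have h2 : ψ (star b * b) ≤ ψ (algebraMap ℝ A (‖b‖ ^ 2)) := by
    rw [← sub_nonneg, ← map_sub, hz]; exact hp z
  refine (CStarAlgebra.norm_le_norm_of_nonneg_of_le (hp b) h2).trans ?_
  rw [Algebra.algebraMap_eq_smul_one, show ((‖b‖ ^ 2 : ℝ) • (1 : A)) = ((‖b‖ ^ 2 : ℝ) : ℂ) • (1 : A) by
    exact (RCLike.real_smul_eq_coe_smul (K := ℂ) _ _), map_smul, norm_smul]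
  simp

lemma CPm.contr {ψ : A →ₗ[ℂ] Matrix N N ℂ} (h : CPm ψ) (h1 : ‖ψ 1‖ ≤ 1) (b : A) : ‖ψ b‖ ≤ ‖b‖ := by
  obtain ⟨B, hB⟩ := h.factor (T := Fin 2) ![1, b]
  have e : ψ b = (B 0).conjTranspose * B 1 := by simpa using hB 0 1
  have e0 : ψ 1 = (B 0).conjTranspose * B 0 := by simpa using hB 0 0
  have e1 : ψ (star b * b) = (B 1).conjTranspose * B 1 := by simpa using hB 1 1
  have i0 : ‖B 0‖ * ‖B 0‖ ≤ 1 := by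
    rw [← Matrix.l2_opNorm_conjTranspose_mul_self, ← e0]; exact h1
  have i1 : ‖B 1‖ * ‖B 1‖ ≤ ‖b‖ * ‖b‖ := by
    rw [← Matrix.l2_opNorm_conjTranspose_mul_self, ← e1]
    refine (h.mono b).trans ?_
    nlinarith [norm_nonneg b]
  rw [e]
  refine (Matrix.l2_opNorm_mul _ _).trans ?_
  rw [Matrix.l2_opNorm_conjTranspose]
  have j0 : ‖B 0‖ ≤ 1 := by nlinarith [norm_nonneg (B 0)]
  have j1 : ‖B 1‖ ≤ ‖b‖ := by nlinarith [norm_nonneg (B 1), norm_nonneg b]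
  nlinarith [norm_nonneg (B 1), norm_nonneg (B 0)]
end cpm

section sat
variable {n : ℕ}

lemma phi_map {A B N : Type} [CStarAlgebra A] [CStarAlgebra B] [Fintype N] [DecidableEq N]
    (f : A →⋆ₙₐ[ℂ] B) (v : N → A) (x : Matrix N N ℂ) : f (phi v x) = phi (fun a => f (v a)) x := by
  simp [phi_apply, map_sum, map_star]

lemma IsRow.map {A B N K : Type} [CStarAlgebra A] [CStarAlgebra B] {blk : N → K} {J : K → Fin (n + 1)}
    {v : N → A} (h : IsRow blk J v) (f : A →⋆ₙₐ[ℂ] B) : IsRow blk J (fun a => f (v a)) where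
  diag a b hab := by rw [← map_star, ← map_mul, h.diag a b hab, map_mul, map_star]
  off a b hab hJ := by rw [← map_star, ← map_mul, h.off a b hab hJ, map_zero]
  nrm a := (NonUnitalStarAlgHom.norm_apply_le f _).trans (h.nrm a)

lemma starEquiv_norm {A B : Type} [CStarAlgebra A] [CStarAlgebra B] (e : A ≃⋆ₐ[ℂ] B) (x : A) : ‖e x‖ = ‖x‖ :=
  NonUnitalStarAlgHom.norm_map (e : A →⋆ₐ[ℂ] B) e.injective x

lemma rowND_iso {A B : Type} [CStarAlgebra A] [CStarAlgebra B] (e : A ≃⋆ₐ[ℂ] B) (h : RowND n B) : RowND n A := by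
  classical
  intro S ε hε
  obtain ⟨N, K, _, _, _, _, blk, J, v, ψ, hv, hbd, hcp, hn, hS⟩ := h (S.image e) ε hε
  let f : A →⋆ₙₐ[ℂ] B := ((e : A →⋆ₐ[ℂ] B) : A →⋆ₙₐ[ℂ] B)
  let g : B →⋆ₙₐ[ℂ] A := ((e.symm : B →⋆ₐ[ℂ] A) : B →⋆ₙₐ[ℂ] A)
  refine ⟨N, K, inferInstance, inferInstance, inferInstance, inferInstance, blk, J, fun a => g (v a),
    { toFun := fun b => ψ (e b), map_add' := by simp, map_smul' := by simp }, hv.map g, fun b => hbd _,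
    hcp.comp f fun b => rfl, fun b => (hn _).trans (starEquiv_norm e b).le, fun b hb => ?_⟩
  have := hS _ (Finset.mem_image_of_mem e hb)
  rw [← phi_map]
  have h2 : g (phi v (ψ (e b))) - b = e.symm (phi v (ψ (e b)) - e b) := by
    rw [map_sub]; simp [g]
  simp only [LinearMap.coe_mk, AddHom.coe_mk]
  rw [h2, starEquiv_norm]; exact this

lemma norm_le_of_conj {N₁ N₂ : Type} [Fintype N₁] [DecidableEq N₁] [Fintype N₂] [DecidableEq N₂]
    (x : Matrix N₁ N₁ ℂ) (y : Matrix N₂ N₂ ℂ) {c : ℝ} (hx : ‖x‖ ≤ c) (hy : ‖y‖ ≤ c) :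
    ‖Matrix.fromBlocks x 0 0 y‖ ≤ c := by
  let f : Matrix N₁ N₁ ℂ × Matrix N₂ N₂ ℂ →⋆ₙₐ[ℂ] Matrix (N₁ ⊕ N₂) (N₁ ⊕ N₂) ℂ :=
    { toFun := fun z => Matrix.fromBlocks z.1 0 0 z.2
      map_smul' := fun c z => by simp [Matrix.fromBlocks_smul]
      map_zero' := by simp
      map_add' := fun z w => by simp [Matrix.fromBlocks_add]
      map_mul' := fun z w => by simp [Matrix.fromBlocks_multiply]
      map_star' := fun z => by simp [Matrix.star_eq_conjTranspose, Matrix.fromBlocks_conjTranspose] }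
  exact (NonUnitalStarAlgHom.norm_apply_le f (x, y)).trans (max_le hx hy)

lemma phi_prod {A₁ A₂ N N' : Type} [CStarAlgebra A₁] [CStarAlgebra A₂] [Fintype N] [DecidableEq N]
    [Fintype N'] [DecidableEq N'] (v : N → A₁) (v' : N' → A₂) (x : Matrix N N ℂ) (y : Matrix N' N' ℂ) :
    phi (Sum.elim (fun a => (v a, 0)) (fun a => (0, v' a))) (Matrix.fromBlocks x 0 0 y) = 
      (phi v x, phi v' y) := by
  rw [phi_apply]
  simp only [Fintype.sum_sum_type, Sum.elim_inl, Sum.elim_inr, Matrix.fromBlocks_apply₁₁,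
    Matrix.fromBlocks_apply₁₂, Matrix.fromBlocks_apply₂₁, Matrix.fromBlocks_apply₂₂, Matrix.zero_apply,
    zero_smul, Finset.sum_const_zero, add_zero, zero_add]
  refine Prod.ext ?_ ?_
  · simp only [Prod.fst_add, Prod.fst_sum, Prod.smul_fst, Prod.fst_mul, Prod.fst_star, zero_mul,
      smul_zero, Finset.sum_const_zero, add_zero]
    rfl
  · simp only [Prod.snd_add, Prod.snd_sum, Prod.smul_snd, Prod.snd_mul, Prod.snd_star, zero_mul,
      smul_zero, Finset.sum_const_zero, zero_add]
    rfl

lemma rowND_sum {A A₁ A₂ : Type} [CStarAlgebra A] [CStarAlgebra A₁] [CStarAlgebra A₂]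
    (e : A ≃⋆ₐ[ℂ] (A₁ × A₂)) (h1 : RowND n A₁) (h2 : RowND n A₂) : RowND n A := by
  refine rowND_iso e ?_
  clear e
  classical
  intro S ε hε
  obtain ⟨N, K, _, _, _, _, blk, J, v, ψ, hv, hbd, hcp, hn, hS⟩ := h1 (S.image Prod.fst) ε hε
  obtain ⟨N', K', _, _, _, _, blk', J', v', ψ', hv', hbd', hcp', hn', hS'⟩ := h2 (S.image Prod.snd) ε hε
  let Ψ : A₁ × A₂ →ₗ[ℂ] Matrix (N ⊕ N') (N ⊕ N') ℂ :=
    { toFun := fun b => Matrix.fromBlocks (ψ b.1) 0 0 (ψ' b.2)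
      map_add' := fun x y => by simp [Matrix.fromBlocks_add]
      map_smul' := fun c x => by simp [Matrix.fromBlocks_smul] }
  have hΨ : ∀ b, Ψ b = Matrix.fromBlocks (ψ b.1) 0 0 (ψ' b.2) := fun b => rfl
  refine ⟨N ⊕ N', K ⊕ K', inferInstance, inferInstance, inferInstance, inferInstance, Sum.map blk blk',
    Sum.elim J J', Sum.elim (fun a => (v a, 0)) (fun a => (0, v' a)), Ψ, ⟨?_, ?_, ?_⟩, ?_, ?_, ?_, ?_⟩
  · rintro (a | a) (b | b) hab
    · have := hv.diag a b (by simpa using hab)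
      ext <;> simp [this]
    · simp at hab
    · simp at hab
    · have := hv'.diag a b (by simpa using hab)
      ext <;> simp [this]
  · rintro (a | a) (b | b) hab hJ
    · have := hv.off a b (by simpa using hab) (by simpa using hJ)
      ext <;> simp [this]
    · ext <;> simp
    · ext <;> simp
    · have := hv'.off a b (by simpa using hab) (by simpa using hJ)
      ext <;> simp [this]
  · rintro (a | a)
    · simpa [Prod.norm_def] using hv.nrm a
    · simpa [Prod.norm_def] using hv'.nrm a
  · rintro b (x | x) (y | y) hxy
    · rw [hΨ]; simpa using hbd b.1 x y (by simpa using hxy)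
    · simp [hΨ]
    · simp [hΨ]
    · rw [hΨ]; simpa using hbd' b.2 x y (by simpa using hxy)
  · intro k a
    obtain ⟨B, hB⟩ := hcp.factor (fun i => (a i).1)
    obtain ⟨B', hB'⟩ := hcp'.factor (fun i => (a i).2)
    have := Matrix.posSemidef_conjTranspose_mul_self 
      (Matrix.of fun (c : (Fin k × N) ⊕ (Fin k × N')) (p : Fin k × (N ⊕ N')) => 
        Matrix.fromBlocks (B p.1) 0 0 (B' p.1) c p.2)
    convert this using 1
    ext p q
    rw [Matrix.mul_apply, Fintype.sum_sum_type]
    have e1 := hB p.1 q.1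
    have e2 := hB' p.1 q.1
    rcases p with ⟨p, x | x⟩ <;> rcases q with ⟨q, y | y⟩
    · simp [hΨ, e1, Matrix.mul_apply]
    · simp [hΨ]
    · simp [hΨ]
    · simp [hΨ, e2, Matrix.mul_apply]
  · intro b
    rw [hΨ]
    exact norm_le_of_conj _ _ ((hn _).trans (le_max_left _ _)) ((hn' _).trans (le_max_right _ _))
  · intro b hb
    have i1 := hS _ (Finset.mem_image_of_mem Prod.fst hb)
    have i2 := hS' _ (Finset.mem_image_of_mem Prod.snd hb)
    have : phi (Sum.elim (fun a => (v a, 0)) (fun a => (0, v' a))) (Ψ b) = (phi v (ψ b.1), phi v' (ψ' b.2)) := by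
      rw [hΨ]; exact phi_prod v v' _ _
    rw [this]
    exact max_lt i1 i2

lemma rowND_matrix {A B : Type} [CStarAlgebra A] [CStarAlgebra B] (k : ℕ)
    (e : B ≃⋆ₐ[ℂ] Matrix (Fin (k + 1)) (Fin (k + 1)) A) (h : RowND n A) : RowND n B := by
  classical
  intro S ε hε
  let ε' := ε / ((k + 1) * (k + 1) + 1)
  have hε' : 0 < ε' := by positivity
  obtain ⟨N, K, _, _, _, _, blk, J, v, ψ, hv, hbd, hcp, hn, hS⟩ := 
    h (S.biUnion fun b => Finset.univ.biUnion fun l => Finset.univ.image fun l' => e b l l') ε' hε'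
  let I := Fin (k + 1)
  let dg : I → A →⋆ₙₐ[ℂ] B := fun l =>
    { toFun := fun x => e.symm (Matrix.single l l x)
      map_smul' := fun c x => by rw [← Matrix.smul_single, map_smul]; rfl
      map_zero' := by simp
      map_add' := fun x y => by rw [Matrix.single_add, map_add]
      map_mul' := fun x y => by rw [← map_mul, Matrix.single_mul_single_same]
      map_star' := fun x => by
        rw [← map_star, Matrix.star_eq_conjTranspose, Matrix.conjTranspose_single] }
  have hss : ∀ (i j i' : I) (x y : A), star (e.symm (Matrix.single i j x)) * e.symm (Matrix.single i i' y) =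
      e.symm (Matrix.single j i' (star x * y)) := by
    intro i j i' x y
    rw [← map_star, Matrix.star_eq_conjTranspose, Matrix.conjTranspose_single, ← map_mul, Matrix.single_mul_single_same]
  have hsn : ∀ (i j : I) (x : A), ‖e.symm (Matrix.single i j x)‖ ≤ ‖x‖ := by
    intro i j x
    have h1 : ‖star (e.symm (Matrix.single i j x)) * e.symm (Matrix.single i j x)‖ ≤ ‖x‖ * ‖x‖ := by
      rw [hss, ← CStarRing.norm_star_mul_self]
      exact NonUnitalStarAlgHom.norm_apply_le (dg j) _
    rw [CStarRing.norm_star_mul_self] at h1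
    nlinarith [norm_nonneg x, norm_nonneg (e.symm (Matrix.single i j x))]
  let Ψ : B →ₗ[ℂ] Matrix (I × N) (I × N) ℂ :=
    { toFun := fun b => Matrix.of fun p q => ψ (e b p.1 q.1) p.2 q.2
      map_add' := fun x y => by ext p q; simp
      map_smul' := fun c x => by ext p q; simp }
  have hΨ : ∀ b p q, Ψ b p q = ψ (e b p.1 q.1) p.2 q.2 := fun b p q => rfl
  have hcpΨ : CPm Ψ := by
    intro r a
    have := Matrix.posSemidef_sum (Finset.univ : Finset I) (fun m _ => 
      (hcp.gen (fun t : Fin r × I => e (a t.1) m t.2)).submatrix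
        (fun p : Fin r × (I × N) => ((p.1, p.2.1), p.2.2)))
    convert this using 1
    ext p q
    simp only [Matrix.of_apply, hΨ, Matrix.sum_apply, Matrix.submatrix_apply]
    rw [map_mul, map_star, Matrix.mul_apply, map_sum, Matrix.sum_apply]
    refine Finset.sum_congr rfl fun c _ => ?_
    rfl
  have h1Ψ : ‖Ψ 1‖ ≤ 1 := by
    let f : Matrix N N ℂ →⋆ₙₐ[ℂ] Matrix (I × N) (I × N) ℂ :=
    { toFun := fun z => Matrix.kronecker (1 : Matrix I I ℂ) z
      map_smul' := fun c z => by simp [Matrix.kronecker_smul]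
      map_zero' := by simp
      map_add' := fun z w => by simp [Matrix.kronecker_add]
      map_mul' := fun z w => by
        have := Matrix.mul_kronecker_mul (1 : Matrix I I ℂ) (1 : Matrix I I ℂ) z w
        rw [one_mul] at this; exact this
      map_star' := fun z => by simp [Matrix.star_eq_conjTranspose, Matrix.conjTranspose_kronecker] }
    have hf : Ψ 1 = f (ψ 1) := by
      ext p q
      rw [hΨ, map_one]
      change _ = (1 : Matrix I I ℂ) p.1 q.1 * ψ 1 p.2 q.2
      by_cases hpq : p.1 = q.1
      · simp [Matrix.one_apply, hpq]
      · simp [Matrix.one_apply, hpq]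
    rw [hf]
    refine (NonUnitalStarAlgHom.norm_apply_le f _).trans ((hn 1).trans ?_)
    rcases subsingleton_or_nontrivial A with hs | hs
    · rw [Subsingleton.elim (1 : A) 0, norm_zero]; exact zero_le_one
    · rw [CStarRing.norm_one]
  refine ⟨I × N, K, inferInstance, inferInstance, inferInstance, inferInstance, fun p => blk p.2, J,
    fun p => e.symm (Matrix.single p.1 0 (v p.2)), Ψ, ⟨?_, ?_, ?_⟩, ?_, hcpΨ, hcpΨ.contr h1Ψ, ?_⟩
  · rintro ⟨l, a⟩ ⟨l', b⟩ hab
    simp only [hss]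
    rw [hv.diag a b hab]
  · rintro ⟨l, a⟩ ⟨l', b⟩ hab hJ
    by_cases hl : l = l'
    · subst hl
      simp only [hss]
      rw [hv.off a b (fun h => hab (by rw [h])) hJ]; simp
    · rw [← map_star, Matrix.star_eq_conjTranspose, Matrix.conjTranspose_single, ← map_mul, 
        Matrix.single_mul_single_of_ne _ _ _ _ hl, map_zero]
  · rintro ⟨l, a⟩
    exact (hsn _ _ _).trans (hv.nrm a)
  · intro b p q hpq
    rw [hΨ]; exact hbd _ _ _ hpq
  · intro b hb
    have h3 : ∀ b : B, b = ∑ l, ∑ l', e.symm (Matrix.single l l' (e b l l')) := by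
      intro b
      simp only [← map_sum]
      rw [← Matrix.matrix_eq_sum_single]; simp
    have h2 : phi (fun p : I × N => e.symm (Matrix.single p.1 0 (v p.2))) (Ψ b) = 
        ∑ l, ∑ l', e.symm (Matrix.single l l' (phi v (ψ (e b l l')))) := by
      have h5 : ∀ l l' : I, e.symm (Matrix.single l l' (phi v (ψ (e b l l')))) = 
          ∑ a, ∑ c, Ψ b (l, a) (l', c) • (e.symm (Matrix.single l 0 (v a)) * star (e.symm (Matrix.single l' 0 (v c)))) := by
        intro l l'
        rw [phi_apply]
        have : ∀ (s : Finset N) (g : N → A), Matrix.single l l' (∑ a ∈ s, g a) = ∑ a ∈ s, Matrix.single l l' (g a) := 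
          fun s g => map_sum (Matrix.singleAddMonoidHom l l') g s
        simp only [this, map_sum]
        refine Finset.sum_congr rfl fun a _ => Finset.sum_congr rfl fun c _ => ?_
        rw [← map_star, Matrix.star_eq_conjTranspose, Matrix.conjTranspose_single, ← map_mul, 
          Matrix.single_mul_single_same, ← Matrix.smul_single, map_smul]
        rfl
      rw [phi_apply, Fintype.sum_prod_type]
      refine Finset.sum_congr rfl fun l _ => ?_
      simp only [h5]
      rw [Finset.sum_comm (s := (Finset.univ : Finset I))]
      refine Finset.sum_congr rfl fun a _ => ?_
      rw [Fintype.sum_prod_type]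
    have h4 : phi (fun p : I × N => e.symm (Matrix.single p.1 0 (v p.2))) (Ψ b) - b =
        ∑ l, ∑ l', e.symm (Matrix.single l l' (phi v (ψ (e b l l')) - e b l l')) := by
      rw [h2]
      nth_rewrite 2 [h3 b]
      simp only [← Finset.sum_sub_distrib, ← map_sub]
      refine Finset.sum_congr rfl fun l _ => Finset.sum_congr rfl fun l' _ => ?_
      congr 1
      exact (map_sub (Matrix.singleAddMonoidHom (α := A) l l') _ _).symm
    rw [h4]
    have h6 : ∀ l l' : I, ‖e.symm (Matrix.single l l' (phi v (ψ (e b l l')) - e b l l'))‖ ≤ ε' := by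
      intro l l'
      refine (hsn _ _ _).trans (hS _ ?_).le
      simp only [Finset.mem_biUnion, Finset.mem_image, Finset.mem_univ, true_and]
      exact ⟨b, hb, l, l', rfl⟩
    calc _ ≤ ∑ l : I, ∑ l' : I, ε' := (norm_sum_le _ _).trans (Finset.sum_le_sum fun l _ =>
          (norm_sum_le _ _).trans (Finset.sum_le_sum fun l' _ => h6 l l'))
      _ = (k + 1) * (k + 1) * ε' := by simp [I]; ring
      _ < ε := by
        have : ((k + 1) * (k + 1) + 1) * ε' = ε := by simp only [ε']; field_simp
        linarith
end sat
end

section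

section st
variable {A N K M : Type} [CStarAlgebra A] [Fintype N] [DecidableEq N] [Fintype M]

lemma phi_conj_mul (v : N → A) (x y : Matrix M N ℂ) :
    phi v (x.conjTranspose * y) = ∑ c, star (∑ a, x c a • star (v a)) * (∑ b, y c b • star (v b)) := by
  simp only [phi_apply, Matrix.mul_apply, Finset.sum_smul, star_sum, star_smul, star_star,
    Matrix.conjTranspose_apply, Finset.sum_mul, Finset.mul_sum, smul_mul_smul_comm]
  have h1 : ∀ a, (∑ b, ∑ c, (star (x c a) * y c b) • (v a * star (v b))) =
      ∑ c, ∑ b, (star (x c a) * y c b) • (v a * star (v b)) := fun a => Finset.sum_comm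
  simp only [h1]
  rw [Finset.sum_comm]
  refine Finset.sum_congr rfl fun c _ => ?_
  rw [Finset.sum_comm]

lemma phi_split {blk : N → K} (X : K → Prop) (v : N → A) {x : Matrix N N ℂ} (hx : BD blk x) :
    phi v x = phi (rst (fun a => X (blk a)) v) x + phi (rst (fun a => ¬ X (blk a)) v) x := by
  simp only [phi_apply, ← Finset.sum_add_distrib]
  refine Finset.sum_congr rfl fun a _ => Finset.sum_congr rfl fun b _ => ?_
  by_cases hab : blk a = blk b
  · by_cases h : X (blk b) <;> simp [rst, hab, h]
  · simp [hx a b hab]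

lemma norm_le_norm_add {a b : A} (ha : ∃ m : Type, ∃ _ : Fintype m, ∃ z : m → A, a = ∑ c, star (z c) * z c)
    (hb : ∃ m : Type, ∃ _ : Fintype m, ∃ z : m → A, b = ∑ c, star (z c) * z c) : ‖a‖ ≤ ‖a + b‖ := by
  letI := CStarAlgebra.spectralOrder A
  letI := CStarAlgebra.spectralOrderedRing A
  obtain ⟨m, _, z, rfl⟩ := ha
  obtain ⟨m', _, z', rfl⟩ := hb
  refine CStarAlgebra.norm_le_norm_of_nonneg_of_le (Finset.sum_nonneg fun c _ => star_mul_self_nonneg _) ?_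
  exact le_add_of_nonneg_right (Finset.sum_nonneg fun c _ => star_mul_self_nonneg _)

lemma star_key {blk : N → K} (v : N → A) {ψ : A →ₗ[ℂ] Matrix N N ℂ} (hbd : ∀ b, BD blk (ψ b)) (hcp : CPm ψ)
    (X : K → Prop) (b : A) :
    ‖phi (rst (fun a => X (blk a)) v) (ψ b) - phi (rst (fun a => X (blk a)) v) (ψ 1) * b‖ ^ 2 ≤
      ‖phi v (ψ 1)‖ * ‖phi v (ψ (star b * b)) - phi v (ψ (star b)) * b - star b * phi v (ψ b) +
        star b * phi v (ψ 1) * b‖ := by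
  classical
  obtain ⟨B, hB⟩ := hcp.factor (fun t : Bool => if t then b else 1)
  have h11 := hB true true
  have h10 := hB true false
  have h01 := hB false true
  have h00 := hB false false
  simp only [if_true, Bool.false_eq_true, if_false, star_one, one_mul, mul_one] at h11 h10 h01 h00
  let t : (N → A) → Bool → (Bool × N) → A := fun w p c => ∑ e, B p c e • star (w e)
  let z : (N → A) → (Bool × N) → A := fun w c => t w true c - t w false c * b
  have e11 : ∀ w, phi w (ψ (star b * b)) = ∑ c, star (t w true c) * t w true c := fun w => by
    rw [h11, phi_conj_mul]
  have e10 : ∀ w, phi w (ψ (star b)) = ∑ c, star (t w true c) * t w false c := fun w => by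
    rw [h10, phi_conj_mul]
  have e01 : ∀ w, phi w (ψ b) = ∑ c, star (t w false c) * t w true c := fun w => by
    rw [h01, phi_conj_mul]
  have e00 : ∀ w, phi w (ψ 1) = ∑ c, star (t w false c) * t w false c := fun w => by
    rw [h00, phi_conj_mul]
  let ζ : (N → A) → A := fun w => phi w (ψ (star b * b)) - phi w (ψ (star b)) * b - star b * phi w (ψ b) +
        star b * phi w (ψ 1) * b
  have hζ : ∀ w, ζ w = ∑ c, star (z w c) * z w c := by
    intro w
    simp only [ζ, z, e11, e10, e01, e00, Finset.sum_mul, Finset.mul_sum, ← Finset.sum_add_distrib, 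
      ← Finset.sum_sub_distrib]
    refine Finset.sum_congr rfl fun c _ => ?_
    rw [star_sub, star_mul]
    noncomm_ring
  set w := rst (fun a => X (blk a)) v
  set w' := rst (fun a => ¬ X (blk a)) v
  have hs : ∀ x, phi v (ψ x) = phi w (ψ x) + phi w' (ψ x) := fun x => phi_split X v (hbd x)
  have n1 : ‖phi w (ψ 1)‖ ≤ ‖phi v (ψ 1)‖ := by
    rw [hs]
    exact norm_le_norm_add ⟨_, _, _, e00 w⟩ ⟨_, _, _, e00 w'⟩
  have n2 : ‖ζ w‖ ≤ ‖ζ v‖ := by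
    have : ζ v = ζ w + ζ w' := by
      simp only [ζ, hs]; noncomm_ring
    rw [this]
    exact norm_le_norm_add ⟨_, _, _, hζ w⟩ ⟨_, _, _, hζ w'⟩
  have h3 : phi w (ψ b) - phi w (ψ 1) * b = ∑ c, star (t w false c) * z w c := by
    simp only [z, e01, e00, Finset.sum_mul, ← Finset.sum_sub_distrib, mul_sub, mul_assoc]
  rw [h3]
  refine (cauchy_schwarz _ _).trans ?_
  rw [← e00, ← hζ]
  exact mul_le_mul n1 n2 (norm_nonneg _) (norm_nonneg _)

lemma CPm.map_star {ψ : A →ₗ[ℂ] Matrix N N ℂ} (hcp : CPm ψ) (b : A) : ψ (star b) = (ψ b).conjTranspose := by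
  obtain ⟨B, hB⟩ := hcp.factor (fun t : Bool => if t then b else 1)
  have h10 := hB true false
  have h01 := hB false true
  simp only [if_true, Bool.false_eq_true, if_false, star_one, one_mul, mul_one] at h10 h01
  rw [h10, h01]; simp

lemma CPm.psd_one {ψ : A →ₗ[ℂ] Matrix N N ℂ} (hcp : CPm ψ) : (ψ 1).PosSemidef := by
  obtain ⟨B, hB⟩ := hcp.factor (fun t : Unit => 1)
  have := hB () ()
  simp only [star_one, one_mul] at this
  rw [this]; exact Matrix.posSemidef_conjTranspose_mul_self _

end st

def StarND (n : ℕ) (A : Type) [CStarAlgebra A] : Prop :=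
  ∀ (S : Finset A) (ε : ℝ), 0 < ε → ∃ (N K : Type) (_ : Fintype N) (_ : DecidableEq N)
    (_ : Fintype K) (_ : DecidableEq K) (blk : N → K) (J : K → Fin (n + 1)) (v : N → A)
    (d : Matrix N N ℂ) (hat : A → Matrix N N ℂ), IsRow blk J v ∧ BD blk d ∧ d.PosSemidef ∧ ‖d‖ ≤ 1 ∧
    ∀ b ∈ S, BD blk (hat b) ∧ ‖phi v (hat b) - b‖ < ε ∧ ∀ X : K → Prop,
      ‖phi (rst (fun a => X (blk a)) v) (hat b) - phi (rst (fun a => X (blk a)) v) d * b‖ < ε ∧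
      ‖phi (rst (fun a => X (blk a)) v) (hat b) - b * phi (rst (fun a => X (blk a)) v) d‖ < ε

lemma norm_one_le' (A : Type) [CStarAlgebra A] : ‖(1 : A)‖ ≤ 1 := by
  rcases subsingleton_or_nontrivial A with hs | hs
  · rw [Subsingleton.elim (1 : A) 0, norm_zero]; exact zero_le_one
  · rw [CStarRing.norm_one]

lemma starND_of_rowND {n : ℕ} {A : Type} [CStarAlgebra A] (h : RowND n A) : StarND n A := by
  classical
  intro S ε hε
  let R : ℝ := 1 + ∑ b ∈ S, ‖b‖
  have hR : 1 ≤ R := le_add_of_nonneg_right (Finset.sum_nonneg fun b _ => norm_nonneg _)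
  have hSR : ∀ b ∈ S, ‖b‖ ≤ R := fun b hb => by
    have := Finset.single_le_sum (f := fun b => ‖b‖) (fun b _ => norm_nonneg b) hb
    simp only [R]; linarith
  obtain ⟨η, hη, hη1, hηε, hηR⟩ : ∃ η : ℝ, 0 < η ∧ η ≤ 1 ∧ η ≤ ε ∧ 2 * (η * (4 * R ^ 2)) < ε ^ 2 := by
    refine ⟨min 1 (min ε (ε ^ 2 / (16 * R ^ 2))), by positivity, min_le_left _ _,
      (min_le_right _ _).trans (min_le_left _ _), ?_⟩
    have : min 1 (min ε (ε ^ 2 / (16 * R ^ 2))) ≤ ε ^ 2 / (16 * R ^ 2) := (min_le_right _ _).trans (min_le_right _ _)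
    calc _ ≤ 2 * (ε ^ 2 / (16 * R ^ 2) * (4 * R ^ 2)) := by gcongr
      _ = ε ^ 2 / 2 := by field_simp; norm_num
      _ < ε ^ 2 := by have : 0 < ε ^ 2 := by positivity
                      linarith
  obtain ⟨N, K, _, _, _, _, blk, J, v, ψ, hv, hbd, hcp, hn, hS⟩ := 
    h (({1} ∪ S ∪ S.image star) ∪ (S.image (fun b => star b * b) ∪ S.image (fun b => b * star b))) η hη
  have m1 : ‖phi v (ψ 1) - 1‖ < η := hS _ (by simp)
  have m1' : ‖phi v (ψ 1)‖ ≤ 2 := by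
    have := norm_add_le (phi v (ψ 1) - 1) 1
    rw [sub_add_cancel] at this
    linarith [norm_one_le' A]
  have key : ∀ b : A, ‖b‖ ≤ R → ‖phi v (ψ b) - b‖ < η → ‖phi v (ψ (star b)) - star b‖ < η → 
      ‖phi v (ψ (star b * b)) - star b * b‖ < η → ∀ X : K → Prop,
      ‖phi (rst (fun a => X (blk a)) v) (ψ b) - phi (rst (fun a => X (blk a)) v) (ψ 1) * b‖ < ε := by
    intro b hb i1 i2 i3 X
    have := star_key v hbd hcp X b
    refine lt_of_pow_lt_pow_left₀ 2 hε.le (this.trans_lt (lt_of_le_of_lt ?_ hηR))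
    refine mul_le_mul m1' ?_ (norm_nonneg _) (by norm_num)
    have e : phi v (ψ (star b * b)) - phi v (ψ (star b)) * b - star b * phi v (ψ b) +
        star b * phi v (ψ 1) * b = (phi v (ψ (star b * b)) - star b * b) - (phi v (ψ (star b)) - star b) * b 
        - star b * (phi v (ψ b) - b) + star b * (phi v (ψ 1) - 1) * b := by noncomm_ring
    rw [e]
    have hb' : ‖star b‖ ≤ R := by rwa [norm_star]
    have s2 : ‖(phi v (ψ (star b)) - star b) * b‖ ≤ η * R := (norm_mul_le _ _).trans (by gcongr)
    have s3 : ‖star b * (phi v (ψ b) - b)‖ ≤ R * η := (norm_mul_le _ _).trans (by gcongr)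
    have s4 : ‖star b * (phi v (ψ 1) - 1) * b‖ ≤ R * η * R := (norm_mul_le _ _).trans (by
      gcongr; exact (norm_mul_le _ _).trans (by gcongr))
    have t1 := norm_add_le ((phi v (ψ (star b * b)) - star b * b) - (phi v (ψ (star b)) - star b) * b 
        - star b * (phi v (ψ b) - b)) (star b * (phi v (ψ 1) - 1) * b)
    have t2 := norm_sub_le ((phi v (ψ (star b * b)) - star b * b) - (phi v (ψ (star b)) - star b) * b)
        (star b * (phi v (ψ b) - b))
    have t3 := norm_sub_le (phi v (ψ (star b * b)) - star b * b) ((phi v (ψ (star b)) - star b) * b)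
    have hRR : η * R ≤ η * R ^ 2 := by gcongr; nlinarith
    have hR1 : η ≤ η * R ^ 2 := by nlinarith
    nlinarith
  have hstar : ∀ (w : N → A) b, phi w (ψ (star b)) = star (phi w (ψ b)) := by
    intro w b
    rw [hcp.map_star]; exact (star_phi2 w w _).symm
  refine ⟨N, K, inferInstance, inferInstance, inferInstance, inferInstance, blk, J, v, ψ 1, ψ, hv, hbd 1, 
    hcp.psd_one, (hn 1).trans (norm_one_le' A), fun b hb => ⟨hbd b, (hS _ (by simp [hb])).trans_le hηε, fun X => ?_⟩⟩
  have c1 := hS b (by simp [hb])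
  have c2 := hS (star b) (by simp only [Finset.mem_union, Finset.mem_image]; left; right; exact ⟨b, hb, rfl⟩)
  have c3 := hS (star b * b) (by simp only [Finset.mem_union, Finset.mem_image]; right; left; exact ⟨b, hb, rfl⟩)
  have c4 := hS (b * star b) (by simp only [Finset.mem_union, Finset.mem_image]; right; right; exact ⟨b, hb, rfl⟩)
  refine ⟨key b (hSR b hb) c1 c2 c3 X, ?_⟩
  have := key (star b) (by rw [norm_star]; exact hSR b hb) c2 (by rwa [star_star]) (by rwa [star_star]) X
  rw [← norm_star, star_sub, star_mul, star_star, ← hstar, ← hstar, star_star, star_one] at this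
  exact this

lemma starND_of_local {n : ℕ} {A : Type} [CStarAlgebra A]
    (h : ∀ (S : Finset A) (ε : ℝ), 0 < ε → ∃ (B : Type) (_ : CStarAlgebra B), StarND n B ∧ ∃ φ : B →⋆ₐ[ℂ] A,
      ∀ a ∈ S, ∃ b : B, ‖a - φ b‖ < ε) : StarND n A := by
  classical
  letI := CStarAlgebra.spectralOrder A
  letI := CStarAlgebra.spectralOrderedRing A
  intro S ε hε
  let ε' := ε / (n + 3)
  have hε' : 0 < ε' := by positivity
  have hεε : ε' * (n + 3) = ε := by simp only [ε']; field_simp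
  obtain ⟨B, _, hB, φ, hφ⟩ := h S ε' hε'
  have : ∀ a : A, ∃ b : B, a ∈ S → ‖a - φ b‖ < ε' := fun a => by
    by_cases ha : a ∈ S
    · obtain ⟨b, hb⟩ := hφ a ha; exact ⟨b, fun _ => hb⟩
    · exact ⟨0, fun h => (ha h).elim⟩
  choose β hβ using this
  obtain ⟨N, K, _, _, _, _, blk, J, v, d, hat, hv, hd, hdp, hd1, hS⟩ := hB (S.image β) ε' hε'
  have hv' := hv.map (φ : B →⋆ₙₐ[ℂ] A)
  have hnφ : ∀ x : B, ‖φ x‖ ≤ ‖x‖ := fun x => NonUnitalStarAlgHom.norm_apply_le φ x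
  refine ⟨N, K, inferInstance, inferInstance, inferInstance, inferInstance, blk, J, fun a => φ (v a), d, 
    fun a => hat (β a), hv', hd, hdp, hd1, fun a ha => ?_⟩
  obtain ⟨i1, i2, i3⟩ := hS (β a) (Finset.mem_image_of_mem _ ha)
  have hpm : ∀ x, phi (fun a => φ (v a)) x = φ (phi v x) := fun x => (phi_map (φ : B →⋆ₙₐ[ℂ] A) v x).symm
  refine ⟨i1, ?_, fun X => ?_⟩
  · rw [hpm]
    have e : φ (phi v (hat (β a))) - a = φ (phi v (hat (β a)) - β a) - (a - φ (β a)) := by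
      rw [map_sub]; abel
    rw [e]
    have := norm_sub_le (φ (phi v (hat (β a)) - β a)) (a - φ (β a))
    have h2 := hnφ (phi v (hat (β a)) - β a)
    have h3 := hβ a ha
    have : (0:ℝ) ≤ n := by positivity
    nlinarith
  · obtain ⟨i4, i5⟩ := i3 X
    have hr : rst (fun a => X (blk a)) (fun a => φ (v a)) = fun a => φ (rst (fun a => X (blk a)) v a) := by
      funext a; by_cases h : X (blk a) <;> simp [rst, h]
    have hpm' : ∀ x, phi (rst (fun a => X (blk a)) (fun a => φ (v a))) x = φ (phi (rst (fun a => X (blk a)) v) x) := 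
      fun x => by rw [hr]; exact (phi_map (φ : B →⋆ₙₐ[ℂ] A) _ x).symm
    have hb : ‖phi (rst (fun a => X (blk a)) (fun a => φ (v a))) d‖ ≤ n + 1 := by
      refine (phi_row_le (hv'.restr X) zero_le_one (hv'.restr X).nrm_sq hd).trans ?_
      have : (0:ℝ) ≤ n + 1 := by positivity
      nlinarith
    have h3 := hβ a ha
    constructor
    · have e : phi (rst (fun a => X (blk a)) (fun a => φ (v a))) (hat (β a)) - 
          phi (rst (fun a => X (blk a)) (fun a => φ (v a))) d * a = 
          φ (phi (rst (fun a => X (blk a)) v) (hat (β a)) - phi (rst (fun a => X (blk a)) v) d * β a) - 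
          phi (rst (fun a => X (blk a)) (fun a => φ (v a))) d * (a - φ (β a)) := by
        rw [hpm', hpm', map_sub, map_mul]; noncomm_ring
      rw [e]
      have t := norm_sub_le (φ (phi (rst (fun a => X (blk a)) v) (hat (β a)) - phi (rst (fun a => X (blk a)) v) d * β a)) (phi (rst (fun a => X (blk a)) (fun a => φ (v a))) d * (a - φ (β a)))
      have t2 := (hnφ _).trans i4.le
      have t3 : ‖phi (rst (fun a => X (blk a)) (fun a => φ (v a))) d * (a - φ (β a))‖ ≤ (n + 1) * ε' :=
        (norm_mul_le _ _).trans (by gcongr)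
      nlinarith
    · have e : phi (rst (fun a => X (blk a)) (fun a => φ (v a))) (hat (β a)) - 
          a * phi (rst (fun a => X (blk a)) (fun a => φ (v a))) d = 
          φ (phi (rst (fun a => X (blk a)) v) (hat (β a)) - β a * phi (rst (fun a => X (blk a)) v) d) - 
          (a - φ (β a)) * phi (rst (fun a => X (blk a)) (fun a => φ (v a))) d := by
        rw [hpm', hpm', map_sub, map_mul]; noncomm_ring
      rw [e]
      have t := norm_sub_le (φ (phi (rst (fun a => X (blk a)) v) (hat (β a)) - β a * phi (rst (fun a => X (blk a)) v) d)) ((a - φ (β a)) * phi (rst (fun a => X (blk a)) (fun a => φ (v a))) d)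
      have t2 := (hnφ _).trans i5.le
      have t3 : ‖(a - φ (β a)) * phi (rst (fun a => X (blk a)) (fun a => φ (v a))) d‖ ≤ ε' * (n + 1) :=
        (norm_mul_le _ _).trans (by gcongr)
      nlinarith
end

section

section stt
variable {A : Type} [CStarAlgebra A]

lemma state_pos [PartialOrder A] [StarOrderedRing A] (f : A →ₗ[ℂ] ℂ) (hf : ∀ x, ‖f x‖ ≤ ‖x‖)
    (h1 : f 1 = 1) {y : A} (hy : 0 ≤ y) : 0 ≤ f y := by
  have hsa : IsSelfAdjoint y := .of_nonneg hy
  have him : (f y).im = 0 := by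
    have key : ∀ t : ℝ, (f y).im ^ 2 + 2 * t * (f y).im ≤ ‖y‖ ^ 2 := by
      intro t
      have e1 : f (y + (t * Complex.I : ℂ) • 1) = f y + t * Complex.I := by simp [h1]
      have e2 : ‖y + (t * Complex.I : ℂ) • (1:A)‖ ^ 2 ≤ ‖y‖ ^ 2 + t ^ 2 := by
        rw [sq, ← CStarRing.norm_star_mul_self]
        have : star (y + (t * Complex.I : ℂ) • (1:A)) * (y + (t * Complex.I : ℂ) • (1:A)) = y * y + ((t ^ 2 : ℝ) : ℂ) • 1 := by
          rw [star_add, star_smul, hsa.star_eq, star_one]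
          simp only [add_mul, mul_add, smul_mul_assoc, mul_smul_comm, one_mul, mul_one, smul_smul, smul_add]
          have : star (t * Complex.I : ℂ) = - (t * Complex.I : ℂ) := by simp
          rw [this]
          have e3 : (t * Complex.I : ℂ) * -(t * Complex.I : ℂ) = ((t ^ 2 : ℝ) : ℂ) := by
            push_cast; ring_nf; simp
          have e4 : -(t * Complex.I : ℂ) * (t * Complex.I : ℂ) = ((t ^ 2 : ℝ) : ℂ) := by
            push_cast; ring_nf; simp
          simp only [e4, e3, neg_smul]
          abel
        rw [this]
        refine (norm_add_le _ _).trans (add_le_add ?_ ?_)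
        · rw [sq]; exact norm_mul_le _ _
        · rw [norm_smul]
          have := norm_one_le' A
          rw [Complex.norm_real, Real.norm_of_nonneg (sq_nonneg t)]
          nlinarith [sq_nonneg t]
      have e3 := hf (y + (t * Complex.I : ℂ) • 1)
      rw [e1] at e3
      have e4 : ((f y).im + t) ^ 2 ≤ ‖f y + t * Complex.I‖ ^ 2 := by
        have := Complex.abs_im_le_norm (f y + t * Complex.I)
        have e5 : (f y + t * Complex.I).im = (f y).im + t := by simp
        rw [e5] at this
        rw [← sq_abs]
        gcongr
      have : ‖f y + t * Complex.I‖ ^ 2 ≤ ‖y + (t * Complex.I : ℂ) • (1:A)‖ ^ 2 := by gcongr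
      nlinarith
    by_contra h
    have := key ((‖y‖ ^ 2 + 1) / (2 * (f y).im))
    have e : 2 * ((‖y‖ ^ 2 + 1) / (2 * (f y).im)) * (f y).im = ‖y‖ ^ 2 + 1 := by field_simp
    nlinarith [sq_nonneg (f y).im]
  have hre : 0 ≤ (f y).re := by
    have h2 : ‖((‖y‖ : ℝ) : ℂ) • (1:A) - y‖ ≤ ‖y‖ := by
      have hle : y ≤ ((‖y‖ : ℝ) : ℂ) • (1:A) := by
        have := hsa.le_algebraMap_norm_self
        rw [Algebra.algebraMap_eq_smul_one, RCLike.real_smul_eq_coe_smul (K := ℂ)] at this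
        exact this
      refine (CStarAlgebra.norm_le_norm_of_nonneg_of_le (sub_nonneg.2 hle) (sub_le_self _ hy)).trans ?_
      rw [norm_smul]; simp
      exact mul_le_of_le_one_right (norm_nonneg _) (norm_one_le' A)
    have h3 := hf (((‖y‖ : ℝ) : ℂ) • (1:A) - y)
    have h4 : (f (((‖y‖ : ℝ) : ℂ) • (1:A) - y)).re = ‖y‖ - (f y).re := by simp [h1]
    have h5 := (Complex.re_le_norm (f (((‖y‖ : ℝ) : ℂ) • (1:A) - y)))
    rw [h4] at h5
    linarith
  rw [Complex.le_def]; exact ⟨by simpa using hre, by simp [him]⟩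

lemma exists_state [PartialOrder A] [StarOrderedRing A] {h : A} (hh : 0 ≤ h) : ∃ ω : A →ₗ[ℂ] ℂ, (∀ x, 0 ≤ ω (star x * x)) ∧ (∀ x, ‖ω x‖ ≤ ‖x‖) ∧
    ω h = ‖h‖ := by
  rcases subsingleton_or_nontrivial A with hs | hs
  · exact ⟨0, fun x => le_rfl, fun x => by simp, by rw [Subsingleton.elim h 0]; simp⟩
  · have hn : ‖1 + h‖ = 1 + ‖h‖ := by
      refine le_antisymm ((norm_add_le _ _).trans (by rw [CStarRing.norm_one])) ?_
      have h1 : ‖h‖ ∈ spectrum ℝ h := CStarAlgebra.norm_mem_spectrum_of_nonneg hh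
      have h2 : 1 + ‖h‖ ∈ spectrum ℝ (1 + h) := by
        have := (spectrum.add_mem_add_iff (r := ‖h‖) (s := (1:ℝ)) (a := h)).2 h1
        simpa [add_comm] using this
      have := spectrum.norm_le_norm_of_mem h2
      rwa [Real.norm_of_nonneg (by positivity)] at this
    obtain ⟨g, hg, hg1⟩ := exists_dual_vector ℂ (1 + h) (by
      intro h0; rw [hn] at h0; linarith [norm_nonneg h])
    have hgn : ∀ x, ‖g x‖ ≤ ‖x‖ := fun x => by simpa [hg] using g.le_opNorm x
    have e1 := hgn 1
    have e2 := hgn h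
    rw [CStarRing.norm_one] at e1
    rw [hn, map_add] at hg1
    have r1 := Complex.re_le_norm (g 1)
    have r2 := Complex.re_le_norm (g h)
    have r3 : (g 1).re + (g h).re = 1 + ‖h‖ := by
      have := congrArg Complex.re hg1; simpa using this
    have q1 : g 1 = ((1:ℝ) : ℂ) := by
      have a1 : (g 1).re = 1 := by linarith
      have a2 : ‖g 1‖ = (g 1).re := by linarith
      have a3 := Complex.re_eq_norm.1 a2.symm
      exact Complex.ext (by simpa using a1) (by simpa using (Complex.le_def.1 a3).2.symm)
    have q2 : g h = ((‖h‖:ℝ) : ℂ) := by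
      rw [q1] at hg1; push_cast at hg1; exact add_left_cancel hg1
    refine ⟨g, fun x => state_pos (g : A →ₗ[ℂ] ℂ) hgn (by simpa using q1) (star_mul_self_nonneg x), hgn, q2⟩

lemma comm_pow_le (q : Polynomial ℝ) : ∃ C : ℝ, 0 ≤ C ∧ ∀ (M : Type) [CStarAlgebra M] (d k : M), ‖d‖ ≤ 1 → 
    ‖k * Polynomial.aeval d q - Polynomial.aeval d q * k‖ ≤ C * ‖k * d - d * k‖ := by
  induction q using Polynomial.induction_on' with
  | add p q hp hq =>
    obtain ⟨C, h0, h⟩ := hp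
    obtain ⟨C', h0', h'⟩ := hq
    refine ⟨C + C', by positivity, fun M _ d k hd => ?_⟩
    rw [map_add]
    have e : k * (Polynomial.aeval d p + Polynomial.aeval d q) - (Polynomial.aeval d p + Polynomial.aeval d q) * k = 
      (k * Polynomial.aeval d p - Polynomial.aeval d p * k) + (k * Polynomial.aeval d q - Polynomial.aeval d q * k) := by
      noncomm_ring
    rw [e, add_mul]
    exact (norm_add_le _ _).trans (add_le_add (h M d k hd) (h' M d k hd))
  | monomial m a =>
    have key : ∀ m : ℕ, ∀ (M : Type) [CStarAlgebra M] (d k : M), ‖d‖ ≤ 1 → ‖k * d ^ m - d ^ m * k‖ ≤ m * ‖k * d - d * k‖ := by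
      intro m M _ d k hd
      induction m with
      | zero => simp
      | succ m ih =>
        have e : k * d ^ (m + 1) - d ^ (m + 1) * k = (k * d ^ m - d ^ m * k) * d + d ^ m * (k * d - d * k) := by
          rw [pow_succ]; noncomm_ring
        rw [e]
        refine (norm_add_le _ _).trans ?_
        have a1 : ‖(k * d ^ m - d ^ m * k) * d‖ ≤ m * ‖k * d - d * k‖ * 1 := 
          (norm_mul_le _ _).trans (mul_le_mul ih hd (norm_nonneg _) (by positivity))
        have a2 : ‖d ^ m * (k * d - d * k)‖ ≤ 1 * ‖k * d - d * k‖ := by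
          refine (norm_mul_le _ _).trans (mul_le_mul_of_nonneg_right ?_ (norm_nonneg _))
          rcases Nat.eq_zero_or_pos m with rfl | hm
          · simpa using norm_one_le' M
          · exact (norm_pow_le' d hm).trans (pow_le_one₀ (norm_nonneg _) hd)
        push_cast
        linarith
    refine ⟨|a| * m, by positivity, fun M _ d k hd => ?_⟩
    rw [Polynomial.aeval_monomial, ← Algebra.smul_def, mul_smul_comm, smul_mul_assoc, ← smul_sub, norm_smul, 
      Real.norm_eq_abs, mul_assoc]
    exact mul_le_mul_of_nonneg_left (key m M d k hd) (abs_nonneg _)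

lemma comm_sqrt {ρ : ℝ} (hρ : 0 < ρ) : ∃ C : ℝ, 0 ≤ C ∧ ∀ (M : Type) [CStarAlgebra M] [PartialOrder M] 
    [StarOrderedRing M] (d k : M), 0 ≤ d → ‖d‖ ≤ 1 → 
    ‖k * cfcR Real.sqrt d - cfcR Real.sqrt d * k‖ ≤ ρ * ‖k‖ + C * ‖k * d - d * k‖ := by
  obtain ⟨q, hq⟩ := exists_polynomial_near_of_continuousOn 0 1 Real.sqrt (by fun_prop) (ρ / 2) (by positivity)
  obtain ⟨C, hC, h⟩ := comm_pow_le q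
  refine ⟨C, hC, fun M _ _ _ d k hd hd1 => ?_⟩
  have hsa : IsSelfAdjoint d := .of_nonneg hd
  have e : ‖Polynomial.aeval d q - cfcR Real.sqrt d‖ ≤ ρ / 2 := by
    rw [← cfc_polynomial (R := ℝ) q d, cfcR, ← cfc_sub _ _ d (by fun_prop) (by fun_prop)]
    refine norm_cfc_le (by positivity) fun x hx => ?_
    refine (hq x ⟨spectrum_nonneg_of_nonneg hd hx, ?_⟩).le
    rcases subsingleton_or_nontrivial M with hs | hs
    · rw [spectrum.of_subsingleton] at hx; exact hx.elim
    · exact (le_abs_self x).trans ((spectrum.norm_le_norm_of_mem hx).trans hd1)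
  set s := cfcR Real.sqrt d
  set p := Polynomial.aeval d q
  have e2 : k * s - s * k = (k * p - p * k) - (k * (p - s) - (p - s) * k) := by noncomm_ring
  rw [e2]
  have t1 := norm_sub_le (k * p - p * k) (k * (p - s) - (p - s) * k)
  have t2 := norm_sub_le (k * (p - s)) ((p - s) * k)
  have t3 : ‖k * (p - s)‖ ≤ ‖k‖ * (ρ / 2) := (norm_mul_le _ _).trans (by gcongr)
  have t4 : ‖(p - s) * k‖ ≤ (ρ / 2) * ‖k‖ := (norm_mul_le _ _).trans (by gcongr)
  have t5 : ‖k * p - p * k‖ ≤ _ := h M d k hd1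
  linarith

end stt
end

section

section mat
variable {N K : Type} [Fintype N] [DecidableEq N]

lemma opnorm_le_of_bilin {M : Matrix N N ℂ} {C : ℝ} (hC : 0 ≤ C)
    (h : ∀ x y : N → ℂ, ‖∑ e, ∑ f, star (x e) * M e f * y f‖ ≤ C * (√(∑ e, ‖x e‖ ^ 2) * √(∑ e, ‖y e‖ ^ 2))) :
    ‖M‖ ≤ C := by
  rw [Matrix.l2_opNorm_def]
  refine ContinuousLinearMap.opNorm_le_bound _ hC fun y => ?_
  set z := (Matrix.toEuclideanLin (𝕜 := ℂ) (m := N) (n := N) M) y with hz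
  change ‖z‖ ≤ _
  have hzc : ∀ e, z e = ∑ f, M e f * y f := by
    intro e
    rw [hz]; simp [Matrix.toLpLin_apply, Matrix.mulVec, dotProduct]
  have h1 := h (fun e => z e) (fun e => y e)
  rw [← EuclideanSpace.norm_eq, ← EuclideanSpace.norm_eq] at h1
  have h2 : ∑ e, ∑ f, star (z e) * M e f * y f = ((‖z‖ ^ 2 : ℝ) : ℂ) := by
    rw [EuclideanSpace.norm_sq_eq]
    push_cast
    refine Finset.sum_congr rfl fun e _ => ?_
    simp only [mul_assoc]
    rw [← Finset.mul_sum, ← hzc, ← Complex.conj_mul']; rfl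
  rw [h2, Complex.norm_real, Real.norm_of_nonneg (by positivity)] at h1
  rcases eq_or_lt_of_le (norm_nonneg z) with h0 | h0
  · rw [← h0]; positivity
  · nlinarith

lemma BD_iff_comm [DecidableEq K] {blk : N → K} {d : Matrix N N ℂ} : BD blk d ↔ ∀ i : K, 
    Commute (Matrix.diagonal fun a => if blk a = i then (1:ℂ) else 0) d := by
  constructor
  · intro h i
    ext a b
    rw [Matrix.diagonal_mul, Matrix.mul_diagonal]
    by_cases hab : blk a = blk b
    · rw [hab, mul_comm]
    · simp [h a b hab]
  · intro h a b hab
    have := congrFun (congrFun (h (blk a)) a) b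
    rw [Matrix.diagonal_mul, Matrix.mul_diagonal] at this
    simpa [Ne.symm hab] using this

lemma BD.cfcR {blk : N → K} {d : Matrix N N ℂ} (h : BD blk d) (f : ℝ → ℝ) :
    BD blk (cfcR f d) := by
  classical
  rw [BD_iff_comm] at h ⊢
  intro i
  exact (Commute.cfc_real (h i).symm f).symm

lemma BD.mul {blk : N → K} {x y : Matrix N N ℂ} (hx : BD blk x) (hy : BD blk y) : BD blk (x * y) := by
  intro a b hab
  rw [Matrix.mul_apply]
  refine Finset.sum_eq_zero fun c _ => ?_
  by_cases h : blk a = blk c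
  · rw [hy c b (h ▸ hab), mul_zero]
  · rw [hx a c h, zero_mul]

open scoped MatrixOrder in
lemma sqrt_psd {d : Matrix N N ℂ} (hd : d.PosSemidef) : (cfcR Real.sqrt d).conjTranspose = cfcR Real.sqrt d ∧
    cfcR Real.sqrt d * cfcR Real.sqrt d = d ∧ ∀ (ρ : ℝ) (hρ : 0 < ρ), ‖d‖ ≤ 1 → ∀ k : Matrix N N ℂ, 
     ‖k * cfcR Real.sqrt d - cfcR Real.sqrt d * k‖ ≤ ρ * ‖k‖ + (comm_sqrt hρ).choose * ‖k * d - d * k‖ := by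
  have h0 : 0 ≤ d := Matrix.nonneg_iff_posSemidef.2 hd
  refine ⟨(IsSelfAdjoint.cfc (f := Real.sqrt) (a := d) : IsSelfAdjoint (cfcR Real.sqrt d)), ?_, fun ρ hρ h1 k => ?_⟩
  · have hsa : IsSelfAdjoint d := .of_nonneg h0
    rw [cfcR, ← cfc_mul _ _ d (by fun_prop) (by fun_prop)]
    refine (cfc_congr (fun x hx => ?_)).trans (cfc_id' ℝ d hsa)
    exact Real.mul_self_sqrt (spectrum_nonneg_of_nonneg h0 hx)
  · exact (comm_sqrt hρ).choose_spec.2 _ d k h0 h1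

end mat

section rows
variable {A N K : Type} [CStarAlgebra A] [Fintype N] [DecidableEq N] [Fintype K] [DecidableEq K] {n : ℕ}
  {blk : N → K} {J : K → Fin (n + 1)} {v : N → A}

lemma exists_blockc (h : IsRow blk J v) : ∃ c : K → A, (∀ a b, blk a = blk b → star (v a) * v b = if a = b then c (blk a) else 0) ∧
    (∀ i, ∃ x, c i = star x * x) ∧ ∀ i, ‖c i‖ ≤ 1 := by
  classical
  refine ⟨fun i => if h : ∃ a, blk a = i then star (v h.choose) * v h.choose else 0, fun a b hab => ?_, fun i => ?_, fun i => ?_⟩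
  · have h2 : ∃ a', blk a' = blk a := ⟨a, rfl⟩
    simp only [h2, dite_true]
    by_cases h1 : a = b
    · subst h1; rw [if_pos rfl]; exact h.diag _ _ h2.choose_spec.symm
    · rw [if_neg h1]; exact h.off a b h1 (by rw [hab])
  · by_cases h1 : ∃ a, blk a = i
    · exact ⟨v h1.choose, by simp [h1]⟩
    · exact ⟨0, by simp [h1]⟩
  · by_cases h1 : ∃ a, blk a = i
    · simp only [h1, dite_true]
      rw [CStarRing.norm_star_mul_self]
      have := h.nrm h1.choose
      nlinarith [norm_nonneg (v h1.choose)]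
    · simp [h1]

/-- column combination of a block -/
lemma comb_norm (c : K → A) (hc : ∀ a b, blk a = blk b → star (v a) * v b = if a = b then c (blk a) else 0)
    (hc1 : ∀ i, ‖c i‖ ≤ 1) (i : K) (x : N → ℂ) :
    ‖∑ e, (if blk e = i then x e else 0) • v e‖ ≤ √(∑ e, if blk e = i then ‖x e‖ ^ 2 else 0) := by
  refine Real.le_sqrt_of_sq_le ?_
  rw [sq, ← CStarRing.norm_star_mul_self]
  have : star (∑ e, (if blk e = i then x e else 0) • v e) * (∑ e, (if blk e = i then x e else 0) • v e) = 
     ∑ e, (((if blk e = i then ‖x e‖ ^ 2 else 0 : ℝ)) : ℂ) • c i := by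
    rw [star_sum, Finset.sum_mul]
    refine Finset.sum_congr rfl fun e _ => ?_
    rw [Finset.mul_sum]
    rw [Finset.sum_eq_single e]
    · by_cases he : blk e = i
      · simp only [he, if_true, star_smul, smul_mul_smul_comm]
        rw [hc e e rfl, if_pos rfl, he]
        congr 1
        push_cast
        rw [← Complex.conj_mul']; rfl
      · simp [he]
    · intro f _ hf
      by_cases he : blk e = i
      · by_cases hf' : blk f = i
        · simp only [he, hf', if_true, star_smul, smul_mul_smul_comm]
          rw [hc e f (he.trans hf'.symm), if_neg (Ne.symm hf), smul_zero]
        · simp [hf']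
      · simp [he]
    · simp
  rw [this, ← Finset.sum_smul, norm_smul, ← Complex.ofReal_sum, Complex.norm_real, Real.norm_of_nonneg (Finset.sum_nonneg fun e _ => by positivity)]
  exact mul_le_of_le_one_right (Finset.sum_nonneg fun e _ => by positivity) (hc1 i)

lemma sum_blocks (g : N → ℝ) : ∑ i : K, ∑ e, (if blk e = i then g e else 0) = ∑ e, g e := by
  rw [Finset.sum_comm]; simp

/-- block bilinear bound -/
lemma bd_norm {M : Matrix N N ℂ} (hM : BD blk M) {C : ℝ} (hC : 0 ≤ C)
    (h : ∀ (i : K) (x y : N → ℂ), ‖∑ e, ∑ f, star (if blk e = i then x e else 0) * M e f * (if blk f = i then y f else 0)‖ ≤ 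
      C * (√(∑ e, if blk e = i then ‖x e‖ ^ 2 else 0) * √(∑ e, if blk e = i then ‖y e‖ ^ 2 else 0))) :
    ‖M‖ ≤ C := by
  refine opnorm_le_of_bilin hC fun x y => ?_
  have e1 : ∑ e, ∑ f, star (x e) * M e f * y f = 
      ∑ i, ∑ e, ∑ f, star (if blk e = i then x e else 0) * M e f * (if blk f = i then y f else 0) := by
    rw [Finset.sum_comm (s := (Finset.univ : Finset K))]
    refine Finset.sum_congr rfl fun e _ => ?_
    rw [Finset.sum_comm (s := (Finset.univ : Finset K))]
    refine Finset.sum_congr rfl fun f _ => ?_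
    by_cases hef : blk e = blk f
    · rw [Finset.sum_eq_single (blk e)]
      · simp [hef]
      · intro i _ hi; simp [Ne.symm hi]
      · simp
    · simp [hM e f hef]
  rw [e1]
  refine (norm_sum_le _ _).trans ((Finset.sum_le_sum fun i _ => h i x y).trans ?_)
  rw [← Finset.mul_sum]
  refine mul_le_mul_of_nonneg_left ?_ hC
  refine (Real.sum_sqrt_mul_sqrt_le _ (fun i => Finset.sum_nonneg fun e _ => by positivity) 
    (fun i => Finset.sum_nonneg fun e _ => by positivity)).trans ?_
  rw [sum_blocks (fun e => ‖x e‖ ^ 2), sum_blocks (fun e => ‖y e‖ ^ 2)]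
end rows
end

section

lemma gram_psd {A T : Type} [CStarAlgebra A] [Fintype T] {ω : A →ₗ[ℂ] ℂ} (hω : ∀ x, 0 ≤ ω (star x * x)) (z : T → A) :
    (Matrix.of fun s t => ω (star (z s) * z t)).PosSemidef := by
  letI := CStarAlgebra.spectralOrder A
  letI := CStarAlgebra.spectralOrderedRing A
  let Ω : A →ₚ[ℂ] ℂ := PositiveLinearMap.mk₀ ω (fun x hx => by
    obtain ⟨y, rfl⟩ := nonneg_ex hx; exact hω y)
  have hst : ∀ x, ω (star x) = star (ω x) := fun x => map_star Ω x
  refine Matrix.PosSemidef.of_dotProduct_mulVec_nonneg ?_ fun x => ?_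
  · ext s t
    rw [Matrix.conjTranspose_apply, Matrix.of_apply, Matrix.of_apply, ← hst, star_mul, star_star]
  · have : star x ⬝ᵥ (Matrix.of fun s t => ω (star (z s) * z t)).mulVec x = 
        ω (star (∑ s, x s • z s) * ∑ s, x s • z s) := by
      simp only [dotProduct, Matrix.mulVec, star_sum, Finset.sum_mul, Finset.mul_sum, map_sum, Matrix.of_apply,
        star_smul, smul_mul_smul_comm, map_smul, smul_eq_mul, Pi.star_apply]
      rw [Finset.sum_comm]
      refine Finset.sum_congr rfl fun t _ => Finset.sum_congr rfl fun s _ => ?_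
      ring
    rw [this]; exact hω _

lemma cube_norm {A : Type} [CStarAlgebra A] {c : A} (hc : star c = c) {δ : ℝ} (hδ : 0 < δ) (h : δ ≤ ‖c‖) :
    δ ^ 3 ≤ ‖c * c * c‖ := by
  have h1 : ‖c * c‖ = ‖c‖ * ‖c‖ := by nth_rw 1 [← hc]; exact CStarRing.norm_star_mul_self
  have h2 : ‖(c * c) * (c * c)‖ = ‖c * c‖ * ‖c * c‖ := by
    have : star (c * c) = c * c := by rw [star_mul, hc]
    nth_rw 1 [← this]; exact CStarRing.norm_star_mul_self
  have h3 := norm_mul_le (c * c * c) c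
  have e : c * c * c * c = (c * c) * (c * c) := by noncomm_ring
  rw [e, h2, h1] at h3
  have h4 : 0 < ‖c‖ := hδ.trans_le h
  have h5 : ‖c‖ * ‖c‖ * ‖c‖ ≤ ‖c * c * c‖ := by
    refine le_of_mul_le_mul_right (le_trans (le_of_eq ?_) h3) h4
    ring
  calc δ ^ 3 ≤ ‖c‖ ^ 3 := by gcongr
    _ = ‖c‖ * ‖c‖ * ‖c‖ := by ring
    _ ≤ _ := h5

section rows
variable {A N K : Type} [CStarAlgebra A] [Fintype N] [DecidableEq N] [Fintype K] [DecidableEq K] {n : ℕ}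
  {blk : N → K} {J : K → Fin (n + 1)} {v : N → A}

lemma star_mul_phi (c : K → A) (hc : ∀ a b, blk a = blk b → star (v a) * v b = if a = b then c (blk a) else 0)
    {i : K} {x : Matrix N N ℂ} {e : N} (he : blk e = i) : 
    star (v e) * phi (rst (fun a => blk a = i) v) x = ∑ b, x e b • (c i * star (rst (fun a => blk a = i) v b)) := by
  rw [phi_apply, Finset.mul_sum, Finset.sum_eq_single e]
  · rw [Finset.mul_sum]
    refine Finset.sum_congr rfl fun b _ => ?_
    rw [mul_smul_comm, ← mul_assoc, rst_pos (p := fun a => blk a = i) he, hc e e rfl, if_pos rfl, he]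
  · intro a _ hae
    rw [Finset.mul_sum]
    refine Finset.sum_eq_zero fun b _ => ?_
    rw [mul_smul_comm, ← mul_assoc]
    by_cases ha : blk a = i
    · rw [rst_pos (p := fun a => blk a = i) ha, hc e a (he.trans ha.symm), if_neg (Ne.symm hae), zero_mul, smul_zero]
    · rw [rst_neg (p := fun a => blk a = i) ha]; simp
  · simp

lemma exists_kappa (h : IsRow blk J v) {δ : ℝ} (hδ : 0 < δ) : ∃ (good : K → Prop) (κ : A →ₗ[ℂ] Matrix N N ℂ),
    (∀ a, ¬ good (blk a) → ‖star (v a) * v a‖ ≤ δ) ∧ CPm κ ∧ (∀ b, BD blk (κ b)) ∧ ‖κ 1‖ ≤ 1 ∧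
    (∀ x, BD blk x → phi v (κ 1 * x) = phi (rst (fun a => good (blk a)) v) x ∧ κ 1 * x = x * κ 1) ∧ 
    ∀ (d x : Matrix N N ℂ) (b : A) (η : ℝ), BD blk d → BD blk x → 0 ≤ η → 
      (∀ i, ‖phi (rst (fun a => blk a = i) v) x - phi (rst (fun a => blk a = i) v) d * b‖ ≤ η) →
      ‖κ 1 * x - d * κ b‖ ≤ η / δ ^ 3 := by
  classical
  letI := CStarAlgebra.spectralOrder A
  letI := CStarAlgebra.spectralOrderedRing A
  obtain ⟨c, hc, hcp, hc1⟩ := exists_blockc h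
  have hcs : ∀ i, star (c i) = c i := fun i => by obtain ⟨x, hx⟩ := hcp i; rw [hx]; simp
  have h3 : ∀ i, 0 ≤ c i * c i * c i := fun i => by
    obtain ⟨x, hx⟩ := hcp i
    have : c i * c i * c i = star (x * c i) * (x * c i) := by
      rw [star_mul, hcs]; nth_rw 2 [hx]; noncomm_ring
    rw [this]; exact star_mul_self_nonneg _
  choose ω hω1 hω2 hω3 using fun i => exists_state (h3 i)
  let good : K → Prop := fun i => δ ≤ ‖c i‖
  let τ : K → ℝ := fun i => ‖c i * c i * c i‖
  have hτ : ∀ i, good i → δ ^ 3 ≤ τ i := fun i hi => cube_norm (hcs i) hδ hi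
  have hτ0 : ∀ i, good i → 0 < τ i := fun i hi => lt_of_lt_of_le (by positivity) (hτ i hi)
  let κ : A →ₗ[ℂ] Matrix N N ℂ :=
    { toFun := fun b => Matrix.of fun e f => if blk e = blk f ∧ good (blk e) then 
        ((τ (blk e))⁻¹ : ℂ) * ω (blk e) (c (blk e) * star (v e) * b * v f * c (blk e)) else 0
      map_add' := fun x y => by
        ext e f
        simp only [Matrix.of_apply, Matrix.add_apply]
        split_ifs
        · rw [← mul_add, ← map_add]; congr 2; noncomm_ring
        · simp
      map_smul' := fun r x => by
        ext e f
        simp only [Matrix.of_apply, Matrix.smul_apply, RingHom.id_apply]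
        split_ifs
        · rw [mul_smul_comm, smul_mul_assoc, smul_mul_assoc, map_smul, smul_eq_mul, smul_eq_mul]; ring
        · simp }
  have hκ : ∀ b e f, κ b e f = if blk e = blk f ∧ good (blk e) then 
        ((τ (blk e))⁻¹ : ℂ) * ω (blk e) (c (blk e) * star (v e) * b * v f * c (blk e)) else 0 := fun b e f => rfl
  have hκ1 : κ 1 = Matrix.diagonal fun e => if good (blk e) then 1 else 0 := by
    ext e f
    rw [hκ, Matrix.diagonal_apply]
    by_cases hef : e = f
    · subst hef
      by_cases hg : good (blk e)
      · simp only [hg, and_self, if_true]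
        have : c (blk e) * star (v e) * 1 * v e * c (blk e) = c (blk e) * c (blk e) * c (blk e) := by
          rw [mul_one, mul_assoc (c (blk e)), hc e e rfl, if_pos rfl]
        rw [this, hω3]
        have := hτ0 _ hg
        exact inv_mul_cancel₀ (by exact_mod_cast this.ne')
      · simp [hg]
    · rw [if_neg hef]
      split_ifs with h1
      · rw [mul_one, mul_assoc (c (blk e)), hc e f h1.1, if_neg hef]; simp
      · rfl
  have hκbd : ∀ b, BD blk (κ b) := fun b e f hef => by rw [hκ, if_neg (fun h => hef h.1)]
  refine ⟨good, κ, ?_, ?_, hκbd, ?_, ?_, ?_⟩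
  · intro a ha
    rw [hc a a rfl, if_pos rfl]
    exact (not_le.1 ha).le
  · intro k a
    have := Matrix.posSemidef_sum (Finset.univ : Finset K) (fun i _ => 
      ((gram_psd (hω1 i) (fun s : Fin k × N => if blk s.2 = i ∧ good i then a s.1 * v s.2 * c i else 0)).smul 
        (show (0:ℝ) ≤ (τ i)⁻¹ by positivity)))
    convert this using 1
    ext s t
    simp only [Matrix.of_apply, Matrix.sum_apply, Matrix.smul_apply]
    rw [hκ, Finset.sum_eq_single (blk s.2)]
    · by_cases hg : good (blk s.2)
      · by_cases hst : blk s.2 = blk t.2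
        · simp only [hst.symm, hg, and_self, if_true]
          rw [Complex.real_smul]
          push_cast
          congr 2
          rw [star_mul, star_mul, hcs]; noncomm_ring
        · simp [hst, Ne.symm hst]
      · simp [hg]
    · intro i _ hi
      simp [Ne.symm hi]
    · simp
  · rw [hκ1, Matrix.l2_opNorm_diagonal, pi_norm_le_iff_of_nonneg zero_le_one]
    intro e; split_ifs <;> simp
  · intro x hx
    constructor
    · rw [hκ1]
      simp only [phi_apply, Matrix.diagonal_mul]
      refine Finset.sum_congr rfl fun e _ => Finset.sum_congr rfl fun f _ => ?_
      by_cases hef : blk e = blk f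
      · by_cases hg : good (blk f)
        · simp [rst, hg, hef]
        · simp [rst, hg, hef]
      · simp [hx e f hef]
    · rw [hκ1]; ext e f
      rw [Matrix.diagonal_mul, Matrix.mul_diagonal]
      by_cases hef : blk e = blk f
      · rw [hef, mul_comm]
      · simp [hx e f hef]
  · intro d x b η hd hx hη hY
    set Y : K → A := fun i => phi (rst (fun a => blk a = i) v) x - phi (rst (fun a => blk a = i) v) d * b
    have hbd : BD blk (κ 1 * x - d * κ b) := by
      intro e f hef
      rw [Matrix.sub_apply, ((hκbd 1).mul hx) e f hef, (hd.mul (hκbd b)) e f hef, sub_zero]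
    refine bd_norm hbd (by positivity) fun i p q => ?_
    have hent : ∀ e f, blk e = i → blk f = i → good i → (κ 1 * x - d * κ b) e f = 
        ((τ i)⁻¹ : ℂ) * ω i (star (v e) * Y i * v f * c i) := by
      intro e f he hf hg
      have y1 : star (v e) * Y i * v f * c i = x e f • (c i * c i * c i) - 
          ∑ a, d e a • (if blk a = i then c i * star (v a) * b * v f * c i else 0) := by
        simp only [Y]
        rw [mul_sub, ← mul_assoc, star_mul_phi c hc he, star_mul_phi c hc he, sub_mul, sub_mul]
        congr 1
        · rw [Finset.sum_mul, Finset.sum_mul, Finset.sum_eq_single f]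
          · rw [smul_mul_assoc, smul_mul_assoc, rst_pos (p := fun a => blk a = i) hf, mul_assoc (c i), hc f f rfl, if_pos rfl, hf]
          · intro a _ haf
            rw [smul_mul_assoc, smul_mul_assoc]
            by_cases ha : blk a = i
            · rw [rst_pos (p := fun a => blk a = i) ha, mul_assoc (c i), hc a f (ha.trans hf.symm), if_neg haf]; simp
            · rw [rst_neg (p := fun a => blk a = i) ha]; simp
          · simp
        · rw [Finset.sum_mul, Finset.sum_mul, Finset.sum_mul]
          refine Finset.sum_congr rfl fun a _ => ?_
          rw [smul_mul_assoc, smul_mul_assoc, smul_mul_assoc]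
          by_cases ha : blk a = i
          · rw [rst_pos (p := fun a => blk a = i) ha, if_pos ha]
          · rw [rst_neg (p := fun a => blk a = i) ha, if_neg ha]; simp
      rw [y1, map_sub, map_smul, hω3, map_sum, mul_sub, Matrix.sub_apply, hκ1, Matrix.diagonal_mul, he, if_pos hg, one_mul]
      have ht := hτ0 i hg
      have ht' : (τ i : ℂ) ≠ 0 := by exact_mod_cast ht.ne'
      congr 1
      · change x e f = (τ i : ℂ)⁻¹ * (x e f * (τ i : ℂ))
        field_simp
      · rw [Matrix.mul_apply, Finset.mul_sum]
        refine Finset.sum_congr rfl fun a _ => ?_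
        rw [map_smul, hκ, smul_eq_mul]
        by_cases ha : blk a = i
        · simp only [ha, hf, hg, and_self, if_true]; ring
        · rw [hd e a (fun h => ha (h.symm.trans he))]; simp
    by_cases hg : good i
    · have e1 : ∑ e, ∑ f, star (if blk e = i then p e else 0) * (κ 1 * x - d * κ b) e f * (if blk f = i then q f else 0) = 
          ((τ i)⁻¹ : ℂ) * ω i (star (∑ e, (if blk e = i then p e else 0) • v e) * Y i * (∑ f, (if blk f = i then q f else 0) • v f) * c i) := by
        simp only [star_sum, Finset.sum_mul, Finset.mul_sum, map_sum]
        rw [Finset.sum_comm]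
        refine Finset.sum_congr rfl fun e _ => Finset.sum_congr rfl fun f _ => ?_
        by_cases hf : blk f = i
        · by_cases he : blk e = i
          · rw [hent f e hf he hg]
            simp only [he, hf, if_true, star_smul, smul_mul_assoc, mul_smul_comm, map_smul, smul_eq_mul]
            ring
          · simp [he]
        · simp [hf]
      rw [e1, norm_mul, norm_inv, Complex.norm_real, Real.norm_of_nonneg (norm_nonneg _)]
      have b1 := comb_norm c hc hc1 i p
      have b2 := comb_norm c hc hc1 i q
      have b3 := hω2 i (star (∑ e, (if blk e = i then p e else 0) • v e) * Y i * (∑ f, (if blk f = i then q f else 0) • v f) * c i)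
      have b4 : ‖star (∑ e, (if blk e = i then p e else 0) • v e) * Y i * (∑ f, (if blk f = i then q f else 0) • v f) * c i‖ ≤ 
          √(∑ e, if blk e = i then ‖p e‖ ^ 2 else 0) * η * √(∑ e, if blk e = i then ‖q e‖ ^ 2 else 0) * 1 := by
        refine (norm_mul_le _ _).trans (mul_le_mul ?_ (hc1 i) (norm_nonneg _) (by positivity))
        refine (norm_mul_le _ _).trans (mul_le_mul ?_ b2 (norm_nonneg _) (by positivity))
        refine (norm_mul_le _ _).trans (mul_le_mul ?_ (hY i) (norm_nonneg _) (by positivity))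
        rw [norm_star]; exact b1
      have b5 : (τ i)⁻¹ ≤ (δ ^ 3)⁻¹ := inv_anti₀ (by positivity) (hτ i hg)
      calc _ ≤ (δ ^ 3)⁻¹ * (√(∑ e, if blk e = i then ‖p e‖ ^ 2 else 0) * η * √(∑ e, if blk e = i then ‖q e‖ ^ 2 else 0) * 1) :=
            mul_le_mul b5 (b3.trans b4) (norm_nonneg _) (by positivity)
        _ = _ := by ring
    · have e1 : ∑ e, ∑ f, star (if blk e = i then p e else 0) * (κ 1 * x - d * κ b) e f * (if blk f = i then q f else 0) = 0 := by
        refine Finset.sum_eq_zero fun e _ => Finset.sum_eq_zero fun f _ => ?_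
        by_cases he : blk e = i
        · have : (κ 1 * x - d * κ b) e f = 0 := by
            rw [Matrix.sub_apply, hκ1, Matrix.diagonal_mul, he, if_neg hg, zero_mul, Matrix.mul_apply, zero_sub, neg_eq_zero]
            refine Finset.sum_eq_zero fun a _ => ?_
            by_cases ha : blk a = i
            · rw [hκ, ha, if_neg (fun h => hg h.2), mul_zero]
            · rw [hd e a (fun h => ha (h.symm.trans he)), zero_mul]
          rw [this]; simp
        · simp [he]
      rw [e1, norm_zero]; positivity
end rows
end

section

lemma rowND_of_starND {n : ℕ} {A : Type} [CStarAlgebra A] (h : StarND n A) : RowND n A := by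
  letI := CStarAlgebra.spectralOrder A
  letI := CStarAlgebra.spectralOrderedRing A
  intro S ε hε
  set R : ℝ := 1 + ∑ b ∈ S, ‖b‖ with hR
  have hR0 : 0 < R := by have := Finset.sum_nonneg (fun b (_ : b ∈ S) => norm_nonneg b); linarith
  have hbR : ∀ b ∈ S, ‖b‖ ≤ R := fun b hb => by
    have := Finset.single_le_sum (fun b (_ : b ∈ S) => norm_nonneg b) hb; linarith
  have hn : (0:ℝ) < n + 1 := by positivity
  obtain ⟨δ, hδ, hδe⟩ : ∃ δ : ℝ, 0 < δ ∧ (n + 1) * δ * R = ε / 8 :=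
    ⟨ε / (8 * (n + 1) * R), by positivity, by field_simp⟩
  set C := (comm_sqrt hδ).choose with hC
  have hC0 : 0 ≤ C := (comm_sqrt hδ).choose_spec.1
  obtain ⟨η, hη, hη1, hη2⟩ : ∃ η : ℝ, 0 < η ∧ η ≤ ε / 8 ∧ (n + 1) * ((2 * C + 1) * (η / δ ^ 3)) ≤ ε / 4 := by
    refine ⟨min (ε / 8) (δ ^ 3 * ε / (4 * (n + 1) * (2 * C + 1))), lt_min (by positivity) (by positivity),
      min_le_left _ _, ?_⟩
    have := min_le_right (ε / 8) (δ ^ 3 * ε / (4 * (n + 1) * (2 * C + 1)))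
    calc _ ≤ ((n:ℝ) + 1) * ((2 * C + 1) * ((δ ^ 3 * ε / (4 * (n + 1) * (2 * C + 1))) / δ ^ 3)) := by gcongr
      _ = ε / 4 := by field_simp
  obtain ⟨N, K, _, _, _, _, blk, J, v, d, hat, hv, hdB, hd, hd1, hS⟩ := h S η hη
  obtain ⟨good, κ, hg, hκ, hκB, hκ1, hκx, hκd⟩ := exists_kappa hv hδ
  obtain ⟨hs1, hs2, hs3⟩ := sqrt_psd hd
  set s := cfcR Real.sqrt d with hs
  have hsn : ‖s‖ ≤ 1 := by
    have h1 := Matrix.l2_opNorm_conjTranspose_mul_self s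
    rw [hs1, hs2] at h1
    nlinarith [norm_nonneg s]
  have hsB : BD blk s := hdB.cfcR _
  let ψ : A →ₗ[ℂ] Matrix N N ℂ :=
    { toFun := fun b => s * κ b * s
      map_add' := fun x y => by rw [map_add, mul_add, add_mul]
      map_smul' := fun c x => by rw [map_smul, mul_smul_comm, smul_mul_assoc]; rfl }
  have hψ : ∀ b, ψ b = s * κ b * s := fun _ => rfl
  have hψc : CPm ψ := hκ.conj s (fun b => by rw [hψ, hs1])
  have hκc := hκ.contr hκ1
  have hψ1 : ‖ψ 1‖ ≤ 1 := by
    rw [hψ]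
    calc _ ≤ ‖s‖ * ‖κ 1‖ * ‖s‖ := (norm_mul_le _ _).trans (by gcongr; exact norm_mul_le _ _)
      _ ≤ 1 * 1 * 1 := by gcongr
      _ = 1 := by norm_num
  refine ⟨N, K, inferInstance, inferInstance, inferInstance, inferInstance, blk, J, v, ψ, hv, fun b => (hsB.mul (hκB b)).mul hsB, hψc, hψc.contr hψ1, ?_⟩
  intro b hb
  obtain ⟨hxB, hx1, hx2⟩ := hS b hb
  set x := hat b with hx
  have hL := hκd d x b η hdB hxB hη.le (fun i => (hx2 (fun k => k = i)).1.le)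
  have hxB' : BD blk x.conjTranspose := fun a c hac => by
    rw [Matrix.conjTranspose_apply, hxB c a (Ne.symm hac), star_zero]
  have hR' : ‖κ 1 * x - κ b * d‖ ≤ η / δ ^ 3 := by
    have h1 := hκd d x.conjTranspose (star b) η hdB hxB' hη.le (fun i => by
      have h2 := (hx2 (fun k => k = i)).2.le
      rw [← norm_star, star_sub, star_mul] at h2
      have h3 : ∀ (w : N → A) (y : Matrix N N ℂ), star (phi w y) = phi w y.conjTranspose := fun w y => star_phi2 w w y
      rwa [h3, h3, hd.1.eq] at h2)
    rw [← Matrix.l2_opNorm_conjTranspose, Matrix.conjTranspose_sub, Matrix.conjTranspose_mul, Matrix.conjTranspose_mul,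
      hκ.map_star, hd.1.eq, Matrix.conjTranspose_conjTranspose, Matrix.conjTranspose_conjTranspose,
      hκ.psd_one.1.eq, ← (hκx x hxB).2] at h1
    exact h1
  have hcomm : ‖κ b * d - d * κ b‖ ≤ 2 * (η / δ ^ 3) := by
    have : κ b * d - d * κ b = (κ 1 * x - d * κ b) - (κ 1 * x - κ b * d) := by abel
    rw [this]; exact (norm_sub_le _ _).trans (by linarith)
  have hk := hs3 δ hδ hd1 (κ b)
  have hkb := (hκc b).trans (hbR b hb)
  have h1 : ‖ψ b - κ 1 * x‖ ≤ δ * R + (2 * C + 1) * (η / δ ^ 3) := by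
    have e : ψ b - κ 1 * x = s * (κ b * s - s * κ b) - (κ 1 * x - d * κ b) := by
      rw [hψ, mul_sub, ← mul_assoc, ← mul_assoc, hs2]; abel
    rw [e]
    have h2 : ‖s * (κ b * s - s * κ b)‖ ≤ 1 * (δ * R + C * (2 * (η / δ ^ 3))) :=
      (norm_mul_le _ _).trans (by gcongr; exact hk.trans (by gcongr))
    exact (norm_sub_le _ _).trans (by linarith)
  have hpB : BD blk (ψ b - κ 1 * x) := BD.sub ((hsB.mul (hκB b)).mul hsB) ((hκB 1).mul hxB)
  have h2 := phi_row_le hv zero_le_one hv.nrm_sq hpB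
  have h3 := phi_split good v hxB
  have hbad := hv.restr (fun k => ¬ good k)
  have h4 := phi_row_le hbad hδ.le (fun a => by
    by_cases ha : good (blk a)
    · rw [rst_neg (p := fun a => ¬ good (blk a)) (not_not.2 ha)]; simpa using hδ.le
    · rw [rst_pos (p := fun a => ¬ good (blk a)) ha]; exact hg a ha) hdB
  have h5 := (hx2 (fun k => ¬ good k)).1
  have h6 : ‖phi (rst (fun a => ¬ good (blk a)) v) x‖ ≤ η + (n + 1) * δ * R := by
    have e : phi (rst (fun a => ¬ good (blk a)) v) x =
      (phi (rst (fun a => ¬ good (blk a)) v) x - phi (rst (fun a => ¬ good (blk a)) v) d * b) +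
        phi (rst (fun a => ¬ good (blk a)) v) d * b := by abel
    rw [e]
    refine (norm_add_le _ _).trans (add_le_add h5.le ((norm_mul_le _ _).trans ?_))
    calc _ ≤ ((n + 1) * δ * ‖d‖) * ‖b‖ := by gcongr
      _ ≤ ((n + 1) * δ * 1) * R := by gcongr; exact hbR b hb
      _ = _ := by ring
  have e : phi v (ψ b) - b = phi v (ψ b - κ 1 * x) - phi (rst (fun a => ¬ good (blk a)) v) x + (phi v x - b) := by
    rw [map_sub, (hκx x hxB).1, h3]; abel
  rw [e]
  have h7 : (n + 1) * 1 * ‖ψ b - κ 1 * x‖ ≤ (n+1) * δ * R + ε / 4 := by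
    calc _ ≤ ((n:ℝ) + 1) * 1 * (δ * R + (2 * C + 1) * (η / δ ^ 3)) := by gcongr
      _ ≤ _ := by linarith
  calc _ ≤ ‖phi v (ψ b - κ 1 * x)‖ + ‖phi (rst (fun a => ¬ good (blk a)) v) x‖ + ‖phi v x - b‖ :=
        (norm_add_le _ _).trans (add_le_add (norm_sub_le _ _) le_rfl)
    _ < ε := by linarith
end

section

lemma spec_ex {N : Type} [Fintype N] [DecidableEq N] {d : Matrix N N ℂ} (hd : d.PosSemidef) :
    ∃ (U : Matrix N N ℂ) (l : N → ℝ), (∀ c, 0 ≤ l c) ∧ U.conjTranspose * U = 1 ∧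
      d * U = U * Matrix.diagonal (fun c => (l c : ℂ)) ∧ d = U * Matrix.diagonal (fun c => (l c : ℂ)) * U.conjTranspose := by
  have h2 : (hd.1.eigenvectorUnitary : Matrix N N ℂ).conjTranspose * (hd.1.eigenvectorUnitary : Matrix N N ℂ) = 1 :=
    Unitary.coe_star_mul_self hd.1.eigenvectorUnitary
  have h1 : d = (hd.1.eigenvectorUnitary : Matrix N N ℂ) * Matrix.diagonal (fun c => (hd.1.eigenvalues c : ℂ)) *
    (hd.1.eigenvectorUnitary : Matrix N N ℂ).conjTranspose := hd.1.spectral_theorem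
  refine ⟨hd.1.eigenvectorUnitary, hd.1.eigenvalues, fun c => hd.eigenvalues_nonneg c, h2, ?_, h1⟩
  have := congrArg (· * (hd.1.eigenvectorUnitary : Matrix N N ℂ)) h1
  simpa only [mul_assoc, h2, mul_one] using this

lemma diag_ex {N K : Type} [Fintype N] [DecidableEq N] [Fintype K] [DecidableEq K] {blk : N → K}
    {d : Matrix N N ℂ} (hd : d.PosSemidef) (hB : BD blk d) :
    ∃ (M : Type) (_ : Fintype M) (_ : DecidableEq M) (blk' : M → K) (W : Matrix N M ℂ) (l : M → ℝ),
      (∀ c, 0 ≤ l c) ∧ (∀ a c, blk a ≠ blk' c → W a c = 0) ∧ W.conjTranspose * W = 1 ∧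
      d = W * Matrix.diagonal (fun c => (l c : ℂ)) * W.conjTranspose := by
  classical
  let P : K → Matrix N N ℂ := fun k => Matrix.diagonal fun a => if blk a = k then 1 else 0
  have hP : ∀ k, (P k).conjTranspose = P k := fun k => by
    simp only [P, Matrix.diagonal_conjTranspose]; congr 1; funext a; simp only [Pi.star_apply]; split_ifs <;> simp
  have hk : ∀ k, (P k * d * P k).PosSemidef := fun k => by
    have := hd.conjTranspose_mul_mul_same (P k); rwa [hP] at this
  choose U l hl hU1 hU2 hU3 using fun k => spec_ex (hk k)
  have hPd : ∀ k a b, (P k * d * P k) a b = if blk a = k ∧ blk b = k then d a b else 0 := fun k a b => by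
    simp only [P, Matrix.mul_diagonal, Matrix.diagonal_mul]; split_ifs <;> simp_all
  have hz : ∀ k c a, l k c ≠ 0 → blk a ≠ k → U k a c = 0 := fun k c a hlc ha => by
    have h1 := congrFun (congrFun (hU2 k) a) c
    rw [Matrix.mul_diagonal, Matrix.mul_apply, Finset.sum_eq_zero (fun b _ => by rw [hPd, if_neg (fun h => ha h.1), zero_mul])] at h1
    rcases mul_eq_zero.1 h1.symm with h | h
    · exact h
    · exact absurd (Complex.ofReal_eq_zero.1 h) hlc
  refine ⟨{q : K × N // l q.1 q.2 ≠ 0}, inferInstance, inferInstance, fun q => q.1.1, Matrix.of fun a q => U q.1.1 a q.1.2,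
    fun q => l q.1.1 q.1.2, fun q => hl _ _, fun a q h => hz _ _ _ q.2 h, ?_, ?_⟩
  · ext ⟨⟨k, c⟩, hq⟩ ⟨⟨k', c'⟩, hq'⟩
    rw [Matrix.mul_apply]
    simp only [Matrix.conjTranspose_apply, Matrix.of_apply]
    by_cases hkk : k = k'
    · subst hkk
      have := congrFun (congrFun (hU1 k) c) c'
      rw [Matrix.mul_apply] at this
      simp only [Matrix.conjTranspose_apply] at this
      rw [this]
      simp [Matrix.one_apply]
    · rw [Matrix.one_apply_ne (by simp [hkk])]
      refine Finset.sum_eq_zero fun a _ => ?_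
      by_cases ha : blk a = k
      · rw [hz k' c' a hq' (fun h => hkk (ha.symm.trans h)), mul_zero]
      · rw [hz k c a hq ha, star_zero, zero_mul]
  · ext a b
    rw [Matrix.mul_apply]
    simp only [Matrix.mul_diagonal, Matrix.conjTranspose_apply, Matrix.of_apply]
    have e1 : d a b = ∑ k, (P k * d * P k) a b := by
      simp only [hPd]
      rw [Finset.sum_eq_single (blk a) (fun k _ h => if_neg fun h' => h h'.1.symm) (by simp)]
      split_ifs with h
      · rfl
      · exact hB a b fun h' => h ⟨rfl, h'.symm⟩
    have e2 : ∀ k, (P k * d * P k) a b = ∑ c, U k a c * l k c * star (U k b c) := fun k => by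
      rw [hU3 k, Matrix.mul_apply]; simp only [Matrix.mul_diagonal, Matrix.conjTranspose_apply]
    rw [e1, Finset.sum_congr rfl (fun k _ => e2 k), ← Fintype.sum_prod_type' (f := fun k c => U k a c * l k c * star (U k b c))]
    rw [← Finset.sum_filter_of_ne (p := fun q : K × N => l q.1 q.2 ≠ 0) (fun q _ h h' => h (by rw [h']; simp))]
    exact Finset.sum_subtype _ (by simp) _

end

section

section corner
variable {A N K M : Type} [CStarAlgebra A] [Fintype N] [DecidableEq N] [Fintype K] [DecidableEq K]
  [Fintype M] [DecidableEq M] {n : ℕ} {blk : N → K} {J : K → Fin (n + 1)}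

lemma phi_V (v : N → A) (V : Matrix N M ℂ) (x : Matrix M M ℂ) :
    phi v (V * x * V.conjTranspose) = phi (fun i => ∑ a, V a i • v a) x := by
  rw [phi_apply, phi_apply]
  simp only [star_sum, Finset.sum_mul, Finset.mul_sum, Finset.smul_sum, star_smul, smul_mul_smul_comm, smul_smul,
    Matrix.mul_apply, Matrix.conjTranspose_apply, Finset.sum_smul]
  calc _ = ∑ a, ∑ b, ∑ j, ∑ i, (x i j * (V a i * star (V b j))) • (v a * star (v b)) := by
        refine Finset.sum_congr rfl fun a _ => Finset.sum_congr rfl fun b _ => Finset.sum_congr rfl fun j _ =>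
          Finset.sum_congr rfl fun i _ => ?_
        congr 1; ring
    _ = ∑ j, ∑ i, ∑ a, ∑ b, (x i j * (V a i * star (V b j))) • (v a * star (v b)) := by
        rw [Finset.sum_congr rfl fun a _ => Finset.sum_comm (s := (Finset.univ : Finset N)), Finset.sum_comm]
        refine Finset.sum_congr rfl fun j _ => ?_
        rw [Finset.sum_congr rfl fun a _ => Finset.sum_comm (s := (Finset.univ : Finset N)), Finset.sum_comm]
    _ = _ := by
        rw [Finset.sum_comm]
        refine Finset.sum_congr rfl fun i _ => Finset.sum_congr rfl fun j _ => ?_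
        first | rfl | (rw [Finset.sum_comm])

lemma IsRow.conjV {v : N → A} (h : IsRow blk J v) {blk' : M → K} {V : Matrix N M ℂ}
    (hV : ∀ a c, blk a ≠ blk' c → V a c = 0) (hV1 : V.conjTranspose * V = 1) :
    IsRow blk' J (fun i => ∑ a, V a i • v a) := by
  letI := CStarAlgebra.spectralOrder A
  letI := CStarAlgebra.spectralOrderedRing A
  obtain ⟨c, hc, -, hc1⟩ := exists_blockc h
  have key : ∀ i j, J (blk' i) = J (blk' j) → star (∑ a, V a i • v a) * (∑ a, V a j • v a) =
      if i = j then c (blk' i) else 0 := by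
    intro i j hij
    have e : star (∑ a, V a i • v a) * (∑ a, V a j • v a) = ((V.conjTranspose * V) i j) • c (blk' i) := by
      rw [Matrix.mul_apply, Finset.sum_smul, star_sum, Finset.sum_mul]
      refine Finset.sum_congr rfl fun a _ => ?_
      rw [Finset.mul_sum, Matrix.conjTranspose_apply]
      by_cases ha : blk a = blk' i
      · rw [Finset.sum_eq_single a]
        · rw [star_smul, smul_mul_smul_comm, hc a a rfl, if_pos rfl, ha]
        · intro b _ hb
          by_cases hb' : blk b = blk' j
          · rw [star_smul, smul_mul_smul_comm, h.off a b (Ne.symm hb) (by rw [ha, hb', hij]), smul_zero]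
          · rw [hV b j hb', zero_smul, mul_zero]
        · simp
      · rw [hV a i ha]; simp
    rw [e, hV1, Matrix.one_apply]
    split_ifs <;> simp
  refine ⟨fun i j hij => ?_, fun i j hij hJ => ?_, fun i => ?_⟩
  · rw [key i i rfl, key j j rfl, if_pos rfl, if_pos rfl, hij]
  · rw [key i j hJ, if_neg hij]
  · refine cs_norm_sq_le zero_le_one ?_
    rw [key i i rfl, if_pos rfl, one_pow]; exact hc1 _

lemma psi_cut {ψ : A →ₗ[ℂ] Matrix N N ℂ} (h : CPm ψ) (h1 : ∀ b, ‖ψ b‖ ≤ ‖b‖) {p b : A} (hp : star p = p)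
    (hpp : p * p = p) (hb : p * b = b) {Q : Matrix N N ℂ} {δ : ℝ} 
    (hQ : ‖Q * ψ p * Q.conjTranspose‖ ≤ δ) : ‖Q * ψ b‖ ≤ √δ * ‖b‖ := by
  obtain ⟨B, hB⟩ := h.factor (T := Bool) (fun t => cond t p b)
  have e1 := hB true true
  have e2 := hB true false
  have e3 := hB false false
  simp only [cond_true, cond_false, hp, hpp, hb] at e1 e2 e3
  have n1 : ‖Q * (B true).conjTranspose‖ ^ 2 ≤ δ := by
    rw [← Matrix.l2_opNorm_conjTranspose, pow_two, ← Matrix.l2_opNorm_conjTranspose_mul_self, Matrix.conjTranspose_conjTranspose,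
      Matrix.conjTranspose_mul, Matrix.conjTranspose_conjTranspose]
    have : Q * (B true).conjTranspose * (B true * Q.conjTranspose) = Q * ψ p * Q.conjTranspose := by
      rw [e1]; simp only [Matrix.mul_assoc]
    rwa [this]
  have n2 : ‖B false‖ ≤ ‖b‖ := by
    have : ‖B false‖ * ‖B false‖ ≤ ‖b‖ * ‖b‖ := by
      rw [← Matrix.l2_opNorm_conjTranspose_mul_self, ← e3, ← CStarRing.norm_star_mul_self]; exact h1 _
    nlinarith [norm_nonneg b, norm_nonneg (B false)]
  rw [e2, ← Matrix.mul_assoc]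
  exact (Matrix.l2_opNorm_mul _ _).trans (mul_le_mul (Real.le_sqrt_of_sq_le n1) n2 (norm_nonneg _) (Real.sqrt_nonneg _))

lemma rowM_phi_one [PartialOrder A] [StarOrderedRing A] (z : N → A) : ‖rowM z‖ ^ 2 ≤ ‖phi z 1‖ := by
  have e : rowM z * star (rowM z) = diagM (fun o => o.elim (phi z 1) (fun _ => 0)) := by
    ext i j
    rw [diagM_apply, CStarMatrix.mul_apply]
    simp only [CStarMatrix.star_apply]
    have hn : ∀ (a : N) k, rowM z (some a) k = 0 := fun a k => rfl
    rcases i with _ | i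
    · rcases j with _ | j
      · rw [if_pos rfl, Fintype.sum_option, phi_apply]
        have h0 : rowM z none none = 0 := rfl
        have h1 : ∀ a, rowM z none (some a) = z a := fun a => rfl
        simp [h0, h1, Matrix.one_apply, ite_smul]
      · simp [hn]
    · rw [Finset.sum_eq_zero (fun k _ => by rw [hn, zero_mul])]; split_ifs <;> simp
  rw [pow_two, ← CStarRing.norm_self_mul_star, e]
  refine (NonUnitalStarAlgHom.norm_apply_le (diagM : (Option N → A) →⋆ₐ[ℂ] BigM N A) _).trans ?_
  rw [pi_norm_le_iff_of_nonneg (norm_nonneg _)]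
  rintro (_ | i) <;> simp

lemma row_corner [PartialOrder A] [StarOrderedRing A] {v : N → A} (h : IsRow blk J v) {p : A} (hp : star p = p)
    (hpv : ∀ a, p * v a = v a) {δ : ℝ} (hδ : 0 < δ) (hδ1 : δ ≤ 1) :
    ∃ w : N → A, IsRow blk J w ∧ (∀ a, p * w a * p = w a) ∧ ∀ x, BD blk x → ‖phi w x - phi v x‖ ≤ (n + 1) * δ * ‖x‖ := by
  obtain ⟨c, hc, hc0, hc1⟩ := exists_blockc h
  have hc0' : ∀ i, 0 ≤ c i := fun i => by obtain ⟨x, hx⟩ := hc0 i; rw [hx]; exact star_mul_self_nonneg x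
  choose k k1 k2 k3 k4 _ using fun i => k_props (hc0' i) hδ
  have kc : ∀ i, k i * c i * k i = k i * k i * c i := fun i => by
    rw [mul_assoc, ((k2 i) _ (Commute.refl (c i))).eq.symm, mul_assoc]
  have hvv : ∀ a, star (v a) * v a = c (blk a) := fun a => by rw [hc a a rfl, if_pos rfl]
  have hex : ∀ a, ∃ b, blk b = blk a := fun a => ⟨a, rfl⟩
  let o : N → N := fun a => (hex a).choose
  have ho : ∀ a, blk (o a) = blk a := fun a => (hex a).choose_spec
  have ho2 : ∀ a b, blk a = blk b → o a = o b := fun a b hab => by simp only [o, hab]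
  have hww : ∀ a b, star (v a * k (blk a) * star (v (o a))) * (v b * k (blk b) * star (v (o b))) =
      v (o a) * (k (blk a) * (star (v a) * v b) * k (blk b)) * star (v (o b)) := fun a b => by
    simp only [star_mul, star_star, k1, mul_assoc]
  have hgg : ∀ a b, star (((√δ : ℝ) : ℂ) • (v a * k (blk a))) * (((√δ : ℝ) : ℂ) • (v b * k (blk b))) =
      (δ : ℂ) • (k (blk a) * (star (v a) * v b) * k (blk b)) := fun a b => by
    rw [star_smul, smul_mul_smul_comm]
    congr 1
    · simp only [Complex.star_def, Complex.conj_ofReal]; rw [← Complex.ofReal_mul, Real.mul_self_sqrt hδ.le]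
    · simp only [star_mul, k1, mul_assoc]
  have hgn : ∀ a, ‖star (((√δ : ℝ) : ℂ) • (v a * k (blk a))) * (((√δ : ℝ) : ℂ) • (v a * k (blk a)))‖ ≤ δ := fun a => by
    rw [hgg, hvv, kc, norm_smul, Complex.norm_real, Real.norm_of_nonneg hδ.le]
    nlinarith [k3 (blk a)]
  have hg : IsRow blk J (fun a => ((√δ : ℝ) : ℂ) • (v a * k (blk a))) := by
    refine ⟨fun a b hab => ?_, fun a b hab hJ => ?_, fun a => ?_⟩
    · rw [hgg, hgg, hvv, hvv, hab]
    · rw [hgg, h.off a b hab hJ]; simp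
    · exact cs_norm_sq_le zero_le_one (by rw [one_pow]; exact (hgn a).trans hδ1)
  refine ⟨fun a => v a * k (blk a) * star (v (o a)), ⟨fun a b hab => ?_, fun a b hab hJ => ?_, fun a => ?_⟩, fun a => ?_, fun x hx => ?_⟩
  · rw [hww, hww, hvv, hvv, ho2 a b hab, hab]
  · rw [hww, h.off a b hab hJ]; simp
  · refine cs_norm_sq_le zero_le_one ?_
    rw [hww, hvv, kc, one_pow]
    have h1 := h.nrm (o a)
    calc _ ≤ ‖v (o a)‖ * ‖k (blk a) * k (blk a) * c (blk a)‖ * ‖star (v (o a))‖ := (norm_mul_le _ _).trans (by gcongr; exact norm_mul_le _ _)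
      _ ≤ 1 * 1 * 1 := by rw [norm_star]; gcongr; exact k3 _
      _ = 1 := by norm_num
  · have : star (v (o a)) * p = star (v (o a)) := by rw [← hp, ← star_mul, hpv]
    rw [mul_assoc, mul_assoc (v a * _), this, mul_assoc (v a), ← mul_assoc p, hpv]
    simp only [mul_assoc]
  · have e : phi (fun a => v a * k (blk a) * star (v (o a))) x - phi v x = - phi (fun a => ((√δ : ℝ) : ℂ) • (v a * k (blk a))) x := by
      rw [sub_eq_iff_eq_add, phi_apply, phi_apply, phi_apply, ← Finset.sum_neg_distrib, ← Finset.sum_add_distrib]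
      refine Finset.sum_congr rfl fun a _ => ?_
      rw [← Finset.sum_neg_distrib, ← Finset.sum_add_distrib]
      refine Finset.sum_congr rfl fun b _ => ?_
      by_cases hab : blk a = blk b
      · rw [← smul_neg, ← smul_add]; congr 1
        have e1 : v a * k (blk a) * star (v (o a)) * star (v b * k (blk b) * star (v (o b))) = v a * (k (blk a) * k (blk a) * c (blk a)) * star (v b) := by
          rw [← kc, ← ho a, ← hvv (o a), ho a, ← ho2 a b hab, ← hab]
          simp only [star_mul, star_star, k1, mul_assoc]
        have e2 : (((√δ : ℝ) : ℂ) • (v a * k (blk a))) * star (((√δ : ℝ) : ℂ) • (v b * k (blk b))) = v a * (δ • (k (blk a) * k (blk a))) * star (v b) := by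
          rw [star_smul, smul_mul_smul_comm, RCLike.real_smul_eq_coe_smul (K := ℂ), mul_smul_comm, smul_mul_assoc, ← hab]
          congr 1
          · simp only [Complex.star_def, Complex.conj_ofReal]; rw [← Complex.ofReal_mul, Real.mul_self_sqrt hδ.le]; rfl
          · simp only [star_mul, k1, mul_assoc]
        rw [e1, e2, ← k4]; noncomm_ring
      · rw [hx a b hab]; simp
    rw [e, norm_neg]
    exact phi_row_le hg hδ.le hgn hx
end corner
end

section

lemma iso_norm {N M : Type} [Fintype N] [DecidableEq N] [Fintype M] [DecidableEq M] {V : Matrix N M ℂ}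
    (h : V.conjTranspose * V = 1) : ‖V‖ ≤ 1 := by
  have h1 := Matrix.l2_opNorm_conjTranspose_mul_self V
  rw [h] at h1
  have h2 := norm_one_le' (Matrix M M ℂ)
  nlinarith [norm_nonneg V]

lemma cut_ex {N K : Type} [Fintype N] [DecidableEq N] [Fintype K] [DecidableEq K] {blk : N → K}
    {d : Matrix N N ℂ} (hd : d.PosSemidef) (hB : BD blk d) {δ : ℝ} (hδ : 0 < δ) :
    ∃ (M : Type) (_ : Fintype M) (_ : DecidableEq M) (blk' : M → K) (V : Matrix N M ℂ),
      (∀ a c, blk a ≠ blk' c → V a c = 0) ∧ V.conjTranspose * V = 1 ∧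
      ‖(1 - V * V.conjTranspose) * d * (1 - V * V.conjTranspose).conjTranspose‖ ≤ δ ∧
      (d - (δ : ℂ) • (V * V.conjTranspose)).PosSemidef := by
  classical
  obtain ⟨M, _, _, blk', W, l, hl, hW, hW1, hd'⟩ := diag_ex hd hB
  have hWn := iso_norm hW1
  let V : Matrix N {c : M // δ ≤ l c} ℂ := Matrix.of fun a c => W a c.1
  let g : Matrix M M ℂ := Matrix.diagonal fun c => if δ ≤ l c then 1 else 0
  have hVV : V * V.conjTranspose = W * g * W.conjTranspose := by
    ext a b
    simp only [Matrix.mul_apply (M := V), Matrix.mul_apply (M := W * g), g, Matrix.mul_diagonal, Matrix.conjTranspose_apply, V, Matrix.of_apply]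
    simp only [mul_ite, mul_one, mul_zero, ite_mul, zero_mul]
    rw [← Finset.sum_filter]
    exact (Finset.sum_subtype _ (by simp) (fun c => W a c * star (W b c))).symm
  have hQW : (1 - V * V.conjTranspose) * W = W * (1 - g) := by
    rw [hVV, Matrix.sub_mul, Matrix.mul_assoc (W * g), hW1, Matrix.mul_one, Matrix.one_mul, Matrix.mul_sub, Matrix.mul_one]
  refine ⟨{c : M // δ ≤ l c}, inferInstance, inferInstance, fun c => blk' c.1, V, fun a c h => hW a c.1 h, ?_, ?_, ?_⟩
  · ext i j
    have := congrFun (congrFun hW1 i.1) j.1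
    rw [Matrix.mul_apply] at this ⊢
    simp only [Matrix.conjTranspose_apply, V, Matrix.of_apply] at this ⊢
    rw [this, Matrix.one_apply, Matrix.one_apply]; simp [Subtype.ext_iff]
  · have e : (1 - V * V.conjTranspose) * d * (1 - V * V.conjTranspose).conjTranspose = 
        W * ((1 - g) * Matrix.diagonal (fun c => (l c : ℂ)) * (1 - g).conjTranspose) * W.conjTranspose := by
      have h1 := congrArg Matrix.conjTranspose hQW
      rw [Matrix.conjTranspose_mul, Matrix.conjTranspose_mul] at h1
      generalize 1 - V * V.conjTranspose = Q at h1 hQW ⊢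
      generalize Matrix.diagonal (fun c => (l c : ℂ)) = L at hd' ⊢
      rw [hd', ← Matrix.mul_assoc, ← Matrix.mul_assoc, hQW, Matrix.mul_assoc _ W.conjTranspose, h1]
      simp only [Matrix.mul_assoc]
    have hg : (1 - g) * Matrix.diagonal (fun c => (l c : ℂ)) * (1 - g).conjTranspose = 
        Matrix.diagonal (fun c => if δ ≤ l c then 0 else (l c : ℂ)) := by
      have : 1 - g = Matrix.diagonal (fun c => if δ ≤ l c then 0 else 1) := by
        simp only [g, ← Matrix.diagonal_one, Matrix.diagonal_sub]; congr 1; funext c; split_ifs <;> simp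
      rw [this, Matrix.diagonal_conjTranspose, Matrix.diagonal_mul_diagonal, Matrix.diagonal_mul_diagonal]
      congr 1; funext c; simp only [Pi.star_apply]; split_ifs <;> simp
    have hgn : ‖Matrix.diagonal (fun c => if δ ≤ l c then 0 else (l c : ℂ))‖ ≤ δ := by
      rw [Matrix.l2_opNorm_diagonal, pi_norm_le_iff_of_nonneg hδ.le]
      intro c
      split_ifs with h
      · simpa using hδ.le
      · rw [Complex.norm_real, Real.norm_of_nonneg (hl c)]; exact (not_le.1 h).le
    rw [e, hg]
    calc _ ≤ ‖W‖ * ‖Matrix.diagonal (fun c => if δ ≤ l c then 0 else (l c : ℂ))‖ * ‖W.conjTranspose‖ := 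
          (Matrix.l2_opNorm_mul _ _).trans (by gcongr; exact Matrix.l2_opNorm_mul _ _)
      _ ≤ 1 * δ * 1 := by rw [Matrix.l2_opNorm_conjTranspose]; gcongr
      _ = δ := by ring
  · have e : d - (δ : ℂ) • (V * V.conjTranspose) = W * (Matrix.diagonal (fun c => (l c : ℂ)) - (δ : ℂ) • g) * W.conjTranspose := by
      rw [hVV, Matrix.mul_sub, Matrix.sub_mul, ← hd', Matrix.mul_smul, Matrix.smul_mul]
    rw [e]
    refine Matrix.PosSemidef.mul_mul_conjTranspose_same ?_ W
    have : Matrix.diagonal (fun c => (l c : ℂ)) - (δ : ℂ) • g = Matrix.diagonal (fun c => ((if δ ≤ l c then l c - δ else l c : ℝ) : ℂ)) := by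
      simp only [g, ← Matrix.diagonal_smul, Matrix.diagonal_sub]; congr 1; funext c
      simp only [Pi.smul_apply, smul_eq_mul]; split_ifs <;> simp
    rw [this]
    refine Matrix.PosSemidef.diagonal fun c => ?_
    simp only [Pi.zero_apply, Complex.zero_le_real]
    split_ifs with h
    · linarith
    · exact hl c

section
variable {A N K M : Type} [CStarAlgebra A] [Fintype N] [DecidableEq N] [Fintype K] [DecidableEq K] {n : ℕ} 

lemma phi_left (q : A) (v : N → A) (x : Matrix N N ℂ) : phi (fun a => q * v a) x = q * phi v x * star q := by
  rw [phi_apply, phi_apply, Finset.mul_sum, Finset.sum_mul]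
  refine Finset.sum_congr rfl fun a _ => ?_
  rw [Finset.mul_sum, Finset.sum_mul]
  refine Finset.sum_congr rfl fun b _ => ?_
  rw [star_mul, mul_smul_comm, smul_mul_assoc]; simp only [mul_assoc]

lemma phi_psd [PartialOrder A] [StarOrderedRing A] (v : N → A) {x : Matrix N N ℂ} (hx : x.PosSemidef) : 0 ≤ phi v x := by
  obtain ⟨y, rfl⟩ := psd_ex hx
  rw [phi_star_mul]
  exact Finset.sum_nonneg fun c _ => star_mul_self_nonneg _

lemma phi_one (v : N → A) : phi v 1 = ∑ a, v a * star (v a) := by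
  rw [phi_apply]; simp [Matrix.one_apply, ite_smul]

lemma rowM_star_mul' [PartialOrder A] [StarOrderedRing A] (y z : N → A) (i j : Option N) :
    (star (rowM y) * rowM z) i j = star (i.elim 0 y) * (j.elim 0 z) := by
  rw [CStarMatrix.mul_apply, Fintype.sum_option, Finset.sum_eq_zero, add_zero]
  · rfl
  · intro a _
    rw [show rowM z (some a) j = 0 from rfl, mul_zero]

/-- nearly `p`-invariant rows can be compressed to honest rows of the corner -/
lemma rows_cut [PartialOrder A] [StarOrderedRing A] {blk : N → K} {J : K → Fin (n + 1)} {v : N → A} (h : IsRow blk J v)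
    {p : A} (hp : star p = p) (hpp : p * p = p) {ε : ℝ} (hε : 0 < ε) (hε1 : ε ≤ 1) 
    (hz : ‖phi (fun a => (1 - p) * v a) 1‖ ≤ ε) : ∃ T : N → A, IsRow blk J T ∧ (∀ a, p * T a = T a) ∧
      ∀ x, BD blk x → ‖phi T x - p * phi v x * p‖ ≤ (n + 1) * (12 * √ε) * ‖x‖ := by
  obtain ⟨T, hT, hT1, hT2⟩ := kr_rows (blk := blk) (J := J) (y := fun a => p * v a) (c := fun a => star (v a) * v a) hε hε1
    (fun a => star_mul_self_nonneg _) h.diag (fun a => (h.nrm_sq a).trans (by linarith)) (fun j => by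
      have e : star (rowM (rst (fun a => J (blk a) = j) fun a => p * v a)) * rowM (rst (fun a => J (blk a) = j) fun a => p * v a)
        - diagM (fun i => i.elim 0 (rst (fun a => J (blk a) = j) fun a => star (v a) * v a)) = 
        - (star (rowM (rst (fun a => J (blk a) = j) fun a => (1 - p) * v a)) * rowM (rst (fun a => J (blk a) = j) fun a => (1 - p) * v a)) := by
        rw [sub_eq_iff_eq_add, ← sub_eq_neg_add, eq_sub_iff_add_eq]
        ext i k
        rw [CStarMatrix.add_apply, rowM_star_mul', rowM_star_mul', diagM_apply]
        rcases i with _ | a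
        · simp
        rcases k with _ | b
        · simp
        simp only [Option.elim_some, Option.some.injEq]
        by_cases ha : J (blk a) = j
        · by_cases hb : J (blk b) = j
          · simp only [rst_pos (p := fun a => J (blk a) = j) ha, rst_pos (p := fun a => J (blk a) = j) hb]
            have e2 : star (p * v a) * (p * v b) + star ((1 - p) * v a) * ((1 - p) * v b) = star (v a) * v b := by
              have e3 : ∀ q : A, star q = q → q * q = q → star (q * v a) * (q * v b) = star (v a) * (q * v b) := fun q h1 h2 => by
                rw [star_mul, h1, mul_assoc, ← mul_assoc q q, h2]
              rw [e3 p hp hpp, e3 (1 - p) (by simp [hp]) (by simp [mul_sub, sub_mul, hpp])]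
              noncomm_ring
            rw [e2]
            split_ifs with hab
            · rw [hab]
            · exact h.off a b hab (ha.trans hb.symm)
          · rw [rst_neg (p := fun a => J (blk a) = j) hb, rst_neg (p := fun a => J (blk a) = j) hb, 
              if_neg (fun hab : a = b => hb (hab ▸ ha))]; simp
        · rw [rst_neg (p := fun a => J (blk a) = j) ha, rst_neg (p := fun a => J (blk a) = j) ha, rst_neg (p := fun a => J (blk a) = j) ha]; simp
      rw [e, norm_neg, CStarRing.norm_star_mul_self, ← pow_two]
      refine (rowM_phi_one _).trans (le_trans ?_ hz)
      rw [phi_one, phi_one]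
      refine CStarAlgebra.norm_le_norm_of_nonneg_of_le (Finset.sum_nonneg fun a _ => mul_star_self_nonneg _) (Finset.sum_le_sum fun a _ => ?_)
      by_cases ha : J (blk a) = j
      · rw [rst_pos (p := fun a => J (blk a) = j) ha]
      · rw [rst_neg (p := fun a => J (blk a) = j) ha, zero_mul]; exact mul_star_self_nonneg _)
  refine ⟨T, hT, hT2 p fun a => by rw [← mul_assoc, hpp], fun x hx => ?_⟩
  have := hT1 x hx
  rwa [phi_left, hp] at this
end
end

section

lemma rowND_corner {n : ℕ} {B D : Type} [CStarAlgebra B] [CStarAlgebra D] {p : D} (hpp : p * p = p) (hp : star p = p)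
    (ι : B →⋆ₙₐ[ℂ] D) (hι : Function.Injective ι) (h1 : ι 1 = p) (hr : Set.range ι = {x | p * x * p = x})
    (h : RowND n D) : RowND n B := by
  classical
  letI := CStarAlgebra.spectralOrder D
  letI := CStarAlgebra.spectralOrderedRing D
  intro S ε hε
  set R : ℝ := 1 + ∑ b ∈ S, ‖b‖ with hR
  have hR0 : 1 ≤ R := by have := Finset.sum_nonneg (fun b (_ : b ∈ S) => norm_nonneg b); linarith
  have hbR : ∀ b ∈ S, ‖b‖ ≤ R := fun b hb => by
    have := Finset.single_le_sum (fun b (_ : b ∈ S) => norm_nonneg b) hb; linarith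
  have hn : (1:ℝ) ≤ n + 1 := by have : (0:ℝ) ≤ n := by positivity
                                linarith
  obtain ⟨θ, hθ, hθ1, hθe⟩ : ∃ θ : ℝ, 0 < θ ∧ θ ≤ 1 ∧ (n + 1) * θ * R ≤ ε / 48 := by
    refine ⟨min 1 (ε / (48 * (n + 1) * R)), lt_min one_pos (by positivity), min_le_left _ _, ?_⟩
    calc _ ≤ ((n:ℝ) + 1) * (ε / (48 * (n + 1) * R)) * R := by gcongr; exact min_le_right _ _
      _ = _ := by field_simp
  have hθ2 : θ ^ 2 ≤ θ := by nlinarith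
  have hθ4 : θ ^ 4 ≤ (n + 1) * θ * R := by
    have h2 : θ ^ 4 ≤ θ := by
      have : θ ^ 4 = θ ^ 2 * θ ^ 2 := by ring
      rw [this]; nlinarith [sq_nonneg θ]
    have h3 : θ ≤ (n + 1) * θ := by nlinarith
    nlinarith
  obtain ⟨N, K, _, _, _, _, blk, J, v, ψ, hv, hψB, hψ, hψc, hS⟩ := h (insert p (S.image ι)) (θ ^ 4) (by positivity)
  have hpS := hS p (Finset.mem_insert_self _ _)
  have hd : (ψ p).PosSemidef := by
    obtain ⟨X, hX⟩ := hψ.factor (T := Unit) (fun _ => p)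
    have := hX () ()
    simp only [hp, hpp] at this
    rw [this]; exact Matrix.posSemidef_conjTranspose_mul_self _
  obtain ⟨M, _, _, blk', V, hV, hV1, hV2, hV3⟩ := cut_ex hd (hψB p) (δ := θ ^ 2) (by positivity)
  have hVn := iso_norm hV1
  have hv' := hv.conjV hV hV1
  have hz : ‖phi (fun i => (1 - p) * ∑ a, V a i • v a) 1‖ ≤ θ ^ 2 := by
    have hq : star (1 - p) = 1 - p := by simp [hp]
    have e1 : phi (fun i => (1 - p) * ∑ a, V a i • v a) 1 = (1 - p) * phi v (V * V.conjTranspose) * (1 - p) := by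
      have := phi_V v V 1
      rw [Matrix.mul_one] at this
      rw [phi_left, hq, this]
    have e2 := phi_psd (fun a => (1 - p) * v a) hV3
    rw [map_sub, map_smul, phi_left, phi_left, hq, ← e1, sub_nonneg] at e2
    have e3 : (1 - p) * phi v (ψ p) * (1 - p) = (1 - p) * (phi v (ψ p) - p) * (1 - p) := by
      have : (1 - p) * p = 0 := by simp [sub_mul, hpp]
      rw [mul_sub (1 - p) (phi v (ψ p)) p, this, sub_zero]
    have hqn : ‖1 - p‖ ≤ 1 := by
      have : star (1 - p) * (1 - p) = 1 - p := by rw [hq]; simp [sub_mul, mul_sub, hpp]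
      have h3 := CStarRing.norm_star_mul_self (x := 1 - p)
      rw [this] at h3
      nlinarith
    have e4 : ‖(1 - p) * phi v (ψ p) * (1 - p)‖ ≤ θ ^ 4 := by
      rw [e3]
      calc _ ≤ ‖1 - p‖ * ‖phi v (ψ p) - p‖ * ‖1 - p‖ := (norm_mul_le _ _).trans (by gcongr; exact norm_mul_le _ _)
        _ ≤ 1 * θ ^ 4 * 1 := by gcongr
        _ = _ := by ring
    have e5 := CStarAlgebra.norm_le_norm_of_nonneg_of_le (smul_nonneg (by positivity)
      (phi_psd (fun i => (1 - p) * ∑ a, V a i • v a) (Matrix.PosSemidef.one))) e2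
    rw [norm_smul, Complex.norm_real, Real.norm_of_nonneg (by positivity)] at e5
    have e6 : θ ^ 2 * ‖phi (fun i => (1 - p) * ∑ a, V a i • v a) 1‖ ≤ θ ^ 2 * θ ^ 2 := by linarith
    exact le_of_mul_le_mul_left e6 (by positivity)
  obtain ⟨T, hT, hpT, hT2⟩ := rows_cut hv' hp hpp (ε := θ ^ 2) (by positivity) (by linarith) hz
  obtain ⟨w, hw, hwp, hw2⟩ := row_corner hT hp hpT (δ := θ ^ 2) (by positivity) (by linarith)
  have hrw : ∀ a, ∃ b, ι b = w a := fun a => by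
    have : w a ∈ Set.range ι := by rw [hr]; exact hwp a
    exact this
  choose w' hw' using hrw
  have hιn : ∀ b, ‖ι b‖ = ‖b‖ := fun b => NonUnitalStarAlgHom.norm_map ι hι b
  have hrow : IsRow blk' J w' := by
    refine ⟨fun a b hab => hι ?_, fun a b hab hJ => hι ?_, fun a => ?_⟩
    · simp only [map_mul, map_star, hw']; exact hw.diag a b hab
    · simp only [map_mul, map_star, hw', map_zero]; exact hw.off a b hab hJ
    · rw [← hιn, hw']; exact hw.nrm a
  let ψι : B →ₗ[ℂ] Matrix N N ℂ := 
    { toFun := fun b => ψ (ι b)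
      map_add' := fun x y => by rw [map_add, map_add]
      map_smul' := fun c x => by rw [map_smul, map_smul]; rfl }
  let ψ' : B →ₗ[ℂ] Matrix M M ℂ := 
    { toFun := fun b => V.conjTranspose * ψ (ι b) * V
      map_add' := fun x y => by rw [map_add, map_add, Matrix.mul_add, Matrix.add_mul]
      map_smul' := fun c x => by rw [map_smul, map_smul, Matrix.mul_smul, Matrix.smul_mul]; rfl }
  have hψ' : ∀ b, ψ' b = V.conjTranspose * ψ (ι b) * V := fun _ => rfl
  have hcp : CPm ψ' := CPm.conj (ψ := ψι) (hψ.comp ι fun _ => rfl) V fun _ => rfl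
  have hc : ∀ b, ‖ψ' b‖ ≤ ‖b‖ := fun b => by
    rw [hψ']
    calc _ ≤ ‖V.conjTranspose‖ * ‖ψ (ι b)‖ * ‖V‖ := (Matrix.l2_opNorm_mul _ _).trans (by gcongr; exact Matrix.l2_opNorm_mul _ _)
      _ ≤ 1 * ‖b‖ * 1 := by rw [Matrix.l2_opNorm_conjTranspose, ← hιn b]; gcongr; exact hψc _
      _ = _ := by ring
  have hBD : ∀ b, BD blk' (ψ' b) := fun b i j hij => by
    rw [hψ', Matrix.mul_apply]
    refine Finset.sum_eq_zero fun c _ => ?_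
    by_cases hcj : blk c = blk' j
    · rw [Matrix.mul_apply, Finset.sum_eq_zero, zero_mul]
      intro e _
      by_cases hei : blk e = blk' i
      · rw [hψB _ e c (by rw [hei, hcj]; exact hij), mul_zero]
      · rw [Matrix.conjTranspose_apply, hV e i hei, star_zero, zero_mul]
    · rw [hV c j hcj, mul_zero]
  refine ⟨M, K, inferInstance, inferInstance, inferInstance, inferInstance, blk', J, w', ψ', hrow, hBD, hcp, hc, ?_⟩
  intro b hb
  have hbS := hS (ι b) (Finset.mem_insert_of_mem (Finset.mem_image_of_mem _ hb))
  have hιb : ‖ι b‖ ≤ R := (hιn b).trans_le (hbR b hb)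
  have hpb : p * ι b = ι b := by rw [← h1, ← map_mul, one_mul]
  have hbp : ι b * p = ι b := by rw [← h1, ← map_mul, mul_one]
  have hpb' : p * ι (star b) = ι (star b) := by rw [← h1, ← map_mul, one_mul]
  set q := V * V.conjTranspose with hq
  have hqh : q.conjTranspose = q := by rw [hq, Matrix.conjTranspose_mul, Matrix.conjTranspose_conjTranspose]
  have c1 := psi_cut hψ hψc hp hpp hpb hV2
  have c2 := psi_cut hψ hψc hp hpp hpb' hV2
  rw [Real.sqrt_sq hθ.le] at c1 c2
  rw [map_star, hψ.map_star, norm_star, ← Matrix.l2_opNorm_conjTranspose, Matrix.conjTranspose_mul, Matrix.conjTranspose_conjTranspose,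
    Matrix.conjTranspose_sub, Matrix.conjTranspose_one, hqh] at c2
  have hqn : ‖q‖ ≤ 1 := by
    calc _ ≤ ‖V‖ * ‖V.conjTranspose‖ := Matrix.l2_opNorm_mul _ _
      _ ≤ 1 * 1 := by rw [Matrix.l2_opNorm_conjTranspose]; gcongr
      _ = 1 := by norm_num
  have c3 : ‖ψ (ι b) - q * ψ (ι b) * q‖ ≤ 2 * (θ * R) := by
    have e : ψ (ι b) - q * ψ (ι b) * q = (1 - q) * ψ (ι b) + q * (ψ (ι b) * (1 - q)) := by noncomm_ring
    rw [e]
    have e1 : ‖q * (ψ (ι b) * (1 - q))‖ ≤ 1 * (θ * ‖ι b‖) := (norm_mul_le _ _).trans (by gcongr)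
    have e2 : θ * ‖ι b‖ ≤ θ * R := by gcongr
    exact (norm_add_le _ _).trans (by linarith)
  have hqe : q * ψ (ι b) * q = V * ψ' b * V.conjTranspose := by
    rw [hψ', hq]; simp only [Matrix.mul_assoc]
  have hqB : BD blk q := fun a c hac => by
    rw [hq, Matrix.mul_apply]
    refine Finset.sum_eq_zero fun i _ => ?_
    by_cases hai : blk a = blk' i
    · rw [Matrix.conjTranspose_apply, hV c i (fun h => hac (hai.trans h.symm)), star_zero, mul_zero]
    · rw [hV a i hai, zero_mul]
  have d1 := phi_row_le hv zero_le_one hv.nrm_sq (x := ψ (ι b) - q * ψ (ι b) * q) (BD.sub (hψB _) ((hqB.mul (hψB _)).mul hqB))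
  rw [map_sub, hqe, phi_V] at d1
  rw [hqe] at c3
  set v' : M → D := fun i => ∑ a, V a i • v a with hv'e
  have hpn : ‖p‖ ≤ 1 := by rw [← h1, hιn]; exact norm_one_le' B
  have d2 : ‖p * phi v' (ψ' b) * p - ι b‖ ≤ θ ^ 4 + (n + 1) * 1 * (2 * (θ * R)) := by
    have e : p * phi v' (ψ' b) * p - ι b = p * ((phi v (ψ (ι b)) - ι b) - (phi v (ψ (ι b)) - phi v' (ψ' b))) * p := by
      have : p * ι b * p = ι b := by rw [hpb, hbp]
      conv_lhs => rw [← this]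
      noncomm_ring
    rw [e]
    calc _ ≤ ‖p‖ * ‖(phi v (ψ (ι b)) - ι b) - (phi v (ψ (ι b)) - phi v' (ψ' b))‖ * ‖p‖ := (norm_mul_le _ _).trans (by gcongr; exact norm_mul_le _ _)
      _ ≤ 1 * (θ ^ 4 + (n + 1) * 1 * (2 * (θ * R))) * 1 := by
        gcongr
        refine (norm_sub_le _ _).trans (add_le_add hbS.le (d1.trans (by gcongr)))
      _ = _ := by ring
  have d3 := hT2 _ (hBD b)
  have d4 := hw2 _ (hBD b)
  have hψR : ‖ψ' b‖ ≤ R := (hc b).trans (hbR b hb)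
  rw [Real.sqrt_sq hθ.le] at d3
  have d3' : (n + 1) * (12 * θ) * ‖ψ' b‖ ≤ 12 * ((n + 1) * θ * R) := by
    calc _ ≤ ((n:ℝ) + 1) * (12 * θ) * R := by gcongr
      _ = _ := by ring
  have d4' : (n + 1) * θ ^ 2 * ‖ψ' b‖ ≤ (n + 1) * θ * R := by gcongr
  rw [← hιn, map_sub, phi_map]
  simp only [hw']
  have e : phi (fun a => w a) (ψ' b) - ι b = (phi w (ψ' b) - phi T (ψ' b)) + (phi T (ψ' b) - p * phi v' (ψ' b) * p) + (p * phi v' (ψ' b) * p - ι b) := by abel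
  rw [e]
  calc _ ≤ ‖phi w (ψ' b) - phi T (ψ' b)‖ + ‖phi T (ψ' b) - p * phi v' (ψ' b) * p‖ + ‖p * phi v' (ψ' b) * p - ι b‖ := norm_add₃_le
    _ < ε := by linarith
end

section

lemma rowND_finSat {n : ℕ} {B : CStarAlg} (h : FinSat (nucClass n) B) : RowND n B.carrier := by
  induction h with
  | base h => exact rowND_of_nd h.2
  | iso _ e ih => exact rowND_iso e.some ih
  | sum _ _ e i1 i2 => exact rowND_sum e.some i1 i2
  | matrix k _ e ih => exact rowND_matrix k e.some ih
  | corner p _ _ hpp hp hι ih =>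
    obtain ⟨ι, hi, h1, hr⟩ := hι
    exact rowND_corner hpp hp ι hi h1 hr ih

end

open TopologicalSpace in
theorem stmt6 (n : ℕ) (P A : Type) [CStarAlgebra P] [CStarAlgebra A]
    [SeparableSpace P] [SeparableSpace A]
    (ι : P →⋆ₐ[ℂ] A) (hι : Function.Injective ι)
    (E : A →ₗ[ℂ] P) (hE : IsCondExpect ι E)
    (hfaithful : ∀ x : A, E (star x * x) = 0 → x = 0)
    (m : ℕ) (u v : Fin m → A) (hqb : IsQuasiBasis ι E u v)
    (hRok : CondExpectHasRokhlin ι E (∑ i, u i * v i))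
    (hA : IsUnitalLocalAlg (nucClass n) A) :
    NuclearDimensionLE n P := by
  refine nd_of_rowND (rowND_of_rokhlin ι hι E hE m u v hqb hRok
    (rowND_of_starND (starND_of_local fun S ε hε => ?_)))
  obtain ⟨B, hB, φ, hφ⟩ := hA S ε hε
  exact ⟨B.carrier, inferInstance, starND_of_rowND (rowND_finSat hB), φ, hφ⟩

end
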